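/- arXiv:2006.10295 — 2 statements merged into one kernel-verified Lean document; each statement's English description precedes it below -/
import Mathlib

section
/- (Compositum Lemma, regular representations over ℚ) Let ℓ > 1 be an integer and G₁, G₂ finite groups with |G₁| = n and |G₂| = m. Suppose δ₁, δ₂ > 0 are such that for i = 1, 2 and for every ε > 0 there is a constant Cᵢ > 0 with |Cl_F[ℓ]| ≤ Cᵢ · Disc(F)^{1/2 − δᵢ + ε} for every Galois number field F over ℚ with Gal(F/ℚ) ≅ Gᵢ. Set δ = δ₁δ₂/(mδ₂ + nδ₁). Then for every ε > 0 there is a constant C > 0 such that |Cl_L[ℓ]| ≤ C · Disc(L)^{1/2 − δ + ε} for every Galois number field L over ℚ with Gal(L/ℚ) ≅ G₁ × G₂. -/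
open NumberField

/-- The number of `ℓ`-torsion elements in the class group of a number field `F`. -/
noncomputable def ellTorsion (F : Type*) [Field F] [NumberField F] (ℓ : ℕ) : ℕ :=
  Nat.card {x : ClassGroup (𝓞 F) // x ^ ℓ = 1}

theorem natAbs_discr_le_of_linearDisjoint {L : Type*} [Field L] [NumberField L]
    (K₁ K₂ : IntermediateField ℚ L) (h₁ : K₁.LinearDisjoint K₂) (h₂ : K₁ ⊔ K₂ = ⊤) :
    (discr L).natAbs ≤
      (discr K₁).natAbs ^ Module.finrank ℚ K₂ * (discr K₂).natAbs ^ Module.finrank ℚ K₁ := by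
  let _ : Algebra (FractionRing (𝓞 K₁)) (FractionRing (𝓞 L)) := FractionRing.liftAlgebra _ _
  have h_main := natAbs_discr_eq_absNorm_differentIdeal_mul_natAbs_discr_pow K₂ (𝓞 K₂) L (𝓞 L)
  have hdvd := IsDedekindDomain.differentIdeal_dvd_map_differentIdeal ℤ (𝓞 L) (𝓞 K₂) (𝓞 K₁)
    (F₁ := K₂) (F₂ := K₁) (by rwa [IntermediateField.linearDisjoint_comm]) (by rwa [sup_comm])
  have hle : Ideal.absNorm (differentIdeal (𝓞 K₂) (𝓞 L)) ≤
      (discr K₁).natAbs ^ Module.finrank ℚ K₂ := by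
    refine (Nat.le_of_dvd ?_ (map_dvd Ideal.absNorm hdvd)).trans_eq ?_
    · rw [Ideal.absNorm_algebraMap, absNorm_differentIdeal K₁]
      exact Nat.pow_pos (Int.natAbs_pos.mpr (discr_ne_zero _))
    · rw [Ideal.absNorm_algebraMap, absNorm_differentIdeal K₁,
        ← IsFractionRing.finrank_eq (𝓞 K₁) K₁ (𝓞 L) L, h₁.finrank_left_eq_finrank h₂]
  rw [h_main, h₁.finrank_right_eq_finrank h₂]
  gcongr

theorem exists_intermediateFields_of_mulEquiv_prod {L : Type*} [Field L] [NumberField L]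
    [IsGalois ℚ L] {G₁ G₂ : Type*} [Group G₁] [Group G₂] (e : (L ≃ₐ[ℚ] L) ≃* (G₁ × G₂)) :
    ∃ K₁ K₂ : IntermediateField ℚ L, IsGalois ℚ K₁ ∧ IsGalois ℚ K₂ ∧
      Nonempty ((K₁ ≃ₐ[ℚ] K₁) ≃* G₁) ∧ Nonempty ((K₂ ≃ₐ[ℚ] K₂) ≃* G₂) ∧
      K₁.LinearDisjoint K₂ ∧ K₁ ⊔ K₂ = ⊤ := by
  let f₁ : (L ≃ₐ[ℚ] L) →* G₁ := (MonoidHom.fst G₁ G₂).comp e.toMonoidHom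
  let f₂ : (L ≃ₐ[ℚ] L) →* G₂ := (MonoidHom.snd G₁ G₂).comp e.toMonoidHom
  have hf₁ : Function.Surjective f₁ := Prod.fst_surjective.comp e.surjective
  have hf₂ : Function.Surjective f₂ := Prod.snd_surjective.comp e.surjective
  have hinf : f₁.ker ⊓ f₂.ker = ⊥ := by
    rw [eq_bot_iff]
    intro x hx
    have h1 : (e x).1 = 1 := hx.1
    have h2 : (e x).2 = 1 := hx.2
    exact e.map_eq_one_iff.mp (Prod.ext h1 h2)
  have hsup : f₁.ker ⊔ f₂.ker = ⊤ := by
    rw [eq_top_iff]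
    intro x _
    have : x = e.symm (1, (e x).2) * e.symm ((e x).1, 1) := by
      rw [← map_mul]; simp
    rw [this]
    refine Subgroup.mul_mem_sup ?_ ?_
    · simp only [MonoidHom.mem_ker, f₁]; exact congrArg Prod.fst (e.apply_symm_apply _)
    · simp only [MonoidHom.mem_ker, f₂]; exact congrArg Prod.snd (e.apply_symm_apply _)
  have g₁ : IsGalois ℚ (IntermediateField.fixedField f₁.ker) :=
    IsGalois.of_fixedField_normal_subgroup _
  have g₂ : IsGalois ℚ (IntermediateField.fixedField f₂.ker) :=
    IsGalois.of_fixedField_normal_subgroup _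
  refine ⟨IntermediateField.fixedField f₁.ker, IntermediateField.fixedField f₂.ker,
    g₁, g₂,
    ⟨(IsGalois.normalAutEquivQuotient f₁.ker).symm.trans
      (QuotientGroup.quotientKerEquivOfSurjective f₁ hf₁)⟩,
    ⟨(IsGalois.normalAutEquivQuotient f₂.ker).symm.trans
      (QuotientGroup.quotientKerEquivOfSurjective f₂ hf₂)⟩,
    IntermediateField.LinearDisjoint.of_inf_eq_bot ?_, ?_⟩
  · have : IntermediateField.fixingSubgroup (IntermediateField.fixedField f₁.ker ⊓
        IntermediateField.fixedField f₂.ker) = ⊤ := by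
      rw [eq_top_iff, ← hsup, sup_le_iff]
      exact ⟨IntermediateField.le_iff_le _ _ |>.mp inf_le_left,
        IntermediateField.le_iff_le _ _ |>.mp inf_le_right⟩
    rw [← IsGalois.fixedField_fixingSubgroup (IntermediateField.fixedField f₁.ker ⊓
      IntermediateField.fixedField f₂.ker), this]
    exact IsGalois.fixedField_top
  · have : IntermediateField.fixingSubgroup (IntermediateField.fixedField f₁.ker ⊔
        IntermediateField.fixedField f₂.ker) = ⊥ := by
      rw [IntermediateField.fixingSubgroup_sup, IntermediateField.fixingSubgroup_fixedField,
        IntermediateField.fixingSubgroup_fixedField, hinf]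
    rw [← IsGalois.fixedField_fixingSubgroup (IntermediateField.fixedField f₁.ker ⊔
      IntermediateField.fixedField f₂.ker), this, IntermediateField.fixedField_bot]

section DivisorBound

theorem finite_dvd_of_ne_zero {R : Type*} [CommRing R] [IsDedekindDomain R] {I : Ideal R}
    (hI : I ≠ 0) : Finite {b : Ideal R // b ∣ I} :=
  have := UniqueFactorizationMonoid.fintypeSubtypeDvd I hI
  Finite.of_fintype _

theorem card_dvd_mul_le {R : Type*} [CommRing R] [IsDedekindDomain R] {I J : Ideal R}
    (hI : I ≠ 0) (hJ : J ≠ 0) :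
    Nat.card {b : Ideal R // b ∣ I * J} ≤
      Nat.card {b : Ideal R // b ∣ I} * Nat.card {b : Ideal R // b ∣ J} := by
  have := finite_dvd_of_ne_zero hI
  have := finite_dvd_of_ne_zero hJ
  rw [← Nat.card_prod]
  refine Nat.card_le_card_of_surjective
    (fun p : {b : Ideal R // b ∣ I} × {b : Ideal R // b ∣ J} ↦
      (⟨p.1.1 * p.2.1, mul_dvd_mul p.1.2 p.2.2⟩ : {b : Ideal R // b ∣ I * J})) ?_
  rintro ⟨b, hb⟩
  obtain ⟨x, y, hx, hy, rfl⟩ := exists_dvd_and_dvd_of_dvd_mul hb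
  exact ⟨⟨⟨x, hx⟩, ⟨y, hy⟩⟩, rfl⟩

theorem card_dvd_prime_pow_le {R : Type*} [CommRing R] [IsDedekindDomain R] {P : Ideal R}
    (hP : Prime P) (k : ℕ) : Nat.card {b : Ideal R // b ∣ P ^ k} ≤ k + 1 := by
  rw [← Nat.card_fin (k + 1)]
  refine Nat.card_le_card_of_surjective
    (fun i : Fin (k + 1) ↦ (⟨P ^ (i : ℕ), pow_dvd_pow _ (Nat.lt_succ_iff.mp i.2)⟩ :
      {b : Ideal R // b ∣ P ^ k})) ?_
  rintro ⟨b, hb⟩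
  obtain ⟨i, hi, h⟩ := (dvd_prime_pow hP k).mp hb
  exact ⟨⟨i, Nat.lt_succ_of_le hi⟩, Subtype.ext (associated_iff_eq.mp h).symm⟩

theorem card_dvd_multiset_prod_pow_le {R : Type*} [CommRing R] [IsDedekindDomain R]
    (s : Multiset (Ideal R)) (hs : ∀ P ∈ s, Prime P) (k : ℕ) :
    s.prod ≠ 0 ∧ Nat.card {b : Ideal R // b ∣ s.prod ^ k} ≤ (k + 1) ^ s.card := by
  induction s using Multiset.induction_on with
  | empty =>
    have : Unique {b : Ideal R // b ∣ (1 : Ideal R)} :=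
      ⟨⟨1, dvd_rfl⟩, fun b ↦ Subtype.ext (isUnit_iff_eq_one.mp (isUnit_of_dvd_one b.2))⟩
    rw [Multiset.prod_zero, one_pow, Nat.card_unique]
    simp
  | cons P s ih =>
    obtain ⟨h0, h1⟩ := ih fun Q hQ ↦ hs Q (Multiset.mem_cons_of_mem hQ)
    have hP := hs P (Multiset.mem_cons_self P s)
    rw [Multiset.prod_cons, mul_pow, Multiset.card_cons, pow_succ']
    exact ⟨mul_ne_zero hP.ne_zero h0, (card_dvd_mul_le (pow_ne_zero _ hP.ne_zero)
      (pow_ne_zero _ h0)).trans (Nat.mul_le_mul (card_dvd_prime_pow_le hP k) h1)⟩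

theorem card_normalizedFactors_le_finrank (L : Type*) [Field L] [NumberField L] {p : ℕ}
    (hp : p.Prime) :
    (UniqueFactorizationMonoid.normalizedFactors
      (Ideal.span {(p : 𝓞 L)})).card ≤ Module.finrank ℚ L := by
  have hp0 : Ideal.span {(p : 𝓞 L)} ≠ 0 := by
    simpa [Ideal.span_singleton_eq_bot] using hp.ne_zero
  have hnorm : Ideal.absNorm (Ideal.span {(p : 𝓞 L)}) = p ^ Module.finrank ℚ L := by
    have := Ideal.absNorm_span_natCast (S := 𝓞 L) p
    rw [this, RingOfIntegers.rank]
  have hprod := UniqueFactorizationMonoid.prod_normalizedFactors_eq hp0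
  rw [normalize_eq] at hprod
  set s := UniqueFactorizationMonoid.normalizedFactors (Ideal.span {(p : 𝓞 L)})
  refine (Nat.pow_le_pow_iff_right hp.one_lt).mp ?_
  rw [← hnorm, ← hprod, map_multiset_prod, ← Multiset.card_map Ideal.absNorm s]
  refine Multiset.pow_card_le_prod fun x hx ↦ ?_
  obtain ⟨P, hP, rfl⟩ := Multiset.mem_map.mp hx
  have hdvd := map_dvd Ideal.absNorm (UniqueFactorizationMonoid.dvd_of_mem_normalizedFactors hP)
  rw [hnorm] at hdvd
  obtain ⟨f, -, hf⟩ := (Nat.dvd_prime_pow hp).mp hdvd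
  have hP' := UniqueFactorizationMonoid.prime_of_normalized_factor P hP
  have : f ≠ 0 := by
    rintro rfl
    rw [pow_zero, Ideal.absNorm_eq_one_iff] at hf
    exact hP'.not_isUnit (Ideal.isUnit_iff.mpr hf)
  rw [hf]
  exact Nat.le_self_pow this p

theorem card_dvd_span_natCast_le (L : Type*) [Field L] [NumberField L] {m : ℕ} (hm : m ≠ 0) :
    Nat.card {b : Ideal (𝓞 L) // b ∣ Ideal.span {(m : 𝓞 L)}} ≤
      ∏ p ∈ m.primeFactors, (m.factorization p + 1) ^ Module.finrank ℚ L := by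
  have key : ∀ s : Finset ℕ, (∀ p ∈ s, p.Prime) →
      Nat.card {b : Ideal (𝓞 L) // b ∣ Ideal.span {((∏ p ∈ s, p ^ m.factorization p : ℕ) : 𝓞 L)}} ≤
      ∏ p ∈ s, (m.factorization p + 1) ^ Module.finrank ℚ L := by
    intro s
    induction s using Finset.induction_on with
    | empty =>
      intro _
      have := (card_dvd_multiset_prod_pow_le (R := 𝓞 L) 0 (by simp) 0).2
      simpa [Ideal.one_eq_top, Ideal.span_singleton_one] using this
    | insert p s hp ih =>
      intro hs
      have hpp := hs p (Finset.mem_insert_self p s)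
      have hs' : ∀ q ∈ s, q.Prime := fun q hq ↦ hs q (Finset.mem_insert_of_mem hq)
      have hp0 : Ideal.span {(p : 𝓞 L)} ≠ 0 := by
        simpa [Ideal.span_singleton_eq_bot] using hpp.ne_zero
      have hs0 : Ideal.span {((∏ p ∈ s, p ^ m.factorization p : ℕ) : 𝓞 L)} ≠ 0 := by
        rw [Ne, Ideal.zero_eq_bot, Ideal.span_singleton_eq_bot, Nat.cast_eq_zero]
        exact Finset.prod_ne_zero_iff.mpr fun q hq ↦ pow_ne_zero _ (hs' q hq).ne_zero
      rw [Finset.prod_insert hp, Finset.prod_insert hp, Nat.cast_mul,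
        ← Ideal.span_singleton_mul_span_singleton, Nat.cast_pow, ← Ideal.span_singleton_pow]
      refine (card_dvd_mul_le (pow_ne_zero _ hp0) hs0).trans (Nat.mul_le_mul ?_ (ih hs'))
      have hprod := UniqueFactorizationMonoid.prod_normalizedFactors_eq hp0
      rw [normalize_eq] at hprod
      rw [← hprod]
      exact (card_dvd_multiset_prod_pow_le _
        (fun P hP ↦ UniqueFactorizationMonoid.prime_of_normalized_factor P hP) _).2.trans
        (Nat.pow_le_pow_right (Nat.succ_pos _) (card_normalizedFactors_le_finrank L hpp))
  have := key m.primeFactors fun p hp ↦ Nat.prime_of_mem_primeFactors hp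
  rwa [← Nat.prod_factorization_eq_prod_primeFactors (f := fun p k ↦ p ^ k),
    Nat.prod_factorization_pow_eq_self hm] at this

theorem exists_add_one_pow_le (N : ℕ) {ε : ℝ} (hε : 0 < ε) :
    ∃ A : ℝ, 1 ≤ A ∧ ∀ k : ℕ, ((k : ℝ) + 1) ^ N ≤ A * (2 : ℝ) ^ (k * ε) := by
  obtain ⟨A, hA⟩ : ∃ A : ℝ, ∀ k : ℕ, ((k : ℝ) + 1) ^ N / (2 : ℝ) ^ (k * ε) ≤ A := by
    have h : Filter.Tendsto (fun k : ℕ ↦ ((k + 1 : ℕ) : ℝ) ^ N / ((2 : ℝ) ^ ε) ^ (k + 1))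
        Filter.atTop (nhds 0) :=
      (Filter.tendsto_add_atTop_iff_nat 1).mpr (tendsto_pow_const_div_const_pow_of_one_lt N
        (Real.one_lt_rpow one_lt_two hε))
    obtain ⟨A, hA⟩ := h.bddAbove_range
    refine ⟨A * (2 : ℝ) ^ ε, fun k ↦ ?_⟩
    have h1 : ((k + 1 : ℕ) : ℝ) ^ N / ((2 : ℝ) ^ ε) ^ (k + 1) ≤ A := hA ⟨k, rfl⟩
    rw [div_le_iff₀ (by positivity)] at h1 ⊢
    push_cast at h1
    rwa [pow_succ, ← Real.rpow_natCast ((2 : ℝ) ^ ε), ← Real.rpow_mul (by norm_num), mul_comm ε,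
      mul_comm _ ((2 : ℝ) ^ ε), ← mul_assoc] at h1
  refine ⟨max A 1, le_max_right _ _, fun k ↦ ?_⟩
  have := (hA k).trans (le_max_left A 1)
  rwa [div_le_iff₀ (by positivity)] at this

theorem exists_prod_factorization_le (N : ℕ) {ε : ℝ} (hε : 0 < ε) :
    ∃ C : ℝ, 0 < C ∧ ∀ m : ℕ, m ≠ 0 →
      ((∏ p ∈ m.primeFactors, (m.factorization p + 1) ^ N : ℕ) : ℝ) ≤ C * (m : ℝ) ^ ε := by
  obtain ⟨A, hA1, hA⟩ := exists_add_one_pow_le N hε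
  obtain ⟨P, hP⟩ := exists_nat_ge ((2 : ℝ) ^ (N / ε))
  refine ⟨A ^ P, by positivity, fun m hm ↦ ?_⟩
  have hm' : (m : ℝ) ^ ε = ∏ p ∈ m.primeFactors, (p : ℝ) ^ (m.factorization p * ε) := by
    conv_lhs => rw [← Nat.prod_factorization_pow_eq_self hm,
      Nat.prod_factorization_eq_prod_primeFactors]
    push_cast
    rw [← Real.finsetProd_rpow _ _ (fun _ _ ↦ by positivity)]
    refine Finset.prod_congr rfl fun p _ ↦ ?_
    rw [Real.rpow_mul (by positivity), Real.rpow_natCast]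
  have hAP : ∏ p ∈ m.primeFactors, (if p < P then A else 1) ≤ A ^ P := by
    rw [Finset.prod_ite, Finset.prod_const, Finset.prod_const_one, mul_one]
    refine pow_le_pow_right₀ hA1 ?_
    calc _ ≤ (Finset.range P).card := Finset.card_le_card fun p hp ↦ by
          simp only [Finset.mem_filter] at hp; simpa using hp.2
      _ = P := Finset.card_range P
  calc ((∏ p ∈ m.primeFactors, (m.factorization p + 1) ^ N : ℕ) : ℝ)
      ≤ ∏ p ∈ m.primeFactors, ((if p < P then A else 1) * (p : ℝ) ^ (m.factorization p * ε)) := by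
        push_cast
        refine Finset.prod_le_prod (fun _ _ ↦ by positivity) fun p hp ↦ ?_
        have hp2 : (2 : ℝ) ≤ p := by exact_mod_cast (Nat.prime_of_mem_primeFactors hp).two_le
        set k := m.factorization p
        split_ifs with h
        · refine (hA k).trans ?_
          gcongr
        · rw [one_mul]
          have h2 : (k : ℝ) + 1 ≤ 2 ^ k := by exact_mod_cast Nat.lt_two_pow_self (n := k)
          calc ((k : ℝ) + 1) ^ N ≤ (2 ^ k) ^ N := by gcongr
            _ = ((2 : ℝ) ^ (N / ε)) ^ (k * ε) := by
              rw [← pow_mul, ← Real.rpow_mul (by norm_num), ← Real.rpow_natCast]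
              congr 1
              push_cast
              field_simp
            _ ≤ (p : ℝ) ^ (k * ε) := by
              have : (2 : ℝ) ^ (N / ε) ≤ p := hP.trans (by exact_mod_cast not_lt.mp h)
              gcongr
    _ = (∏ p ∈ m.primeFactors, (if p < P then A else 1)) * (m : ℝ) ^ ε := by
        rw [Finset.prod_mul_distrib, hm']
    _ ≤ A ^ P * (m : ℝ) ^ ε := by gcongr

end DivisorBound

section BoundedIntegers

theorem finite_polynomials_of_coeff_le (N : ℕ) (C : ℤ) :
    {f : Polynomial ℤ | f.natDegree ≤ N ∧ ∀ i, |f.coeff i| ≤ C}.Finite := by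
  refine Set.Finite.of_finite_image (f := fun f (i : Fin (N + 1)) ↦ f.coeff i)
    ((Set.Finite.pi' fun _ : Fin (N + 1) ↦ Set.finite_Icc (-C) C).subset ?_) ?_
  · rintro _ ⟨f, hf, rfl⟩ i
    exact abs_le.mp (hf.2 i)
  · intro f hf g hg h
    ext i
    by_cases hi : i < N + 1
    · exact congrFun h ⟨i, hi⟩
    · rw [Polynomial.coeff_eq_zero_of_natDegree_lt (by have := hf.1; omega),
        Polynomial.coeff_eq_zero_of_natDegree_lt (by have := hg.1; omega)]

theorem exists_card_le_of_infinitePlace_le (N : ℕ) (B : ℝ) :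
    ∃ M : ℕ, ∀ (L : Type*) [Field L] [NumberField L], Module.finrank ℚ L = N →
      ∀ s : Finset (𝓞 L), (∀ x ∈ s, ∀ w : InfinitePlace L, w (x : L) ≤ B) → s.card ≤ M := by
  set C : ℤ := ⌈max B 1 ^ N * (N.choose (N / 2) : ℝ)⌉
  have hfin := finite_polynomials_of_coeff_le N C
  refine ⟨hfin.toFinset.card * N, fun L _ _ hL s hs ↦ ?_⟩
  classical
  have hmin (x : 𝓞 L) : minpoly ℚ (x : L) = (minpoly ℤ (x : L)).map (algebraMap ℤ ℚ) :=
    minpoly.isIntegrallyClosed_eq_field_fractions' ℚ (RingOfIntegers.isIntegral_coe x)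
  have hsub : s.image (fun x : 𝓞 L ↦ (x : L)) ⊆
      (hfin.toFinset.filter (· ≠ 0)).biUnion fun f ↦ (f.map (algebraMap ℤ L)).roots.toFinset := by
    intro y hy
    obtain ⟨x, hx, rfl⟩ := Finset.mem_image.mp hy
    have hxi : IsIntegral ℤ (x : L) := RingOfIntegers.isIntegral_coe x
    rw [Finset.mem_biUnion]
    refine ⟨minpoly ℤ (x : L), ?_, ?_⟩
    · rw [Finset.mem_filter, Set.Finite.mem_toFinset]
      refine ⟨⟨?_, fun i ↦ ?_⟩, minpoly.ne_zero hxi⟩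
      · rw [← hL, ← Polynomial.natDegree_map_eq_of_injective
          (RingHom.injective_int (algebraMap ℤ ℚ)), ← hmin]
        exact minpoly.natDegree_le (x : L)
      · have h1 := Embeddings.coeff_bdd_of_norm_le
          ((InfinitePlace.le_iff_le (x : L) B).mp (hs x hx)) i
        rw [hmin, Polynomial.coeff_map, hL, eq_intCast] at h1
        have h2 : ((|(minpoly ℤ (x : L)).coeff i| : ℤ) : ℝ) ≤ C := by
          refine le_trans (le_of_eq ?_) (h1.trans (Int.le_ceil _))
          rw [Int.norm_cast_rat, Int.norm_eq_abs, Int.cast_abs]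
        exact_mod_cast h2
    · rw [Multiset.mem_toFinset, Polynomial.mem_roots_map_of_injective
        (RingHom.injective_int (algebraMap ℤ L)) (minpoly.ne_zero hxi)]
      exact minpoly.aeval ℤ (x : L)
  rw [← Finset.card_image_of_injective s RingOfIntegers.coe_injective]
  refine (Finset.card_le_card hsub).trans ((Finset.card_biUnion_le_card_mul _ _ N ?_).trans
    (Nat.mul_le_mul_right N (Finset.card_filter_le _ _)))
  intro f hf
  rw [Finset.mem_filter, Set.Finite.mem_toFinset] at hf
  exact (Multiset.toFinset_card_le _).trans ((Polynomial.card_roots' _).trans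
    ((Polynomial.natDegree_map_le).trans hf.1.1))

theorem exists_card_le_of_span_eq (N : ℕ) {ε : ℝ} (hε : 0 < ε) :
    ∃ C : ℝ, 0 < C ∧ ∀ (L : Type*) [Field L] [NumberField L], Module.finrank ℚ L = N →
      ∀ (s : Finset (𝓞 L)) (f : InfinitePlace L → ℝ) (T : ℝ), 1 ≤ T →
        (∀ x ∈ s, x ≠ 0) → (∀ x ∈ s, ∀ y ∈ s, Ideal.span {x} = Ideal.span {y}) →
        (∀ x ∈ s, ∀ w : InfinitePlace L, w (x : L) ≤ f w) →
        (∀ x ∈ s, ∀ w : InfinitePlace L, f w ≤ T * w (x : L)) →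
        (s.card : ℝ) ≤ C * T ^ ε := by
  obtain ⟨M, hM⟩ := exists_card_le_of_infinitePlace_le N (Real.exp 1)
  obtain ⟨A, hA1, hA⟩ := exists_add_one_pow_le N hε
  refine ⟨A * (M + 1), by positivity, fun L _ _ hL s f T hT hs0 hs hle hge ↦ ?_⟩
  classical
  set k := ⌊Real.log T⌋₊
  let g : 𝓞 L → InfinitePlace L → ℕ := fun x w ↦ ⌊Real.log (f w / w (x : L))⌋₊
  have hpos : ∀ x ∈ s, ∀ w : InfinitePlace L, 0 < w (x : L) := fun x hx w ↦
    InfinitePlace.pos_iff.mpr (RingOfIntegers.coe_ne_zero_iff.mpr (hs0 x hx))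
  have hmaps : ∀ x ∈ s, g x ∈ Fintype.piFinset fun _ : InfinitePlace L ↦ Finset.range (k + 1) := by
    intro x hx
    rw [Fintype.mem_piFinset]
    intro w
    rw [Finset.mem_range, Nat.lt_succ_iff]
    refine Nat.floor_le_floor (Real.log_le_log
      (div_pos ((hpos x hx w).trans_le (hle x hx w)) (hpos x hx w)) ?_)
    rw [div_le_iff₀ (hpos x hx w)]
    exact hge x hx w
  have hfib : ∀ y ∈ Fintype.piFinset fun _ : InfinitePlace L ↦ Finset.range (k + 1),
      (s.filter (g · = y)).card ≤ M := by
    intro y _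
    rcases (s.filter (g · = y)).eq_empty_or_nonempty with h | ⟨x₀, hx₀⟩
    · simp [h]
    have hx₀s := (Finset.mem_filter.mp hx₀).1
    have hu : ∀ x ∈ s.filter (g · = y), ∃ u : 𝓞 L, x = x₀ * u := by
      intro x hx
      have : x ∈ Ideal.span {x₀} := by
        rw [← hs x (Finset.mem_filter.mp hx).1 x₀ hx₀s]
        exact Ideal.mem_span_singleton_self x
      exact Ideal.mem_span_singleton.mp this
    choose! u hu using hu
    rw [← Finset.card_image_of_injOn (f := u)]
    · refine hM L hL _ fun z hz w ↦ ?_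
      obtain ⟨x, hx, rfl⟩ := Finset.mem_image.mp hz
      have hxs := (Finset.mem_filter.mp hx).1
      have hg : g x w = g x₀ w := by
        rw [(Finset.mem_filter.mp hx).2, (Finset.mem_filter.mp hx₀).2]
      have h1 := hpos x hxs w
      have h2 := hpos x₀ hx₀s w
      have h3 := h1.trans_le (hle x hxs w)
      have hwu : w (u x : L) = w (x : L) / w (x₀ : L) := by
        have h4 : (x : L) = (x₀ : L) * (u x : L) := by
          exact (congrArg (algebraMap (𝓞 L) L) (hu x hx)).trans (map_mul _ _ _)
        rw [h4, map_mul, mul_div_cancel_left₀ _ h2.ne']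
      have hx_ge : 0 ≤ Real.log (f w / w (x : L)) :=
        Real.log_nonneg ((one_le_div h1).mpr (hle x hxs w))
      have ha : Real.log (f w / w (x₀ : L)) < g x₀ w + 1 := Nat.lt_floor_add_one _
      have hb : (g x w : ℝ) ≤ Real.log (f w / w (x : L)) := Nat.floor_le hx_ge
      rw [hg] at hb
      rw [Real.log_div h3.ne' h2.ne'] at ha
      rw [Real.log_div h3.ne' h1.ne'] at hb
      rw [hwu, ← Real.log_le_iff_le_exp (div_pos h1 h2), Real.log_div h1.ne' h2.ne']
      linarith
    · intro x hx x' hx' h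
      rw [hu x hx, hu x' hx', h]
  have hcard := Finset.card_le_mul_card_image_of_maps_to hmaps M hfib
  rw [Fintype.card_piFinset, Finset.prod_const, Finset.card_univ, Finset.card_range] at hcard
  have hw : Fintype.card (InfinitePlace L) ≤ N := by
    rw [← hL, ← Embeddings.card L ℂ]
    exact Fintype.card_le_of_surjective InfinitePlace.mk fun w ↦ ⟨w.embedding, w.mk_embedding⟩
  calc (s.card : ℝ) ≤ ((M * (k + 1) ^ Fintype.card (InfinitePlace L) : ℕ) : ℝ) := by
        exact_mod_cast hcard
    _ ≤ M * ((k : ℝ) + 1) ^ N := by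
        push_cast
        gcongr
        linarith [(Nat.cast_nonneg k : (0 : ℝ) ≤ k)]
    _ ≤ M * (A * (2 : ℝ) ^ (k * ε)) := by gcongr; exact hA k
    _ ≤ M * (A * T ^ ε) := by
        gcongr
        have h2 : (2 : ℝ) ≤ Real.exp 1 := by linarith [Real.add_one_le_exp 1]
        calc (2 : ℝ) ^ (k * ε) ≤ Real.exp 1 ^ (k * ε) := by gcongr
          _ = Real.exp k ^ ε := by
            rw [Real.rpow_mul (Real.exp_pos 1).le, Real.exp_one_rpow]
          _ ≤ T ^ ε := by
            have : Real.exp k ≤ T := by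
              rw [← Real.le_log_iff_exp_le (by linarith)]
              exact Nat.floor_le (Real.log_nonneg hT)
            gcongr
    _ ≤ A * (M + 1) * T ^ ε := by
        have : 0 ≤ A * T ^ ε := by positivity
        nlinarith

end BoundedIntegers

section LatticePoints

open MeasureTheory Module ZSpan mixedEmbedding
open scoped NNReal ENNReal nonZeroDivisors

theorem MeasureTheory.IsAddFundamentalDomain.measure_le_of_card_le {E : Type*} [AddCommGroup E]
    [MeasurableSpace E] [MeasurableAdd₂ E] {μ : Measure E} [μ.IsAddLeftInvariant]
    {G : AddSubgroup E} [Countable G] {F A : Set E} (hF : IsAddFundamentalDomain G F μ)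
    (hA : MeasurableSet A) (n : ℕ)
    (h : ∀ t : Finset G, (∀ g ∈ t, ∃ x ∈ A, ∃ y ∈ A, (g : E) = x - y) → t.card ≤ n) :
    μ A ≤ n * μ F := by
  classical
  rw [← lintegral_indicator_one hA, hF.lintegral_eq_tsum'', ← lintegral_tsum]
  · refine (lintegral_mono (g := fun _ ↦ (n : ℝ≥0∞)) fun x ↦ ?_).trans_eq (by simp)
    rw [ENNReal.tsum_eq_iSup_sum]
    refine iSup_le fun t ↦ ?_
    have hsum : ∑ g ∈ t, A.indicator (1 : E → ℝ≥0∞) (g +ᵥ x) =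
        (t.filter fun g ↦ g +ᵥ x ∈ A).card := by
      rw [Finset.card_filter, Nat.cast_sum]
      refine Finset.sum_congr rfl fun g _ ↦ ?_
      by_cases hg : g +ᵥ x ∈ A <;> simp [hg]
    rw [hsum]
    refine Nat.cast_le.mpr ?_
    rcases (t.filter fun g ↦ g +ᵥ x ∈ A).eq_empty_or_nonempty with he | ⟨g₀, hg₀⟩
    · simp [he]
    rw [← Finset.card_image_of_injective _ (sub_left_injective (b := g₀))]
    refine h _ fun g hg ↦ ?_
    obtain ⟨g', hg', rfl⟩ := Finset.mem_image.mp hg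
    refine ⟨_, (Finset.mem_filter.mp hg').2, _, (Finset.mem_filter.mp hg₀).2, ?_⟩
    simp [AddSubgroup.vadd_def]
  · intro g
    exact ((measurable_const.indicator hA).comp (measurable_const_add (g : E))).aemeasurable

theorem MeasureTheory.IsAddFundamentalDomain.card_mul_le_measure {E : Type*} [AddCommGroup E]
    [MeasurableSpace E] [MeasurableAdd₂ E] {μ : Measure E} [μ.IsAddLeftInvariant]
    {G : AddSubgroup E} [Countable G] {F A : Set E} (hF : IsAddFundamentalDomain G F μ)
    (hA : MeasurableSet A) (t : Finset G)
    (h : ∀ x : E, ∃ g₀ : G, ∀ g ∈ t, (g₀ : E) + g + x ∈ A) :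
    t.card * μ F ≤ μ A := by
  classical
  rw [← lintegral_indicator_one hA, hF.lintegral_eq_tsum'', ← lintegral_tsum]
  · refine le_trans (by simp) (lintegral_mono (f := fun _ ↦ (t.card : ℝ≥0∞)) fun x ↦ ?_)
    obtain ⟨g₀, hg₀⟩ := h x
    refine le_trans ?_ (ENNReal.sum_le_tsum (t.image (g₀ + ·)))
    rw [Finset.sum_image fun _ _ _ _ h ↦ add_left_cancel h,
      Finset.sum_congr rfl fun g hg ↦ Set.indicator_of_mem
        (show (g₀ + g) +ᵥ x ∈ A from hg₀ g hg) _]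
    simp
  · intro g
    exact ((measurable_const.indicator hA).comp (measurable_const_add (g : E))).aemeasurable

variable {K : Type*} [Field K]

theorem mem_convexBodyLT_iff {f : InfinitePlace K → ℝ≥0} {x : mixedSpace K} :
    x ∈ convexBodyLT K f ↔ ∀ w, normAtPlace w x < f w := by
  simp only [Set.mem_prod, Set.mem_pi, Set.mem_univ, forall_true_left, mem_ball_zero_iff,
    Subtype.forall]
  refine ⟨fun h w ↦ ?_, fun h ↦ ⟨fun w hw ↦ ?_, fun w hw ↦ ?_⟩⟩
  · by_cases hw : w.IsReal
    · rw [normAtPlace_apply_of_isReal hw]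
      exact h.1 w hw
    · rw [InfinitePlace.not_isReal_iff_isComplex] at hw
      rw [normAtPlace_apply_of_isComplex hw]
      exact h.2 w hw
  · rw [← normAtPlace_apply_of_isReal hw]
    exact h w
  · rw [← normAtPlace_apply_of_isComplex hw]
    exact h w

theorem measurableSet_convexBodyLT [NumberField K] (f : InfinitePlace K → ℝ≥0) :
    MeasurableSet (convexBodyLT K f) :=
  (MeasurableSet.univ_pi fun _ ↦ measurableSet_ball).prod
    (MeasurableSet.univ_pi fun _ ↦ measurableSet_ball)

variable [NumberField K]

theorem one_le_abs_discr : 1 ≤ |(discr K : ℝ)| := by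
  exact_mod_cast Int.one_le_abs (discr_ne_zero K)

theorem finite_ringOfIntegers_of_infinitePlace_lt (f : InfinitePlace K → ℝ≥0) :
    {x : 𝓞 K | ∀ w : InfinitePlace K, w (x : K) < f w}.Finite := by
  refine Set.Finite.of_finite_image (f := fun x : 𝓞 K ↦ (x : K)) ?_
    RingOfIntegers.coe_injective.injOn
  refine (Embeddings.finite_of_norm_le K ℂ (∑ w, f w : ℝ≥0)).subset ?_
  rintro _ ⟨x, hx, rfl⟩
  refine ⟨x.isIntegral_coe, (InfinitePlace.le_iff_le (x : K) _).mp fun w ↦ ?_⟩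
  refine (hx w).le.trans ?_
  exact_mod_cast Finset.single_le_sum (f := f) (fun _ _ ↦ zero_le) (Finset.mem_univ w)

theorem prod_le_card_mul_sqrt_discr (I : Ideal (𝓞 K)) (hI : I ≠ ⊥) (f : InfinitePlace K → ℝ≥0) :
    ∃ s : Finset (𝓞 K), (∀ x ∈ s, x ∈ I ∧ ∀ w : InfinitePlace K, w (x : K) < f w) ∧
      (∏ w, (f w : ℝ) ^ w.mult) ≤
        2 ^ finrank ℚ K * (s.card * (Ideal.absNorm I * √|(discr K : ℝ)|)) := by
  classical
  set T : Set (𝓞 K) := {x | x ∈ I ∧ ∀ w : InfinitePlace K, w (x : K) < f w}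
  have hT : T.Finite := (finite_ringOfIntegers_of_infinitePlace_lt f).subset fun x hx ↦ hx.2
  refine ⟨hT.toFinset, fun x hx ↦ hT.mem_toFinset.mp hx, ?_⟩
  let J : (FractionalIdeal (𝓞 K)⁰ K)ˣ :=
    Units.mk0 (I : FractionalIdeal (𝓞 K)⁰ K) (FractionalIdeal.coeIdeal_ne_zero.mpr hI)
  have hfund := ZSpan.isAddFundamentalDomain' (fractionalIdealLatticeBasis K J) volume
  have : Countable (Submodule.span ℤ
      (Set.range (fractionalIdealLatticeBasis K J))).toAddSubgroup := by
    change Countable (Submodule.span ℤ (Set.range (fractionalIdealLatticeBasis K J)))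
    infer_instance
  have hle := hfund.measure_le_of_card_le
    (measurableSet_convexBodyLT fun w ↦ f w / 2) hT.toFinset.card ?_
  · rw [convexBodyLT_volume, volume_fundamentalDomain_fractionalIdealLatticeBasis,
      volume_fundamentalDomain_latticeBasis] at hle
    have hle' := ENNReal.toReal_mono (by finiteness) hle
    simp only [ENNReal.toReal_mul, ENNReal.toReal_pow, ENNReal.toReal_natCast,
      ENNReal.coe_toReal, NNReal.coe_mul, NNReal.coe_pow, NNReal.coe_prod, NNReal.coe_div,
      ENNReal.toReal_inv, convexBodyLTFactor, NNReal.coe_real_pi, NNReal.coe_ofNat,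
      div_pow, Finset.prod_div_distrib, Finset.prod_pow_eq_pow_sum,
      InfinitePlace.sum_mult_eq] at hle'
    have hJ : (ENNReal.ofReal (FractionalIdeal.absNorm (J : FractionalIdeal (𝓞 K)⁰ K) : ℚ)).toReal
        = Ideal.absNorm I := by
      rw [show (J : FractionalIdeal (𝓞 K)⁰ K) = I from rfl, FractionalIdeal.coeIdeal_absNorm]
      simp
    rw [hJ, Real.coe_sqrt, coe_nnnorm, Int.norm_eq_abs, ENNReal.toReal_ofNat] at hle'
    set P := ∏ w, (f w : ℝ) ^ w.mult
    set r₁ := InfinitePlace.nrRealPlaces K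
    set r₂ := InfinitePlace.nrComplexPlaces K
    have hP : 0 ≤ P := by positivity
    have h1 : (1 : ℝ) ≤ 2 ^ r₁ * Real.pi ^ r₂ :=
      one_le_mul_of_one_le_of_one_le (one_le_pow₀ one_le_two)
        (one_le_pow₀ (by linarith [Real.pi_gt_three]))
    have h2 : ((2 : ℝ)⁻¹) ^ r₂ ≤ 1 := pow_le_one₀ (by positivity) (by norm_num)
    rw [← div_le_iff₀' (by positivity)]
    calc P / 2 ^ finrank ℚ K ≤ 2 ^ r₁ * Real.pi ^ r₂ * (P / 2 ^ finrank ℚ K) :=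
          le_mul_of_one_le_left (by positivity) h1
      _ ≤ _ := hle'
      _ ≤ _ := by
        gcongr
        exact mul_le_of_le_one_left (by positivity) h2
  · intro t ht
    have key : ∀ g ∈ t, ∃ x ∈ hT.toFinset, mixedEmbedding K (x : K) = g := by
      intro g hg
      obtain ⟨x, hx, y, hy, hxy⟩ := ht g hg
      obtain ⟨a, ha, hag⟩ := (mem_span_fractionalIdealLatticeBasis K J).mp g.2
      obtain ⟨b, hb, rfl⟩ := (FractionalIdeal.mem_coeIdeal (𝓞 K)⁰).mp ha
      refine ⟨b, hT.mem_toFinset.mpr ⟨hb, ?_⟩, hag⟩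
      rw [← convexBodyLT_mem, mem_convexBodyLT_iff]
      intro w
      have : mixedEmbedding K (b : K) = x + -y := by rw [← sub_eq_add_neg, ← hxy, ← hag]
      rw [this]
      refine (normAtPlace_add_le w x (-y)).trans_lt ?_
      rw [normAtPlace_neg]
      have h1 := mem_convexBodyLT_iff.mp hx w
      have h2 := mem_convexBodyLT_iff.mp hy w
      push_cast at h1 h2
      linarith
    choose! φ hφ using key
    refine Finset.card_le_card_of_injOn φ (fun g hg ↦ (hφ g hg).1) fun g hg g' hg' h ↦ ?_
    apply Subtype.ext
    rw [← (hφ g hg).2, ← (hφ g' hg').2, h]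

theorem exists_primitive_element_infinitePlace_le :
    ∃ a : 𝓞 K, Algebra.adjoin ℚ {(a : K)} = ⊤ ∧
      ∀ w : InfinitePlace K, w (a : K) ≤ 2 ^ (finrank ℚ K + 2) * |(discr K : ℝ)| := by
  classical
  set D := |(discr K : ℝ)|
  have hD : 1 ≤ D := one_le_abs_discr
  set B : ℝ≥0 := NNReal.sqrt ‖discr K‖₊ * 2 ^ finrank ℚ K + 1 with hB
  have hBD : (B : ℝ) ≤ 2 ^ (finrank ℚ K + 1) * D := by
    have h1 : √D ≤ D := Real.sqrt_le_self_iff.mpr (Or.inr hD)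
    have h2 : (1 : ℝ) ≤ 2 ^ finrank ℚ K := one_le_pow₀ one_le_two
    rw [hB]
    push_cast
    rw [Int.norm_eq_abs, pow_succ]
    nlinarith
  have hmink : minkowskiBound K ↑1 < B := by
    rw [minkowskiBound, volume_fundamentalDomain_fractionalIdealLatticeBasis, Units.val_one,
      FractionalIdeal.absNorm_one, Rat.cast_one, ENNReal.ofReal_one, one_mul,
      mixedEmbedding.finrank, volume_fundamentalDomain_latticeBasis]
    refine lt_of_le_of_lt (b := ((NNReal.sqrt ‖discr K‖₊ * 2 ^ finrank ℚ K : ℝ≥0) : ℝ≥0∞)) ?_ ?_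
    · push_cast
      gcongr
      exact mul_le_of_le_one_left zero_le (pow_le_one₀ zero_le (by simp))
    · rw [ENNReal.coe_lt_coe, hB]
      exact lt_add_one _
  have hone : 1 ≤ 2 ^ (finrank ℚ K + 1) * D :=
    one_le_mul_of_one_le_of_one_le (one_le_pow₀ one_le_two) hD
  obtain ⟨w₀⟩ : Nonempty (InfinitePlace K) := inferInstance
  have main : ∃ a : 𝓞 K, IntermediateField.adjoin ℚ {(a : K)} = ⊤ ∧
      ∀ w : InfinitePlace K, w (a : K) ≤ 2 ^ (finrank ℚ K + 2) * D := by
    by_cases hw₀ : w₀.IsReal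
    · obtain ⟨a, ha, haw⟩ := exists_primitive_element_lt_of_isReal K hw₀ (B := B)
        (hmink.trans_le (le_mul_of_one_le_left zero_le (mod_cast one_le_convexBodyLTFactor K)))
      refine ⟨a, ha, fun w ↦ (haw w).le.trans ?_⟩
      push_cast
      rw [pow_succ]
      exact max_le (by linarith) (by linarith)
    · rw [InfinitePlace.not_isReal_iff_isComplex] at hw₀
      obtain ⟨a, ha, haw⟩ := exists_primitive_element_lt_of_isComplex K hw₀ (B := B)
        (hmink.trans_le (le_mul_of_one_le_left zero_le (mod_cast one_le_convexBodyLT'Factor K)))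
      refine ⟨a, ha, fun w ↦ (haw w).le.trans ?_⟩
      rw [Real.sqrt_le_left (by positivity), pow_succ _ (finrank ℚ K + 1)]
      have := B.2
      nlinarith
  obtain ⟨a, ha, haw⟩ := main
  refine ⟨a, ?_, haw⟩
  rw [← IntermediateField.adjoin_toSubalgebra_of_isAlgebraic
    fun x _ ↦ Algebra.IsAlgebraic.isAlgebraic x, ha, IntermediateField.top_toSubalgebra]

theorem span_mixedEmbedding_pow_eq_top {a : K} (ha : Algebra.adjoin ℚ {a} = ⊤) :
    Submodule.span ℝ (Set.range fun i : Fin (finrank ℚ K) ↦ mixedEmbedding K (a ^ (i : ℕ))) =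
      ⊤ := by
  classical
  set S := Submodule.span ℝ
    (Set.range fun i : Fin (finrank ℚ K) ↦ mixedEmbedding K (a ^ (i : ℕ))) with hS
  have hmem (x : K) : mixedEmbedding K x ∈ S := by
    let pb := PowerBasis.ofAdjoinEqTop (Algebra.IsIntegral.isIntegral a) ha
    have hx : x ∈ Submodule.span ℚ (Set.range pb.basis) := by
      rw [pb.basis.span_eq]
      trivial
    induction hx using Submodule.span_induction with
    | mem x hx =>
      obtain ⟨i, rfl⟩ := hx
      refine Submodule.subset_span ⟨⟨i, ?_⟩, ?_⟩
      · rw [pb.finrank]; exact i.2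
      · simp only [pb.basis_eq_pow, pb, PowerBasis.ofAdjoinEqTop_gen]
    | zero => simp
    | add x y _ _ hx hy => rw [map_add]; exact S.add_mem hx hy
    | smul q x _ hx =>
      rw [map_rat_smul (mixedEmbedding K) q x, ← Rat.cast_smul_eq_qsmul ℝ]
      exact S.smul_mem _ hx
  rw [eq_top_iff, ← (latticeBasis K).span_eq, Submodule.span_le]
  rintro _ ⟨i, rfl⟩
  rw [latticeBasis_apply]
  exact hmem _

theorem exists_normAtPlace_add_le (x : mixedSpace K) :
    ∃ a : 𝓞 K, ∀ w, normAtPlace w (mixedEmbedding K (a : K) + x) ≤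
      finrank ℚ K * (2 ^ (finrank ℚ K + 2) * |(discr K : ℝ)|) ^ finrank ℚ K := by
  obtain ⟨a, ha, haw⟩ := exists_primitive_element_infinitePlace_le (K := K)
  have hx : x ∈ Submodule.span ℝ
      (Set.range fun i : Fin (finrank ℚ K) ↦ mixedEmbedding K ((a : K) ^ (i : ℕ))) := by
    rw [span_mixedEmbedding_pow_eq_top ha]
    trivial
  obtain ⟨c, rfl⟩ := (Submodule.mem_span_range_iff_exists_fun ℝ).mp hx
  refine ⟨-∑ i, ⌊c i⌋ * a ^ (i : ℕ), fun w ↦ ?_⟩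
  have heq : mixedEmbedding K ((-∑ i, ⌊c i⌋ * a ^ (i : ℕ) : 𝓞 K) : K) +
      ∑ i, c i • mixedEmbedding K ((a : K) ^ (i : ℕ)) =
      ∑ i, Int.fract (c i) • mixedEmbedding K ((a : K) ^ (i : ℕ)) := by
    have h1 : ((-∑ i, ⌊c i⌋ * a ^ (i : ℕ) : 𝓞 K) : K) =
        -∑ i : Fin (finrank ℚ K), (⌊c i⌋ : K) * (a : K) ^ (i : ℕ) := by
      simp [map_sum]
    rw [h1, map_neg, map_sum, neg_add_eq_sub, ← Finset.sum_sub_distrib]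
    refine Finset.sum_congr rfl fun i _ ↦ ?_
    rw [Int.fract, sub_smul, map_mul, map_intCast, ← zsmul_eq_mul, Int.cast_smul_eq_zsmul]
  rw [heq]
  set β := 2 ^ (finrank ℚ K + 2) * |(discr K : ℝ)|
  have hβ : 1 ≤ β := one_le_mul_of_one_le_of_one_le (one_le_pow₀ one_le_two) one_le_abs_discr
  have hsum (s : Finset (Fin (finrank ℚ K))) :
      normAtPlace w (∑ i ∈ s, Int.fract (c i) • mixedEmbedding K ((a : K) ^ (i : ℕ))) ≤
        s.card * β ^ finrank ℚ K := by
    classical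
    induction s using Finset.induction_on with
    | empty => simp
    | insert i s hi ih =>
      rw [Finset.sum_insert hi, Finset.card_insert_of_notMem hi]
      refine (normAtPlace_add_le w _ _).trans ?_
      rw [normAtPlace_smul, normAtPlace_apply, map_pow, abs_of_nonneg (Int.fract_nonneg _)]
      have h1 : w (a : K) ^ (i : ℕ) ≤ β ^ finrank ℚ K :=
        (pow_le_pow_left₀ (apply_nonneg w _) (haw w) _).trans (pow_le_pow_right₀ hβ i.2.le)
      have h2 : Int.fract (c i) * w (a : K) ^ (i : ℕ) ≤ w (a : K) ^ (i : ℕ) :=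
        mul_le_of_le_one_left (by positivity) (Int.fract_lt_one _).le
      push_cast
      linarith
  simpa using hsum Finset.univ

theorem card_mul_sqrt_discr_le {Y : ℝ} (s : Finset (𝓞 K))
    (hY : finrank ℚ K * (2 ^ (finrank ℚ K + 2) * |(discr K : ℝ)|) ^ finrank ℚ K ≤ Y)
    (hs : ∀ x ∈ s, ∀ w : InfinitePlace K, w (x : K) < Y) :
    s.card * √|(discr K : ℝ)| ≤ 16 ^ finrank ℚ K * Y ^ finrank ℚ K := by
  classical
  have hY0 : 0 ≤ Y := le_trans (by positivity) hY
  lift Y to ℝ≥0 using hY0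
  have hfund := ZSpan.isAddFundamentalDomain' (latticeBasis K) volume
  have : Countable (Submodule.span ℤ (Set.range (latticeBasis K))).toAddSubgroup := by
    change Countable (Submodule.span ℤ (Set.range (latticeBasis K)))
    infer_instance
  let φ : 𝓞 K → (Submodule.span ℤ (Set.range (latticeBasis K))).toAddSubgroup := fun x ↦
    ⟨mixedEmbedding K (x : K), (mem_span_latticeBasis K).mpr ⟨x, rfl⟩⟩
  have hφ : Function.Injective φ := fun x y h ↦
    RingOfIntegers.coe_injective (mixedEmbedding_injective K (congrArg Subtype.val h))
  have hle := hfund.card_mul_le_measure (measurableSet_convexBodyLT fun _ ↦ 2 * Y) (s.image φ) ?_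
  · rw [convexBodyLT_volume, volume_fundamentalDomain_latticeBasis,
      Finset.card_image_of_injective _ hφ] at hle
    have hle' := ENNReal.toReal_mono (by finiteness) hle
    simp only [ENNReal.toReal_mul, ENNReal.toReal_pow, ENNReal.toReal_natCast,
      ENNReal.coe_toReal, NNReal.coe_mul, NNReal.coe_pow,
      ENNReal.toReal_inv, convexBodyLTFactor, NNReal.coe_real_pi, NNReal.coe_ofNat,
      mul_pow, Finset.prod_mul_distrib, Finset.prod_pow_eq_pow_sum,
      InfinitePlace.sum_mult_eq, Real.coe_sqrt, coe_nnnorm, Int.norm_eq_abs,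
      ENNReal.toReal_ofNat] at hle'
    have hr := InfinitePlace.card_add_two_mul_card_eq_rank K
    set r₁ := InfinitePlace.nrRealPlaces K
    set r₂ := InfinitePlace.nrComplexPlaces K
    rw [inv_pow, mul_left_comm, inv_mul_le_iff₀ (by positivity)] at hle'
    refine hle'.trans ?_
    have h4 : (2 : ℝ) ^ r₂ * (2 ^ r₁ * Real.pi ^ r₂ * 2 ^ finrank ℚ K) ≤ 16 ^ finrank ℚ K := by
      calc (2 : ℝ) ^ r₂ * (2 ^ r₁ * Real.pi ^ r₂ * 2 ^ finrank ℚ K)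
          ≤ 2 ^ r₂ * (2 ^ r₁ * 4 ^ r₂ * 2 ^ finrank ℚ K) := by
            gcongr
            exact Real.pi_le_four
        _ ≤ 2 ^ finrank ℚ K * (2 ^ finrank ℚ K * 2 ^ finrank ℚ K * 2 ^ finrank ℚ K) := by
            rw [show (4 : ℝ) = 2 ^ 2 by norm_num, ← pow_mul, ← pow_add _ r₁, hr, ← pow_add,
              ← pow_add,
              ← pow_add, ← pow_add]
            exact pow_le_pow_right₀ one_le_two (by omega)
        _ = 16 ^ finrank ℚ K := by
            rw [← mul_pow, ← mul_pow, ← mul_pow]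
            norm_num
    calc _ = (2 : ℝ) ^ r₂ * (2 ^ r₁ * Real.pi ^ r₂ * 2 ^ finrank ℚ K) * (Y : ℝ) ^ finrank ℚ K := by
          ring
      _ ≤ _ := by gcongr
  · intro x
    obtain ⟨a, ha⟩ := exists_normAtPlace_add_le x
    refine ⟨φ a, fun g hg ↦ ?_⟩
    obtain ⟨y, hy, rfl⟩ := Finset.mem_image.mp hg
    rw [mem_convexBodyLT_iff]
    intro w
    rw [add_right_comm]
    refine (normAtPlace_add_le w _ _).trans_lt ?_
    have h1 : normAtPlace w (φ y : mixedSpace K) < Y := by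
      rw [normAtPlace_apply]
      exact hs y hy w
    have h2 := (ha w).trans hY
    push_cast
    change normAtPlace w (mixedEmbedding K (a : K) + x) + _ < _
    linarith

end LatticePoints

section ClassGroupNorm

open scoped nonZeroDivisors

variable (K L : Type*) [Field K] [NumberField K] [Field L] [NumberField L] [Algebra K L]

/-- The relative norm on nonzero integral ideals. -/
noncomputable def nonzeroRelNorm : (Ideal (𝓞 L))⁰ →* (Ideal (𝓞 K))⁰ where
  toFun I := ⟨Ideal.relNorm (𝓞 K) (I : Ideal (𝓞 L)), mem_nonZeroDivisors_of_ne_zero fun h ↦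
    nonZeroDivisors.coe_ne_zero I (Ideal.relNorm_eq_bot_iff.mp h)⟩
  map_one' := by ext1; simp
  map_mul' I J := by ext1; simp

theorem mk0_nonzeroRelNorm_eq {I J : (Ideal (𝓞 L))⁰}
    (h : ClassGroup.mk0 I = ClassGroup.mk0 J) :
    ClassGroup.mk0 (nonzeroRelNorm K L I) = ClassGroup.mk0 (nonzeroRelNorm K L J) := by
  rw [ClassGroup.mk0_eq_mk0_iff] at h ⊢
  obtain ⟨x, y, hx, hy, h⟩ := h
  refine ⟨Algebra.intNorm (𝓞 K) (𝓞 L) x, Algebra.intNorm (𝓞 K) (𝓞 L) y,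
    Algebra.intNorm_ne_zero.mpr hx, Algebra.intNorm_ne_zero.mpr hy, ?_⟩
  have := congrArg (Ideal.relNorm (𝓞 K)) h
  rwa [map_mul, map_mul, Ideal.relNorm_singleton, Ideal.relNorm_singleton] at this

/-- The norm homomorphism between class groups of number fields. -/
noncomputable def classGroupNorm : ClassGroup (𝓞 L) →* ClassGroup (𝓞 K) :=
  MonoidHom.mk' (fun x ↦
      ClassGroup.mk0 (nonzeroRelNorm K L (Function.surjInv ClassGroup.mk0_surjective x))) <| by
    intro x y
    rw [← map_mul, ← map_mul]
    apply mk0_nonzeroRelNorm_eq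
    simp [map_mul, Function.surjInv_eq]

theorem classGroupNorm_mk0 (I : (Ideal (𝓞 L))⁰) :
    classGroupNorm K L (ClassGroup.mk0 I) = ClassGroup.mk0 (nonzeroRelNorm K L I) :=
  mk0_nonzeroRelNorm_eq K L (Function.surjInv_eq _ _)

theorem natCard_pow_eq_one_le (ℓ : ℕ) :
    Nat.card {x : ClassGroup (𝓞 L) // x ^ ℓ = 1} ≤
      Nat.card (classGroupNorm K L).ker * Nat.card {x : ClassGroup (𝓞 K) // x ^ ℓ = 1} := by
  classical
  let ν := classGroupNorm K L
  let g : {x : ClassGroup (𝓞 L) // x ^ ℓ = 1} → {x : ClassGroup (𝓞 K) // x ^ ℓ = 1} :=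
    fun x ↦ ⟨ν x, by rw [← map_pow, x.2, map_one]⟩
  have : Nonempty {x : ClassGroup (𝓞 L) // x ^ ℓ = 1} := ⟨⟨1, one_pow ℓ⟩⟩
  let r := fun y ↦ Function.invFun g y
  have hr (x) : g (r (g x)) = g x := Function.invFun_eq ⟨x, rfl⟩
  rw [← Nat.card_prod]
  refine Nat.card_le_card_of_injective
    (fun x ↦ (⟨(x : ClassGroup (𝓞 L)) * ((r (g x)).1)⁻¹, ?_⟩, g x)) ?_
  · rw [MonoidHom.mem_ker, map_mul, map_inv, mul_inv_eq_one]
    exact (congrArg Subtype.val (hr x)).symm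
  · intro x y hxy
    simp only [Prod.mk.injEq, Subtype.mk.injEq] at hxy
    obtain ⟨h1, h2⟩ := hxy
    rw [h2] at h1
    exact Subtype.ext (mul_right_cancel h1)

theorem exists_ideal_of_mem_ker {h : ClassGroup (𝓞 L)} (hh : h ∈ (classGroupNorm K L).ker) :
    ∃ (I : (Ideal (𝓞 L))⁰) (a : 𝓞 K), a ≠ 0 ∧ ClassGroup.mk0 I = h⁻¹ ∧
      Ideal.relNorm (𝓞 K) (I : Ideal (𝓞 L)) = Ideal.span {a} := by
  obtain ⟨I, hI⟩ := ClassGroup.mk0_surjective h⁻¹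
  have h1 := classGroupNorm_mk0 K L I
  rw [hI, map_inv, MonoidHom.mem_ker.mp hh, inv_one, eq_comm,
    show nonzeroRelNorm K L I = ⟨_, (nonzeroRelNorm K L I).2⟩ from rfl,
    ClassGroup.mk0_eq_one_iff] at h1
  obtain ⟨a, ha⟩ := h1
  have ha' : Ideal.relNorm (𝓞 K) (I : Ideal (𝓞 L)) = Ideal.span {a} := ha
  refine ⟨I, a, ?_, hI, ha'⟩
  rintro rfl
  rw [Ideal.span_singleton_zero, Ideal.relNorm_eq_bot_iff] at ha'
  exact nonZeroDivisors.coe_ne_zero I ha'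

end ClassGroupNorm

section NormBox

open scoped nonZeroDivisors NNReal

variable {K L : Type*} [Field K] [NumberField K] [Field L] [NumberField L] [Algebra K L]

theorem infinitePlace_norm_lt_pow {α : L} (hα : α ≠ 0) (v : InfinitePlace K) {B : ℝ}
    (h : ∀ w : InfinitePlace L, w.comap (algebraMap K L) = v → w α < B) :
    v (Algebra.norm K α) < B ^ Module.finrank K L := by
  let _ : Algebra K ℂ := v.embedding.toAlgebra
  have hv : v (Algebra.norm K α) = ‖∏ σ : L →ₐ[K] ℂ, σ α‖ := by
    rw [← Algebra.norm_eq_prod_embeddings K ℂ α, ← InfinitePlace.norm_embedding_eq]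
    rfl
  rw [hv, norm_prod, ← AlgHom.card K L ℂ, ← Finset.card_univ, ← Finset.prod_const]
  have : Nonempty (L →ₐ[K] ℂ) := by
    rw [← Fintype.card_pos_iff, AlgHom.card]
    exact Module.finrank_pos
  refine Finset.prod_lt_prod_of_nonempty (fun σ _ ↦ ?_) (fun σ _ ↦ ?_) Finset.univ_nonempty
  · simpa using hα
  · have := h (InfinitePlace.mk (σ : L →+* ℂ)) (by
      rw [InfinitePlace.comap_mk, σ.comp_algebraMap]
      exact InfinitePlace.mk_embedding v)
    simpa using this

theorem prod_mul_pow_mult (Y : ℝ) (x : K) :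
    ∏ w : InfinitePlace K, (Y * w x) ^ w.mult =
      Y ^ Module.finrank ℚ K * |(Algebra.norm ℚ x : ℝ)| := by
  simp_rw [mul_pow]
  rw [Finset.prod_mul_distrib, InfinitePlace.prod_eq_abs_norm, Finset.prod_pow_eq_pow_sum,
    InfinitePlace.sum_mult_eq, Rat.cast_abs]

/-- The radius at `w` of the box cut out by the condition that the relative norm be smaller than
`Y` times `a` at all infinite places. -/
noncomputable def normBoxRadius (L : Type*) [Field L] [NumberField L] [Algebra K L]
    (Y : ℝ) (a : K) (w : InfinitePlace L) : ℝ≥0 :=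
  Real.toNNReal ((Y * w (algebraMap K L a)) ^ ((Module.finrank K L : ℝ)⁻¹))

theorem normBoxRadius_pow {Y : ℝ} (hY : 0 ≤ Y) (a : K) (w : InfinitePlace L) :
    (normBoxRadius L Y a w : ℝ) ^ Module.finrank K L =
      Y * w (algebraMap K L a) := by
  have h0 : 0 ≤ Y * w (algebraMap K L a) := mul_nonneg hY (apply_nonneg _ _)
  rw [normBoxRadius, Real.coe_toNNReal _ (Real.rpow_nonneg h0 _)]
  exact Real.rpow_inv_natCast_pow h0 Module.finrank_pos.ne'

theorem prod_normBoxRadius_pow_mult {Y : ℝ} (hY : 0 ≤ Y) (a : K) :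
    ∏ w : InfinitePlace L, (normBoxRadius L Y a w : ℝ) ^ w.mult =
      Y ^ Module.finrank ℚ K * |(Algebra.norm ℚ a : ℝ)| := by
  rw [← pow_left_inj₀ (by positivity) (by positivity)
    (Module.finrank_pos (R := K) (M := L)).ne', ← Finset.prod_pow]
  simp_rw [pow_right_comm _ (InfinitePlace.mult _), normBoxRadius_pow hY]
  rw [prod_mul_pow_mult, ← Algebra.norm_norm (S := K), Algebra.norm_algebraMap, map_pow,
    ← Module.finrank_mul_finrank ℚ K L, mul_pow, pow_mul, Rat.cast_pow, abs_pow]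

theorem infinitePlace_comap_apply_algebraMap {K L : Type*} [Field K] [Field L] [Algebra K L]
    (w : InfinitePlace L) (a : K) : w (algebraMap K L a) = w.comap (algebraMap K L) a := rfl

theorem exists_intNorm_eq_mul {I : Ideal (𝓞 L)} {a : 𝓞 K} (ha : a ≠ 0)
    (hI : Ideal.relNorm (𝓞 K) I = Ideal.span {a}) {α : 𝓞 L} (hαI : α ∈ I) (hα : α ≠ 0)
    {Y : ℝ} (hY : 0 ≤ Y) (hαf : ∀ w : InfinitePlace L, w (α : L) < normBoxRadius L Y (a : K) w) :
    ∃ c : 𝓞 K, c ≠ 0 ∧ Algebra.intNorm (𝓞 K) (𝓞 L) α = a * c ∧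
      ∀ v : InfinitePlace K, v (c : K) < Y := by
  have hmem : Algebra.intNorm (𝓞 K) (𝓞 L) α ∈ Ideal.relNorm (𝓞 K) I := by
    have := Ideal.relNorm_mono (𝓞 K) ((Ideal.span_singleton_le_iff_mem I).mpr hαI)
    rw [Ideal.relNorm_singleton] at this
    exact this (Ideal.mem_span_singleton_self _)
  rw [hI, Ideal.mem_span_singleton] at hmem
  obtain ⟨c, hc⟩ := hmem
  have hN : Algebra.intNorm (𝓞 K) (𝓞 L) α ≠ 0 := Algebra.intNorm_ne_zero.mpr hα
  refine ⟨c, right_ne_zero_of_mul (hc ▸ hN), hc, fun v ↦ ?_⟩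
  have hva : 0 < v (a : K) := by
    rw [InfinitePlace.pos_iff]
    simpa using ha
  have hnorm : Algebra.norm K (α : L) = (a : K) * c := by
    have := Algebra.algebraMap_intNorm (A := 𝓞 K) (K := K) (L := L) (B := 𝓞 L) α
    rw [← this, hc, map_mul]
  have hlt := infinitePlace_norm_lt_pow (α := (α : L)) (by simpa using hα) v
    (B := (Y * v (a : K)) ^ ((Module.finrank K L : ℝ)⁻¹)) (by
      intro w hw
      refine (hαf w).trans_le ?_
      rw [normBoxRadius, infinitePlace_comap_apply_algebraMap, hw, Real.coe_toNNReal]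
      positivity)
  rw [Real.rpow_inv_natCast_pow (by positivity) Module.finrank_pos.ne', hnorm, map_mul,
    mul_comm] at hlt
  exact lt_of_mul_lt_mul_right hlt hva.le

theorem le_mul_of_prod_le_mul_prod {ι : Type*} [Fintype ι] {f u : ι → ℝ} {m : ι → ℕ} {T : ℝ}
    (hT : 1 ≤ T) (hm : ∀ i, m i ≠ 0) (hu : ∀ i, 0 < u i) (huf : ∀ i, u i ≤ f i)
    (h : ∏ i, f i ^ m i ≤ T * ∏ i, u i ^ m i) (i : ι) : f i ≤ T * u i := by
  classical
  rw [← Finset.mul_prod_erase _ _ (Finset.mem_univ i),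
    ← Finset.mul_prod_erase _ (fun i ↦ u i ^ m i) (Finset.mem_univ i)] at h
  have hP : ∏ j ∈ Finset.univ.erase i, u j ^ m j ≤ ∏ j ∈ Finset.univ.erase i, f j ^ m j :=
    Finset.prod_le_prod (fun j _ ↦ (pow_pos (hu j) _).le)
      (fun j _ ↦ pow_le_pow_left₀ (hu j).le (huf j) _)
  have hP0 : 0 < ∏ j ∈ Finset.univ.erase i, u j ^ m j :=
    Finset.prod_pos fun j _ ↦ pow_pos (hu j) _
  have hle : f i ^ m i ≤ T * u i ^ m i := by
    refine le_of_mul_le_mul_right ?_ hP0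
    calc _ ≤ f i ^ m i * ∏ j ∈ Finset.univ.erase i, f j ^ m j := by
          have := (hu i).trans_le (huf i)
          gcongr
      _ ≤ _ := h
      _ = _ := by ring
  refine le_of_pow_le_pow_left₀ (hm i) (by have := hu i; positivity) (hle.trans ?_)
  rw [mul_pow]
  have := hu i
  gcongr
  exact le_self_pow₀ hT (hm i)

end NormBox

section KernelBound

open scoped nonZeroDivisors NNReal

variable {K L : Type*} [Field K] [NumberField K] [Field L] [NumberField L] [Algebra K L]

theorem natCast_absNorm_span_singleton (x : 𝓞 K) :
    (Ideal.absNorm (Ideal.span {x}) : ℝ) = |(Algebra.norm ℚ (x : K) : ℝ)| := by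
  rw [Ideal.absNorm_span_singleton, ← Algebra.coe_norm_int, Nat.cast_natAbs]
  simp

theorem natCast_absNorm_span_singleton_le {x : 𝓞 K} {Y : ℝ}
    (h : ∀ v : InfinitePlace K, v (x : K) < Y) :
    (Ideal.absNorm (Ideal.span {x}) : ℝ) ≤ Y ^ Module.finrank ℚ K := by
  rw [natCast_absNorm_span_singleton, ← Rat.cast_abs, ← InfinitePlace.prod_eq_abs_norm,
    ← InfinitePlace.sum_mult_eq, ← Finset.prod_pow_eq_pow_sum]
  exact Finset.prod_le_prod (fun v _ ↦ by positivity)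
    fun v _ ↦ pow_le_pow_left₀ (apply_nonneg _ _) (h v).le _

theorem Finset.card_le_mul_card_of_card_fiber_le {α β : Type*} [DecidableEq β] {s : Finset α}
    {t : Finset β} {f : α → β} (hf : ∀ x ∈ s, f x ∈ t) {B : ℝ}
    (hB : ∀ y ∈ t, ((s.filter fun x ↦ f x = y).card : ℝ) ≤ B) :
    (s.card : ℝ) ≤ B * t.card := by
  rw [Finset.card_eq_sum_card_fiberwise hf, Nat.cast_sum, mul_comm, ← nsmul_eq_mul]
  exact Finset.sum_le_card_nsmul _ _ _ hB

theorem normBoxRadius_le_mul {a c : 𝓞 K} {α : 𝓞 L} (hα : α ≠ 0)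
    (hc : c ≠ 0) {Y : ℝ} (hY : 1 ≤ Y)
    (hαf : ∀ w : InfinitePlace L, w (α : L) < normBoxRadius L Y (a : K) w)
    (hαc : Algebra.intNorm (𝓞 K) (𝓞 L) α = a * c) (w : InfinitePlace L) :
    normBoxRadius L Y (a : K) w ≤ Y ^ Module.finrank ℚ K * w (α : L) := by
  refine le_mul_of_prod_le_mul_prod (m := InfinitePlace.mult) (one_le_pow₀ hY)
    (fun w ↦ InfinitePlace.mult_ne_zero)
    (fun w ↦ ?_) (fun w ↦ (hαf w).le) ?_ w
  · rw [InfinitePlace.pos_iff]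
    simpa using hα
  · rw [prod_normBoxRadius_pow_mult (zero_le_one.trans hY), InfinitePlace.prod_eq_abs_norm,
      Rat.cast_abs, ← Algebra.norm_norm (S := K) (a := (α : L)),
      ← Algebra.algebraMap_intNorm (A := 𝓞 K) (K := K) (L := L) (B := 𝓞 L) α, hαc]
    simp only [map_mul, Rat.cast_mul, abs_mul]
    rw [← natCast_absNorm_span_singleton c]
    have h1 : (1 : ℝ) ≤ Ideal.absNorm (Ideal.span {c}) := by
      rw [Nat.one_le_cast, Nat.one_le_iff_ne_zero, Ne, Ideal.absNorm_eq_zero_iff,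
        Ideal.span_singleton_eq_bot]
      exact hc
    gcongr
    exact le_mul_of_one_le_right (abs_nonneg _) h1

theorem exists_mul_eq_span_singleton {I : (Ideal (𝓞 L))⁰} {a c : 𝓞 K} (ha : a ≠ 0)
    (hI : Ideal.relNorm (𝓞 K) (I : Ideal (𝓞 L)) = Ideal.span {a}) {α : 𝓞 L}
    (hαI : α ∈ (I : Ideal (𝓞 L)))
    (hαc : Algebra.intNorm (𝓞 K) (𝓞 L) α = a * c) :
    ∃ b : Ideal (𝓞 L), (I : Ideal (𝓞 L)) * b = Ideal.span {α} ∧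
      b ∣ Ideal.span {((Ideal.absNorm (Ideal.span {c}) : ℕ) : 𝓞 L)} := by
  obtain ⟨b, hb⟩ := Ideal.dvd_iff_le.mpr ((Ideal.span_singleton_le_iff_mem _).mpr hαI)
  refine ⟨b, hb.symm, ?_⟩
  have h1 := congrArg (Ideal.relNorm (𝓞 K)) hb
  rw [Ideal.relNorm_singleton, map_mul, hI, hαc, ← Ideal.span_singleton_mul_span_singleton] at h1
  have h2 := mul_left_cancel₀ (by simpa using ha) h1
  rw [h2, Ideal.absNorm_relNorm, Ideal.dvd_span_singleton]
  exact Ideal.absNorm_mem b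

theorem card_le_mul_of_intNorm_eq {ι : Type*} (I : ι → (Ideal (𝓞 L))⁰)
    (hinj : Function.Injective fun i ↦ ClassGroup.mk0 (I i)) (a : ι → 𝓞 K)
    (ha : ∀ i, a i ≠ 0)
    (hIa : ∀ i, Ideal.relNorm (𝓞 K) (I i : Ideal (𝓞 L)) = Ideal.span {a i})
    {Y : ℝ} (hY : 1 ≤ Y) {c : 𝓞 K} (hc : c ≠ 0) (P : Finset (ι × 𝓞 L))
    (hP : ∀ p ∈ P, p.2 ≠ 0 ∧ p.2 ∈ (I p.1 : Ideal (𝓞 L)) ∧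
      (∀ w : InfinitePlace L, w (p.2 : L) < normBoxRadius L Y (a p.1 : K) w) ∧
      Algebra.intNorm (𝓞 K) (𝓞 L) p.2 = a p.1 * c)
    {B₁ B₂ : ℝ}
    (hB₁ : (Nat.card {b : Ideal (𝓞 L) //
      b ∣ Ideal.span {((Ideal.absNorm (Ideal.span {c}) : ℕ) : 𝓞 L)}} : ℝ) ≤ B₁)
    (hB₂ : ∀ (s : Finset (𝓞 L)) (f : InfinitePlace L → ℝ), (∀ x ∈ s, x ≠ 0) →
      (∀ x ∈ s, ∀ y ∈ s, Ideal.span {x} = Ideal.span {y}) →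
      (∀ x ∈ s, ∀ w : InfinitePlace L, w (x : L) ≤ f w) →
      (∀ x ∈ s, ∀ w, f w ≤ Y ^ Module.finrank ℚ K * w (x : L)) → (s.card : ℝ) ≤ B₂) :
    (P.card : ℝ) ≤ B₂ * B₁ := by
  classical
  have hM : Ideal.span {((Ideal.absNorm (Ideal.span {c}) : ℕ) : 𝓞 L)} ≠ 0 := by
    simpa [Ideal.absNorm_eq_zero_iff] using hc
  have hfin : {b : Ideal (𝓞 L) |
      b ∣ Ideal.span {((Ideal.absNorm (Ideal.span {c}) : ℕ) : 𝓞 L)}}.Finite :=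
    finite_dvd_of_ne_zero hM
  have hex (p : ι × 𝓞 L) : ∃ b : Ideal (𝓞 L), p ∈ P →
      (I p.1 : Ideal (𝓞 L)) * b = Ideal.span {p.2} ∧
      b ∣ Ideal.span {((Ideal.absNorm (Ideal.span {c}) : ℕ) : 𝓞 L)} := by
    by_cases hp : p ∈ P
    · obtain ⟨-, hpI, -, hpc⟩ := hP p hp
      obtain ⟨b, hb⟩ := exists_mul_eq_span_singleton (ha p.1) (hIa p.1) hpI hpc
      exact ⟨b, fun _ ↦ hb⟩
    · exact ⟨⊥, fun h ↦ absurd h hp⟩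
  choose b hb using hex
  have hB₂0 : 0 ≤ B₂ := by simpa using hB₂ ∅ 0 (by simp) (by simp) (by simp) (by simp)
  have hcard := Finset.card_le_mul_card_of_card_fiber_le (s := P) (t := hfin.toFinset) (f := b)
    (fun p hp ↦ by simpa using (hb p hp).2) (B := B₂) ?_
  · refine hcard.trans (mul_le_mul_of_nonneg_left (le_trans (le_of_eq ?_) hB₁) hB₂0)
    rw [← Set.ncard_eq_toFinset_card _ hfin]
    rfl
  intro y _
  have hmem {p} (hp : p ∈ P.filter fun p ↦ b p = y) : p ∈ P ∧
      (I p.1 : Ideal (𝓞 L)) * y = Ideal.span {p.2} := by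
    obtain ⟨h1, h2⟩ := Finset.mem_filter.mp hp
    exact ⟨h1, h2 ▸ (hb p h1).1⟩
  have hfst {p q} (hp : p ∈ P.filter fun p ↦ b p = y) (hq : q ∈ P.filter fun p ↦ b p = y) :
      p.1 = q.1 := by
    apply hinj
    obtain ⟨hpP, hp⟩ := hmem hp
    obtain ⟨hqP, hq⟩ := hmem hq
    refine ClassGroup.mk0_eq_mk0_iff.mpr ⟨q.2, p.2, (hP q hqP).1, (hP p hpP).1, ?_⟩
    rw [← hp, ← hq]
    ring
  rcases (P.filter fun p ↦ b p = y).eq_empty_or_nonempty with h | ⟨p₀, hp₀⟩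
  · rwa [h, Finset.card_empty, Nat.cast_zero]
  rw [← Finset.card_image_of_injOn (f := Prod.snd)
    fun p hp q hq h ↦ Prod.ext (hfst hp hq) h]
  refine hB₂ _ (fun w ↦ normBoxRadius L Y (a p₀.1 : K) w) ?_ ?_ ?_ ?_ <;>
    simp only [Finset.forall_mem_image]
  · exact fun p hp ↦ (hP p (hmem hp).1).1
  · intro p hp q hq
    rw [← (hmem hp).2, ← (hmem hq).2, hfst hp hq]
  · intro p hp w
    rw [hfst hp₀ hp]
    exact ((hP p (hmem hp).1).2.2.1 w).le
  · intro p hp w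
    obtain ⟨h1, h2, h3, h4⟩ := hP p (hmem hp).1
    rw [hfst hp₀ hp]
    exact normBoxRadius_le_mul h1 hc hY h3 h4 w

end KernelBound

section TorsionBound

open scoped nonZeroDivisors NNReal
open Module

variable {K L : Type*} [Field K] [NumberField K] [Field L] [NumberField L] [Algebra K L]

theorem exists_finset_mem_normBox {I : (Ideal (𝓞 L))⁰} {a : 𝓞 K}
    (hI : Ideal.relNorm (𝓞 K) (I : Ideal (𝓞 L)) = Ideal.span {a}) {Y : ℝ} (hY : 0 ≤ Y)
    (hYD : 2 ^ (finrank ℚ L + 1) * √|(discr L : ℝ)| ≤ Y ^ finrank ℚ K) :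
    ∃ s : Finset (𝓞 L), (∀ x ∈ s, x ≠ 0 ∧ x ∈ (I : Ideal (𝓞 L)) ∧
        ∀ w : InfinitePlace L, w (x : L) < normBoxRadius L Y (a : K) w) ∧
      Y ^ finrank ℚ K ≤ 2 ^ (finrank ℚ L + 1) * √|(discr L : ℝ)| * s.card := by
  classical
  have hI0 : (I : Ideal (𝓞 L)) ≠ ⊥ := nonZeroDivisors.coe_ne_zero I
  obtain ⟨s, hs, hcard⟩ := prod_le_card_mul_sqrt_discr (I : Ideal (𝓞 L)) hI0
    (normBoxRadius L Y (a : K))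
  refine ⟨s.erase 0, fun x hx ↦ ⟨Finset.ne_of_mem_erase hx, hs x (Finset.mem_of_mem_erase hx)⟩, ?_⟩
  have hpos : (0 : ℝ) < Ideal.absNorm (I : Ideal (𝓞 L)) := by
    rw [Nat.cast_pos, Nat.pos_iff_ne_zero, Ne, Ideal.absNorm_eq_zero_iff]
    exact hI0
  rw [prod_normBoxRadius_pow_mult hY, ← natCast_absNorm_span_singleton, ← hI,
    Ideal.absNorm_relNorm] at hcard
  have h1 : Y ^ finrank ℚ K ≤ 2 ^ finrank ℚ L * √|(discr L : ℝ)| * s.card := by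
    refine le_of_mul_le_mul_right (hcard.trans_eq ?_) hpos
    ring
  have h2 : (s.card : ℝ) ≤ (s.erase 0).card + 1 := by
    exact_mod_cast Nat.sub_le_iff_le_add.mp (Finset.pred_card_le_card_erase (s := s) (a := 0))
  have h3 : 2 ^ finrank ℚ L * √|(discr L : ℝ)| * s.card ≤
      2 ^ finrank ℚ L * √|(discr L : ℝ)| * ((s.erase 0).card + 1) := by gcongr
  rw [pow_succ] at hYD ⊢
  linarith

theorem exists_card_ker_classGroupNorm_le (N : ℕ) {ε : ℝ} (hε : 0 < ε) :
    ∃ C : ℝ, 0 < C ∧ ∀ (K L : Type*) [Field K] [NumberField K] [Field L] [NumberField L]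
      [Algebra K L], finrank ℚ L = N → ∀ Y : ℝ, 1 ≤ Y →
        finrank ℚ K * (2 ^ (finrank ℚ K + 2) * |(discr K : ℝ)|) ^ finrank ℚ K ≤ Y →
        2 ^ (finrank ℚ L + 1) * √|(discr L : ℝ)| ≤ Y ^ finrank ℚ K →
        Nat.card (classGroupNorm K L).ker * √|(discr K : ℝ)| ≤
          C * √|(discr L : ℝ)| * 16 ^ finrank ℚ K * (Y ^ finrank ℚ K) ^ ε := by
  obtain ⟨C₁, hC₁, hdiv⟩ := exists_prod_factorization_le N (half_pos hε)
  obtain ⟨C₂, hC₂, hunit⟩ := exists_card_le_of_span_eq N (half_pos hε)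
  refine ⟨C₁ * C₂ * 2 ^ (N + 1), by positivity, ?_⟩
  rintro K L _ _ _ _ _ rfl Y hY hYK hYL
  classical
  have hY0 : 0 < Y := zero_lt_one.trans_le hY
  have hT : 1 ≤ Y ^ finrank ℚ K := one_le_pow₀ hY
  choose I a ha hmk hIa using fun h : (classGroupNorm K L).ker ↦ exists_ideal_of_mem_ker K L h.2
  choose s hs hscard using fun h ↦ exists_finset_mem_normBox (hIa h) hY0.le hYL
  have hinj : Function.Injective fun h ↦ ClassGroup.mk0 (I h) := by
    intro h h' hh
    simp only [hmk, inv_inj] at hh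
    exact Subtype.ext hh
  let P : Finset ((classGroupNorm K L).ker × 𝓞 L) :=
    Finset.univ.biUnion fun h ↦ (s h).map ⟨fun x ↦ (h, x), Prod.mk_right_injective h⟩
  have hmemP {p} (hp : p ∈ P) : p.2 ∈ s p.1 := by
    simp only [P, Finset.mem_biUnion, Finset.mem_map] at hp
    obtain ⟨h, -, x, hx, rfl⟩ := hp
    exact hx
  have hPcard : P.card = ∑ h, (s h).card := by
    rw [Finset.card_biUnion]
    · simp
    · intro h _ h' _ hne
      rw [Function.onFun, Finset.disjoint_left]
      simp only [Finset.mem_map]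
      rintro _ ⟨x, -, rfl⟩ ⟨y, -, hy⟩
      exact hne (congrArg Prod.fst hy).symm
  have hlower : Nat.card (classGroupNorm K L).ker * Y ^ finrank ℚ K ≤
      2 ^ (finrank ℚ L + 1) * √|(discr L : ℝ)| * P.card := by
    rw [hPcard, Nat.cast_sum, Finset.mul_sum, Nat.card_eq_fintype_card, ← Finset.card_univ,
      ← nsmul_eq_mul]
    exact Finset.card_nsmul_le_sum _ _ _ fun h _ ↦ hscard h
  have hex (p : (classGroupNorm K L).ker × 𝓞 L) : ∃ c : 𝓞 K, p ∈ P → c ≠ 0 ∧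
      Algebra.intNorm (𝓞 K) (𝓞 L) p.2 = a p.1 * c ∧ ∀ v : InfinitePlace K, v (c : K) < Y := by
    by_cases hp : p ∈ P
    · obtain ⟨h0, hI, hf⟩ := hs p.1 p.2 (hmemP hp)
      obtain ⟨c, hc⟩ := exists_intNorm_eq_mul (ha p.1) (hIa p.1) hI h0 hY0.le hf
      exact ⟨c, fun _ ↦ hc⟩
    · exact ⟨0, fun h ↦ absurd h hp⟩
  choose c hc using hex
  have hupper : (P.card : ℝ) ≤ C₂ * (Y ^ finrank ℚ K) ^ (ε / 2) *
      (C₁ * (Y ^ finrank ℚ K) ^ (ε / 2)) * (P.image c).card := by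
    refine Finset.card_le_mul_card_of_card_fiber_le (fun p hp ↦ Finset.mem_image_of_mem c hp) ?_
    simp only [Finset.forall_mem_image]
    intro q hq
    have hcq : Ideal.absNorm (Ideal.span {c q}) ≠ 0 := by
      rw [Ne, Ideal.absNorm_eq_zero_iff, Ideal.span_singleton_eq_bot]
      exact (hc q hq).1
    refine card_le_mul_of_intNorm_eq I hinj a ha hIa hY (hc q hq).1 _ ?_ ?_ ?_
    · intro p hp
      obtain ⟨hp, hpq⟩ := Finset.mem_filter.mp hp
      obtain ⟨h0, hI, hf⟩ := hs p.1 p.2 (hmemP hp)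
      exact ⟨h0, hI, hf, hpq ▸ (hc p hp).2.1⟩
    · calc _ ≤ _ := Nat.cast_le.mpr (card_dvd_span_natCast_le L hcq)
        _ ≤ _ := hdiv _ hcq
        _ ≤ _ := by
          gcongr
          exact natCast_absNorm_span_singleton_le (hc q hq).2.2
    · exact fun s f h1 h2 h3 h4 ↦ hunit L rfl s f _ hT h1 h2 h3 h4
  have hTcard := card_mul_sqrt_discr_le (P.image c) hYK (by
    simp only [Finset.forall_mem_image]
    exact fun p hp ↦ (hc p hp).2.2)
  refine le_of_mul_le_mul_right ?_ (zero_lt_one.trans_le hT)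
  have hadd : (Y ^ finrank ℚ K) ^ ε =
      (Y ^ finrank ℚ K) ^ (ε / 2) * (Y ^ finrank ℚ K) ^ (ε / 2) := by
    rw [← Real.rpow_add (by positivity), add_halves]
  calc _ = Nat.card (classGroupNorm K L).ker * Y ^ finrank ℚ K * √|(discr K : ℝ)| := by ring
    _ ≤ 2 ^ (finrank ℚ L + 1) * √|(discr L : ℝ)| * (C₂ * (Y ^ finrank ℚ K) ^ (ε / 2) *
      (C₁ * (Y ^ finrank ℚ K) ^ (ε / 2)) * (P.image c).card) * √|(discr K : ℝ)| := by
        exact mul_le_mul_of_nonneg_right (hlower.trans (by gcongr)) (Real.sqrt_nonneg _)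
    _ = 2 ^ (finrank ℚ L + 1) * √|(discr L : ℝ)| * C₂ * C₁ * (Y ^ finrank ℚ K) ^ ε *
        ((P.image c).card * √|(discr K : ℝ)|) := by rw [hadd]; ring
    _ ≤ 2 ^ (finrank ℚ L + 1) * √|(discr L : ℝ)| * C₂ * C₁ * (Y ^ finrank ℚ K) ^ ε *
        (16 ^ finrank ℚ K * Y ^ finrank ℚ K) := by gcongr
    _ = _ := by ring

theorem exists_natCard_pow_eq_one_mul_sqrt_discr_le (k N : ℕ) {ε : ℝ} (hε : 0 < ε) :
    ∃ C : ℝ, 0 < C ∧ ∀ (K L : Type*) [Field K] [NumberField K] [Field L] [NumberField L]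
      [Algebra K L], finrank ℚ K = k → finrank ℚ L = N → ∀ ℓ : ℕ,
        Nat.card {x : ClassGroup (𝓞 L) // x ^ ℓ = 1} * √|(discr K : ℝ)| ≤
          C * Nat.card {x : ClassGroup (𝓞 K) // x ^ ℓ = 1} * √|(discr L : ℝ)| *
            |(discr L : ℝ)| ^ ε := by
  rcases Nat.eq_zero_or_pos k with rfl | hk
  · exact ⟨1, one_pos, fun K _ _ _ _ _ _ h ↦ absurd h finrank_pos.ne'⟩
  have hk' : (0 : ℝ) < k := Nat.cast_pos.mpr hk
  obtain ⟨C, hC, hker⟩ := exists_card_ker_classGroupNorm_le N (ε := ε / (k * k)) (by positivity)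
  set A : ℝ := k * (2 ^ (k + 2)) ^ k + 2 ^ (N + 1) with hA
  have hA1 : 1 ≤ A := (one_le_pow₀ one_le_two).trans (le_add_of_nonneg_left (by positivity))
  refine ⟨C * 16 ^ k * (A ^ k) ^ (ε / (k * k)), by positivity, ?_⟩
  rintro K L _ _ _ _ _ rfl rfl ℓ
  set k := finrank ℚ K
  set N := finrank ℚ L
  have hDL : 1 ≤ |(discr L : ℝ)| := one_le_abs_discr
  have hDK : |(discr K : ℝ)| ≤ |(discr L : ℝ)| := by
    exact_mod_cast Int.le_of_dvd (abs_pos.mpr (discr_ne_zero L))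
      ((abs_dvd_abs _ _).mpr (discr_dvd_discr K L))
  have hpow : |(discr L : ℝ)| ≤ |(discr L : ℝ)| ^ k := le_self_pow₀ hDL hk.ne'
  have hY : 1 ≤ A * |(discr L : ℝ)| ^ k := one_le_mul_of_one_le_of_one_le hA1 (one_le_pow₀ hDL)
  have hmain := hker K L rfl (A * |(discr L : ℝ)| ^ k) hY ?_ ?_
  · have hexp : ((A * |(discr L : ℝ)| ^ k) ^ k) ^ (ε / (k * k)) =
        (A ^ k) ^ (ε / (k * k)) * |(discr L : ℝ)| ^ ε := by
      rw [mul_pow, Real.mul_rpow (by positivity) (by positivity), ← pow_mul,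
        ← Real.rpow_natCast_mul (abs_nonneg (discr L : ℝ)), Nat.cast_mul,
        mul_div_cancel₀ _ (mul_pos hk' hk').ne']
    rw [hexp] at hmain
    have htors := Nat.cast_le (α := ℝ).mpr (natCard_pow_eq_one_le K L ℓ)
    push_cast at htors
    calc _ ≤ Nat.card (classGroupNorm K L).ker * Nat.card {x : ClassGroup (𝓞 K) // x ^ ℓ = 1} *
          √|(discr K : ℝ)| := by gcongr
      _ = Nat.card {x : ClassGroup (𝓞 K) // x ^ ℓ = 1} *
          (Nat.card (classGroupNorm K L).ker * √|(discr K : ℝ)|) := by ring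
      _ ≤ _ := mul_le_mul_of_nonneg_left hmain (Nat.cast_nonneg _)
      _ = _ := by ring
  · rw [mul_pow, ← mul_assoc]
    gcongr
    exact le_add_of_nonneg_right (by positivity)
  · calc (2 : ℝ) ^ (N + 1) * √|(discr L : ℝ)| ≤ A * |(discr L : ℝ)| ^ k := by
          gcongr
          · exact le_add_of_nonneg_left (by positivity)
          · exact (Real.sqrt_le_self_iff.mpr (.inr hDL)).trans hpow
      _ ≤ _ := le_self_pow₀ hY hk.ne'

end TorsionBound

section Compositum

theorem rpow_le_or_rpow_le_of_le_pow_mul_pow {D D₁ D₂ δ₁ δ₂ : ℝ} {n m : ℕ} (hD : 1 ≤ D)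
    (hD₁ : 0 < D₁) (hD₂ : 0 < D₂) (hδ₁ : 0 < δ₁) (hδ₂ : 0 < δ₂) (hn : n ≠ 0) (hm : m ≠ 0)
    (h : D ≤ D₁ ^ m * D₂ ^ n) :
    D ^ (δ₁ * δ₂ / (m * δ₂ + n * δ₁)) ≤ D₁ ^ δ₁ ∨
      D ^ (δ₁ * δ₂ / (m * δ₂ + n * δ₁)) ≤ D₂ ^ δ₂ := by
  by_contra! hlt
  have hD0 : 0 < D := zero_lt_one.trans_le hD
  have hm' : (0 : ℝ) < m := Nat.cast_pos.mpr (Nat.pos_of_ne_zero hm)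
  set δ := δ₁ * δ₂ / (m * δ₂ + n * δ₁) with hδ
  have key {E η : ℝ} (hE : 0 < E) (hη : 0 < η) (h : E ^ η < D ^ δ) : E < D ^ (δ / η) := by
    rw [div_eq_mul_inv, Real.rpow_mul hD0.le]
    exact (Real.lt_rpow_inv_iff_of_pos hE.le (by positivity) hη).mpr h
  have h1 := key hD₁ hδ₁ hlt.1
  have h2 := key hD₂ hδ₂ hlt.2
  refine absurd h (not_le.mpr ?_)
  calc D₁ ^ m * D₂ ^ n < (D ^ (δ / δ₁)) ^ m * (D ^ (δ / δ₂)) ^ n := by gcongr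
    _ = D ^ (δ / δ₁ * m + δ / δ₂ * n) := by
      rw [Real.rpow_add hD0, Real.rpow_mul_natCast hD0.le, Real.rpow_mul_natCast hD0.le]
    _ = D := by
      have : δ / δ₁ * m + δ / δ₂ * n = 1 := by
        rw [hδ]
        field_simp
      rw [this, Real.rpow_one]

theorem natCard_torsion_le_of_rpow_le {D D' δ δ' t t' C C' ε : ℝ} (hD : 1 ≤ D) (hD' : 1 ≤ D')
    (hD'D : D' ≤ D) (hε : 0 < ε) (hC : 0 < C) (hC' : 0 < C')
    (h : t * √D' ≤ C * t' * √D * D ^ (ε / 2)) (h' : t' ≤ C' * D' ^ (1 / 2 - δ' + ε / 2))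
    (hδ : D ^ δ ≤ D' ^ δ') : t ≤ C * C' * D ^ (1 / 2 - δ + ε) := by
  have hD0 : 0 < D := zero_lt_one.trans_le hD
  have hD'0 : 0 < D' := zero_lt_one.trans_le hD'
  refine le_of_mul_le_mul_right (h.trans ?_) (Real.sqrt_pos.mpr hD'0)
  rw [Real.rpow_add hD'0, Real.rpow_sub hD'0, ← Real.sqrt_eq_rpow] at h'
  have hsplit : D ^ (1 / 2 - δ + ε) = √D / D ^ δ * (D ^ (ε / 2) * D ^ (ε / 2)) := by
    rw [Real.rpow_add hD0, Real.rpow_sub hD0, ← Real.sqrt_eq_rpow, ← Real.rpow_add hD0, add_halves]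
  rw [hsplit]
  calc C * t' * √D * D ^ (ε / 2)
      ≤ C * (C' * (√D' / D' ^ δ' * D' ^ (ε / 2))) * √D * D ^ (ε / 2) := by gcongr
    _ ≤ C * (C' * (√D' / D ^ δ * D ^ (ε / 2))) * √D * D ^ (ε / 2) := by gcongr
    _ = _ := by ring

end Compositum

/-- **Compositum Lemma.** If pointwise power savings `δ₁, δ₂` on `ℓ`-torsion hold
for Galois number fields with groups `G₁` (of order `n`) and `G₂` (of order `m`) respectively,
then the saving `δ = δ₁δ₂/(mδ₂ + nδ₁)` holds for Galois number fields with group `G₁ × G₂`. -/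
theorem compositum_lemma (ℓ : ℕ) (hℓ : 1 < ℓ)
    (G₁ G₂ : Type) [Group G₁] [Finite G₁] [Group G₂] [Finite G₂]
    (n m : ℕ) (hn : Nat.card G₁ = n) (hm : Nat.card G₂ = m)
    (δ₁ δ₂ : ℝ) (hδ₁ : 0 < δ₁) (hδ₂ : 0 < δ₂)
    (hG₁ : ∀ ε : ℝ, 0 < ε → ∃ C₁ : ℝ, 0 < C₁ ∧
      ∀ (F : Type) [Field F] [NumberField F] [IsGalois ℚ F],
        Nonempty ((F ≃ₐ[ℚ] F) ≃* G₁) →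
        (ellTorsion F ℓ : ℝ) ≤ C₁ * (|discr F| : ℝ) ^ ((1 : ℝ) / 2 - δ₁ + ε))
    (hG₂ : ∀ ε : ℝ, 0 < ε → ∃ C₂ : ℝ, 0 < C₂ ∧
      ∀ (F : Type) [Field F] [NumberField F] [IsGalois ℚ F],
        Nonempty ((F ≃ₐ[ℚ] F) ≃* G₂) →
        (ellTorsion F ℓ : ℝ) ≤ C₂ * (|discr F| : ℝ) ^ ((1 : ℝ) / 2 - δ₂ + ε)) :
    ∀ ε : ℝ, 0 < ε → ∃ C : ℝ, 0 < C ∧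
      ∀ (L : Type) [Field L] [NumberField L] [IsGalois ℚ L],
        Nonempty ((L ≃ₐ[ℚ] L) ≃* (G₁ × G₂)) →
        (ellTorsion L ℓ : ℝ) ≤
          C * (|discr L| : ℝ) ^ ((1 : ℝ) / 2 - δ₁ * δ₂ / (m * δ₂ + n * δ₁) + ε) := by
  intro ε hε
  have hn0 : n ≠ 0 := hn ▸ Nat.card_pos.ne'
  have hm0 : m ≠ 0 := hm ▸ Nat.card_pos.ne'
  obtain ⟨C₁, hC₁, h₁⟩ := hG₁ (ε / 2) (half_pos hε)
  obtain ⟨C₂, hC₂, h₂⟩ := hG₂ (ε / 2) (half_pos hε)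
  obtain ⟨A₁, hA₁, hmain₁⟩ :=
    exists_natCard_pow_eq_one_mul_sqrt_discr_le n (n * m) (half_pos hε)
  obtain ⟨A₂, hA₂, hmain₂⟩ :=
    exists_natCard_pow_eq_one_mul_sqrt_discr_le m (n * m) (half_pos hε)
  refine ⟨max (A₁ * C₁) (A₂ * C₂), by positivity, ?_⟩
  rintro L _ _ _ ⟨e⟩
  obtain ⟨K₁, K₂, _, _, ⟨e₁⟩, ⟨e₂⟩, hdisj, hsup⟩ := exists_intermediateFields_of_mulEquiv_prod e
  have hK₁ : Module.finrank ℚ K₁ = n := by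
    rw [← IsGalois.card_aut_eq_finrank, Nat.card_congr e₁.toEquiv, hn]
  have hK₂ : Module.finrank ℚ K₂ = m := by
    rw [← IsGalois.card_aut_eq_finrank, Nat.card_congr e₂.toEquiv, hm]
  have hL : Module.finrank ℚ L = n * m := by
    rw [← IsGalois.card_aut_eq_finrank, Nat.card_congr e.toEquiv, Nat.card_prod, hn, hm]
  have hdiscr : |(discr L : ℝ)| ≤ |(discr K₁ : ℝ)| ^ m * |(discr K₂ : ℝ)| ^ n := by
    have := natAbs_discr_le_of_linearDisjoint K₁ K₂ hdisj hsup
    rw [hK₁, hK₂] at this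
    simpa only [Nat.cast_mul, Nat.cast_pow, Nat.cast_natAbs, Int.cast_abs] using
      Nat.cast_le (α := ℝ).mpr this
  have hDL : 1 ≤ |(discr L : ℝ)| := one_le_abs_discr
  have hle (K : IntermediateField ℚ L) : |(discr K : ℝ)| ≤ |(discr L : ℝ)| := by
    exact_mod_cast Int.le_of_dvd (abs_pos.mpr (discr_ne_zero L))
      ((abs_dvd_abs _ _).mpr (discr_dvd_discr K L))
  have hpos (K : IntermediateField ℚ L) : 1 ≤ |(discr K : ℝ)| := one_le_abs_discr
  rcases rpow_le_or_rpow_le_of_le_pow_mul_pow hDL (zero_lt_one.trans_le (hpos K₁))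
    (zero_lt_one.trans_le (hpos K₂)) hδ₁ hδ₂ hn0 hm0 hdiscr with h | h
  · refine (natCard_torsion_le_of_rpow_le hDL (hpos K₁) (hle K₁) hε hA₁ hC₁
      (hmain₁ K₁ L hK₁ hL ℓ) (h₁ K₁ ⟨e₁⟩) h).trans ?_
    gcongr
    exact le_max_left _ _
  · refine (natCard_torsion_le_of_rpow_le hDL (hpos K₂) (hle K₂) hε hA₂ hC₂
      (hmain₂ K₂ L hK₂ hL ℓ) (h₂ K₂ ⟨e₂⟩) h).trans ?_
    gcongr
    exact le_max_right _ _
end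

section
/- Let ℓ > 1 be an integer and let F ⊆ L be number fields (L a finite extension of F). Then |Cl_L[ℓ]| · h_F ≤ [L : F] · |Cl_F[ℓ]| · h_L, where h_F and h_L denote the class numbers of F and L. -/
open NumberField

open NumberField Filter Topology IsDedekindDomain

theorem card_torsion_mul_card_range_pow (A : Type*) [CommGroup A] (ℓ : ℕ) :
    Nat.card {x : A // x ^ ℓ = 1} * Nat.card (powMonoidHom ℓ : A →* A).range = Nat.card A := by
  have h := (powMonoidHom ℓ : A →* A).ker.card_mul_index
  rw [Subgroup.index_ker] at h
  exact h

theorem card_torsion_mul_card_le_of_index_range_le {A B : Type*} [CommGroup A] [CommGroup B]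
    [Finite A] [Finite B] (N : B →* A) {n : ℕ} (hn : N.range.index ≤ n) (ℓ : ℕ) :
    Nat.card {x : B // x ^ ℓ = 1} * Nat.card A ≤
      n * Nat.card {x : A // x ^ ℓ = 1} * Nat.card B := by
  have key : Nat.card (powMonoidHom ℓ : A →* A).range ≤
      N.range.index * Nat.card (powMonoidHom ℓ : B →* B).range := by
    rw [Subgroup.index, ← Nat.card_prod]
    let f : (A ⧸ N.range) × (powMonoidHom ℓ : B →* B).range → (powMonoidHom ℓ : A →* A).range :=
      fun p ↦ ⟨p.1.out ^ ℓ * N p.2.1, by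
        obtain ⟨c, b, x, rfl⟩ := p
        exact ⟨c.out * N x, by simp [mul_pow]⟩⟩
    refine Nat.card_le_card_of_surjective f ?_
    rintro ⟨_, a, rfl⟩
    obtain ⟨⟨_, x, rfl⟩, hb⟩ := QuotientGroup.mk_out_eq_mul N.range a
    refine ⟨(a, ⟨(x⁻¹) ^ ℓ, x⁻¹, rfl⟩), Subtype.ext ?_⟩
    simp only [f]
    rw [hb]
    simp [mul_pow]
  rw [← card_torsion_mul_card_range_pow A ℓ, ← card_torsion_mul_card_range_pow B ℓ]
  calc _ ≤ Nat.card {x : B // x ^ ℓ = 1} * (Nat.card {x : A // x ^ ℓ = 1} *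
        (n * Nat.card (powMonoidHom ℓ : B →* B).range)) := by gcongr; exact key.trans (by gcongr)
    _ = _ := by ring

section relNorm

open nonZeroDivisors IsDedekindDomain

variable (R S : Type*) [CommRing R] [IsDedekindDomain R] [CommRing S] [IsDedekindDomain S]
  [Algebra R S] [Module.Finite R S] [Module.IsTorsionFree R S]

/-- The relative norm on nonzero ideals, with values in the class group. -/
noncomputable def relNormClass : (Ideal S)⁰ →* ClassGroup R :=
  ClassGroup.mk0.comp <| ((Ideal.relNorm R : Ideal S →*₀ Ideal R).toMonoidHom.comp
    (Ideal S)⁰.subtype).codRestrict (Ideal R)⁰ fun I ↦ mem_nonZeroDivisors_iff_ne_zero.2 <|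
      Ideal.relNorm_eq_bot_iff.not.2 (nonZeroDivisors.coe_ne_zero I)

theorem relNormClass_apply (I : (Ideal S)⁰) (J : (Ideal R)⁰)
    (h : Ideal.relNorm R (I : Ideal S) = J) : relNormClass R S I = ClassGroup.mk0 J :=
  congrArg ClassGroup.mk0 (Subtype.ext h)

variable {R S} in
theorem relNormClass_eq_of_mk0_eq {I J : (Ideal S)⁰} (h : ClassGroup.mk0 I = ClassGroup.mk0 J) :
    relNormClass R S I = relNormClass R S J := by
  obtain ⟨x, y, hx, hy, h⟩ := ClassGroup.mk0_eq_mk0_iff.1 h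
  refine ClassGroup.mk0_eq_mk0_iff.2 ⟨Algebra.intNorm R S x, Algebra.intNorm R S y,
    Algebra.intNorm_ne_zero.2 hx, Algebra.intNorm_ne_zero.2 hy, ?_⟩
  have := congrArg (Ideal.relNorm R) h
  rwa [map_mul, map_mul, Ideal.relNorm_singleton, Ideal.relNorm_singleton] at this

/-- The relative norm homomorphism on ideal class groups. -/
noncomputable def ClassGroup.relNorm : ClassGroup S →* ClassGroup R where
  toFun C := relNormClass R S (ClassGroup.mk0_surjective C).choose
  map_one' := by
    rw [relNormClass_eq_of_mk0_eq (J := 1) ?_, map_one]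
    rw [(ClassGroup.mk0_surjective (1 : ClassGroup S)).choose_spec, map_one]
  map_mul' C D := by
    rw [← map_mul]
    refine relNormClass_eq_of_mk0_eq ?_
    rw [map_mul, (ClassGroup.mk0_surjective (C * D)).choose_spec,
      (ClassGroup.mk0_surjective C).choose_spec, (ClassGroup.mk0_surjective D).choose_spec]

theorem ClassGroup.relNorm_mk0 (I : (Ideal S)⁰) :
    ClassGroup.relNorm R S (ClassGroup.mk0 I) = relNormClass R S I :=
  relNormClass_eq_of_mk0_eq (ClassGroup.mk0_surjective (ClassGroup.mk0 I)).choose_spec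

variable {S} in
/-- The norm of the class of a prime is a power of the class of the prime below. -/
theorem ClassGroup.relNorm_mk0_prime [PerfectField (FractionRing R)] (P : HeightOneSpectrum S) :
    ClassGroup.relNorm R S (ClassGroup.mk0 ⟨P.asIdeal, mem_nonZeroDivisors_iff_ne_zero.2 P.ne_bot⟩) =
      ClassGroup.mk0 ⟨(P.under R).asIdeal, mem_nonZeroDivisors_iff_ne_zero.2 (P.under R).ne_bot⟩ ^
        P.asIdeal.inertiaDeg R := by
  have := P.isMaximal
  have := (P.under R).isMaximal
  have : P.asIdeal.LiesOver (P.under R).asIdeal := ⟨rfl⟩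
  rw [ClassGroup.relNorm_mk0, ← map_pow]
  exact relNormClass_apply _ _ _ _ (Ideal.relNorm_eq_pow_of_isMaximal _ _)

variable {R} in
theorem card_filter_under_le (T : Finset (HeightOneSpectrum S)) (p : HeightOneSpectrum R)
    [DecidableEq (HeightOneSpectrum R)] :
    (T.filter fun P ↦ P.under R = p).card ≤ Module.finrank R S := by
  have := p.isMaximal
  have hfin : (p.asIdeal.primesOver S).Finite := IsDedekindDomain.primesOver_finite p.asIdeal S
  let := hfin.fintype
  rw [← Ideal.sum_ramification_inertia_eq_finrank p.asIdeal S]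
  calc (T.filter fun P ↦ P.under R = p).card ≤ Fintype.card (p.asIdeal.primesOver S) := by
        rw [← Fintype.card_coe]
        refine Fintype.card_le_of_injective
          (fun P ↦ ⟨P.1.asIdeal, P.1.isPrime, ⟨?_⟩⟩) fun P Q h ↦ ?_
        · exact (congrArg HeightOneSpectrum.asIdeal (Finset.mem_filter.1 P.2).2).symm
        · exact Subtype.ext (HeightOneSpectrum.ext (congrArg Subtype.val h))
    _ ≤ _ := by
      rw [Fintype.card_eq_sum_ones]
      refine Finset.sum_le_sum fun P _ ↦ ?_
      have := P.2.1
      exact Nat.mul_pos (Ideal.ramificationIdx_pos _ _) (Ideal.inertiaDeg_pos _ _)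

end relNorm

theorem finrank_ringOfIntegers (F L : Type*) [Field F] [NumberField F] [Field L] [NumberField L]
    [Algebra F L] : Module.finrank (𝓞 F) (𝓞 L) = Module.finrank F L :=
  (IsFractionRing.finrank_eq (𝓞 F) F (𝓞 L) L).symm

section zeta
variable (K : Type*) [Field K] [NumberField K]

theorem hasSum_absNorm_rpow_iff (s a : ℝ) :
    HasSum (fun I : Ideal (𝓞 K) ↦ (Ideal.absNorm I : ℝ) ^ (-s)) a ↔
      HasSum (fun n : ℕ ↦ (Nat.card {I : Ideal (𝓞 K) // Ideal.absNorm I = n} : ℝ) *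
        (n : ℝ) ^ (-s)) a := by
  let e := Equiv.sigmaFiberEquiv (fun I : Ideal (𝓞 K) ↦ Ideal.absNorm I)
  have hfin (n : ℕ) : Finite {I : Ideal (𝓞 K) // Ideal.absNorm I = n} :=
    Ideal.finite_setOfPred_absNorm_eq n
  have hfib (n : ℕ) : HasSum (fun I : {I : Ideal (𝓞 K) // Ideal.absNorm I = n} ↦
      (Ideal.absNorm (e ⟨n, I⟩) : ℝ) ^ (-s))
      ((Nat.card {I : Ideal (𝓞 K) // Ideal.absNorm I = n} : ℝ) * (n : ℝ) ^ (-s)) := by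
    have := Fintype.ofFinite {I : Ideal (𝓞 K) // Ideal.absNorm I = n}
    have h := hasSum_fintype (fun I : {I : Ideal (𝓞 K) // Ideal.absNorm I = n} ↦
      (Ideal.absNorm (e ⟨n, I⟩) : ℝ) ^ (-s))
    convert h using 1
    rw [Finset.sum_congr rfl (g := fun _ ↦ (n : ℝ) ^ (-s))]
    · simp
    · intro I _
      simp [e, I.2]
  rw [← e.hasSum_iff]
  constructor
  · intro h
    exact h.sigma hfib
  · intro h
    have hsum : Summable ((fun I : Ideal (𝓞 K) ↦ (Ideal.absNorm I : ℝ) ^ (-s)) ∘ e) := by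
      rw [summable_sigma_of_nonneg (fun _ ↦ by simp only [Function.comp]; positivity)]
      refine ⟨fun n ↦ (hfib n).summable, h.summable.congr fun n ↦ (hfib n).tsum_eq.symm⟩
    have h2 := hsum.hasSum.sigma hfib
    rw [h.unique h2]
    exact hsum.hasSum

theorem summable_absNorm_rpow_iff (s : ℝ) (hs : s ≠ 0) :
    Summable (fun I : Ideal (𝓞 K) ↦ (Ideal.absNorm I : ℝ) ^ (-s)) ↔
    LSeriesSummable (fun n ↦ Nat.card {I : Ideal (𝓞 K) // Ideal.absNorm I = n}) (s : ℂ) := by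
  have : (LSeries.term (fun n ↦ (Nat.card {I : Ideal (𝓞 K) // Ideal.absNorm I = n} : ℂ)) (s : ℂ)) =
      fun n : ℕ ↦ (((Nat.card {I : Ideal (𝓞 K) // Ideal.absNorm I = n} : ℝ) *
        (n : ℝ) ^ (-s) : ℝ) : ℂ) := by
    ext n
    rcases eq_or_ne n 0 with rfl | hn
    · simp [hs]
    · rw [LSeries.term_of_ne_zero hn, Complex.ofReal_mul, Complex.ofReal_cpow (by positivity)]
      push_cast
      rw [Complex.cpow_neg, div_eq_mul_inv]
  rw [LSeriesSummable, this, Complex.summable_ofReal]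
  exact ⟨fun ⟨a, h⟩ ↦ ⟨a, (hasSum_absNorm_rpow_iff K s a).mp h⟩,
    fun ⟨a, h⟩ ↦ ⟨a, (hasSum_absNorm_rpow_iff K s a).mpr h⟩⟩

theorem dedekindZeta_eq_tsum_absNorm_rpow (s : ℝ) (hs : s ≠ 0)
    (h : Summable (fun I : Ideal (𝓞 K) ↦ (Ideal.absNorm I : ℝ) ^ (-s))) :
    dedekindZeta K s = ((∑' I : Ideal (𝓞 K), (Ideal.absNorm I : ℝ) ^ (-s) : ℝ) : ℂ) := by
  rw [((hasSum_absNorm_rpow_iff K s _).mp h.hasSum).tsum_eq.symm, Complex.ofReal_tsum]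
  refine tsum_congr fun n ↦ ?_
  rcases eq_or_ne n 0 with rfl | hn
  · simp [hs]
  · rw [LSeries.term_of_ne_zero hn, Complex.ofReal_mul, Complex.ofReal_cpow (by positivity)]
    push_cast
    rw [Complex.cpow_neg, div_eq_mul_inv]

theorem summable_absNorm_rpow {s : ℝ} (hs : 1 < s) :
    Summable (fun I : Ideal (𝓞 K) ↦ (Ideal.absNorm I : ℝ) ^ (-s)) := by
  have h := (tendsto_sub_one_mul_dedekindZeta_nhdsGT K).eventually_ne
    (Complex.ofReal_ne_zero.mpr (dedekindZeta_residue_ne_zero K))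
  obtain ⟨t, ht, ht1, hts⟩ := (h.and (Ioo_mem_nhdsGT hs)).exists
  rw [summable_absNorm_rpow_iff K s (by positivity)]
  have : LSeriesSummable (fun n ↦ Nat.card {I : Ideal (𝓞 K) // Ideal.absNorm I = n}) (t : ℂ) := by
    by_contra hcon
    refine ht ?_
    rw [dedekindZeta, LSeries, tsum_eq_zero_of_not_summable hcon, mul_zero]
  exact this.of_re_le_re (by simpa using hts.le)

theorem tendsto_sub_one_mul_tsum_absNorm_rpow :
    Tendsto (fun s : ℝ ↦ (s - 1) * ∑' I : Ideal (𝓞 K), (Ideal.absNorm I : ℝ) ^ (-s))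
      (𝓝[>] 1) (𝓝 (dedekindZeta_residue K)) := by
  have h := (Complex.continuous_re.tendsto _).comp (tendsto_sub_one_mul_dedekindZeta_nhdsGT K)
  refine h.congr' ?_
  filter_upwards [self_mem_nhdsWithin] with s hs
  have hs : 1 < s := hs
  simp only [Function.comp]
  rw [dedekindZeta_eq_tsum_absNorm_rpow K s (by positivity) (summable_absNorm_rpow K hs),
    ← Complex.ofReal_one, ← Complex.ofReal_sub, ← Complex.ofReal_mul, Complex.ofReal_re]

end zeta

theorem tsum_coprime_eq_prod_one_sub_mul_tsum {R 𝕜 : Type*} [CommRing R] [IsDedekindDomain R]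
    [NormedField 𝕜] [CompleteSpace 𝕜]
    (f : Ideal R →*₀ 𝕜) (hf : Summable fun I ↦ ‖f I‖) (T : Finset (HeightOneSpectrum R)) :
    ∑' I : Ideal R, {I | ∀ p ∈ T, ¬ p.asIdeal ∣ I}.indicator f I =
      (∏ p ∈ T, (1 - f p.asIdeal)) * ∑' I, f I := by
  classical
  induction T using Finset.induction_on with
  | empty => simp
  | insert p T hp ih =>
    have hs : Summable f := hf.of_norm
    rw [Finset.prod_insert hp, mul_assoc, ← ih, sub_mul, one_mul, ← tsum_mul_left]
    have key : ∑' I, f p.asIdeal * {I | ∀ p ∈ T, ¬ p.asIdeal ∣ I}.indicator f I =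
        ∑' I, {I | p.asIdeal ∣ I ∧ ∀ p ∈ T, ¬ p.asIdeal ∣ I}.indicator f I := by
      have hinj : Function.Injective fun I : Ideal R ↦ p.asIdeal * I :=
        mul_right_injective₀ p.ne_bot
      refine Eq.trans ?_ (hinj.tsum_eq ?_)
      · refine tsum_congr fun I ↦ ?_
        have : (∀ q ∈ T, ¬ q.asIdeal ∣ p.asIdeal * I) ↔ ∀ q ∈ T, ¬ q.asIdeal ∣ I := by
          refine forall₂_congr fun q hq ↦ not_congr ⟨fun h ↦ ?_, fun h ↦ h.mul_left _⟩
          refine (q.prime.dvd_or_dvd h).resolve_left fun h' ↦ hp ?_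
          have : p.asIdeal = q.asIdeal :=
            (p.isMaximal.eq_of_le q.isPrime.ne_top (Ideal.dvd_iff_le.mp h'))
          rwa [HeightOneSpectrum.ext this]
        by_cases h : ∀ q ∈ T, ¬ q.asIdeal ∣ I <;>
          simp only [Set.indicator_apply, Set.mem_ofPred_eq, this, h, dvd_mul_right, map_mul] <;> simp
      · intro I hI
        obtain ⟨J, rfl⟩ := (Set.indicator_apply_ne_zero.mp hI).1.1
        exact ⟨J, rfl⟩
    rw [key, ← (hs.indicator _).tsum_sub (hs.indicator _)]
    refine tsum_congr fun I ↦ ?_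
    by_cases h : ∀ q ∈ T, ¬ q.asIdeal ∣ I <;> by_cases h' : p.asIdeal ∣ I <;>
      simp only [Set.indicator_apply, Set.mem_ofPred_eq, Finset.forall_mem_insert, h, h'] <;> simp

theorem tendsto_prod_one_sub_mul_tsum {R 𝕜 : Type*} [CommRing R] [IsDedekindDomain R]
    [NormedField 𝕜] [CompleteSpace 𝕜]
    (f : Ideal R →*₀ 𝕜) (hf : Summable fun I ↦ ‖f I‖) :
    Tendsto (fun T : Finset (HeightOneSpectrum R) ↦
      (∏ p ∈ T, (1 - f p.asIdeal)) * ∑' I, f I) atTop (𝓝 1) := by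
  classical
  simp_rw [← tsum_coprime_eq_prod_one_sub_mul_tsum f hf]
  have : (1 : 𝕜) = ∑' I : Ideal R, if I = ⊤ then 1 else 0 := by simp
  rw [this]
  refine tendsto_tsum_of_dominated_convergence hf (fun I ↦ ?_) (Eventually.of_forall fun T I ↦ ?_)
  · refine tendsto_const_nhds.congr' ?_
    by_cases hI : I = ⊤
    · refine Eventually.of_forall fun T ↦ ?_
      subst hI
      beta_reduce
      rw [if_pos rfl, Set.indicator_of_mem, ← Ideal.one_eq_top, map_one]
      intro p _ h
      exact p.isPrime.ne_top (top_le_iff.mp (Ideal.dvd_iff_le.mp h))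
    · by_cases hI0 : I = ⊥
      · refine Eventually.of_forall fun T ↦ ?_
        subst hI0
        beta_reduce
        rw [if_neg hI, Set.indicator_apply]
        have : f ⊥ = 0 := map_zero f
        simp [this]
      · obtain ⟨M, hM, hIM⟩ := Ideal.exists_le_maximal I hI
        let p : HeightOneSpectrum R := ⟨M, hM.isPrime, fun h ↦ hI0 (le_bot_iff.mp (h ▸ hIM))⟩
        filter_upwards [eventually_ge_atTop {p}] with T hT
        rw [if_neg hI, Set.indicator_of_notMem]
        intro h
        exact h p (hT (Finset.mem_singleton_self p)) (Ideal.dvd_iff_le.mpr hIM)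
  · exact norm_indicator_le_norm_self _ _

theorem one_le_prod_one_sub_mul_tsum {R : Type*} [CommRing R] [IsDedekindDomain R]
    (f : Ideal R →*₀ ℝ) (hf : Summable f) (hf0 : ∀ I, 0 ≤ f I)
    (T : Finset (HeightOneSpectrum R)) :
    1 ≤ (∏ p ∈ T, (1 - f p.asIdeal)) * ∑' I, f I := by
  rw [← tsum_coprime_eq_prod_one_sub_mul_tsum f hf.norm]
  have h1 : {I : Ideal R | ∀ p ∈ T, ¬ p.asIdeal ∣ I}.indicator f 1 = 1 := by
    rw [Set.indicator_of_mem, map_one]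
    intro p _ h
    exact p.isPrime.ne_top (top_le_iff.mp (Ideal.one_eq_top (R := R) ▸ Ideal.dvd_iff_le.mp h))
  rw [← h1]
  exact (hf.indicator _).le_tsum 1 fun I _ ↦ Set.indicator_nonneg (fun I _ ↦ hf0 I) I

theorem AddMonoidHom.tsum_comp_eq_card_ker_mul {A B : Type*} [AddGroup A] [AddGroup B]
    (φ : A →+ B) (hφ : Function.Surjective φ) (G : B → ENNReal) :
    ∑' a, G (φ a) = (ENat.card φ.ker : ENNReal) * ∑' b, G b := by
  rw [← (Equiv.sigmaFiberEquiv φ).tsum_eq, ENNReal.tsum_sigma', ← ENNReal.tsum_mul_left]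
  refine tsum_congr fun b ↦ ?_
  obtain ⟨a, rfl⟩ := hφ b
  have e : φ.ker ≃ {x : A // φ x = φ a} :=
    { toFun := fun k ↦ ⟨k + a, by simp [(AddMonoidHom.mem_ker).mp k.2]⟩
      invFun := fun x ↦ ⟨x - a, by simp [AddMonoidHom.mem_ker, x.2]⟩
      left_inv := fun k ↦ by simp
      right_inv := fun x ↦ by simp }
  rw [ENat.card_congr e, ← ENNReal.tsum_const]
  exact tsum_congr fun x ↦ by rw [Equiv.sigmaFiberEquiv_apply, x.2]

section weight

open NumberField.Units NumberField.Units.dirichletUnitTheorem NumberField.InfinitePlace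
open MeasureTheory Module

variable (K : Type*) [Field K] [NumberField K]

variable {K} in
/-- The sup norm of `x` with the coordinate at the place `w` rescaled by `exp (y w)`. -/
noncomputable def twistedNorm (y : InfinitePlace K → ℝ) (x : K) : ℝ :=
  ‖fun w : InfinitePlace K ↦ Real.exp (y w) * w x‖

variable {K} in
open scoped Classical in
/-- The vector of trace zero whose coordinates `mult w * a w`, for `w ≠ w₀`, are given. -/
noncomputable def traceZeroExtend (y : logSpace K) (w : InfinitePlace K) : ℝ :=
  if h : w = w₀ then -(∑ v, y v) / mult w else y ⟨w, h⟩ / mult w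

variable {K}

theorem traceZeroExtend_add (y z : logSpace K) :
    traceZeroExtend (y + z) = traceZeroExtend y + traceZeroExtend z := by
  ext w
  by_cases h : w = w₀ <;>
    simp only [traceZeroExtend, h, Pi.add_apply, dite_true, dite_false, Finset.sum_add_distrib] <;>
    ring

theorem continuous_traceZeroExtend : Continuous (traceZeroExtend (K := K)) := by
  refine continuous_pi fun w ↦ ?_
  by_cases h : w = w₀ <;> simp only [traceZeroExtend, h, dite_true, dite_false] <;> fun_prop

theorem traceZeroExtend_mult_mul {a : InfinitePlace K → ℝ} (ha : ∑ w, mult w * a w = 0) :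
    traceZeroExtend (fun w : {w : InfinitePlace K // w ≠ w₀} ↦ mult w.1 * a w.1) = a := by
  classical
  ext w
  have hm : (mult w : ℝ) ≠ 0 := mult_coe_ne_zero
  by_cases h : w = w₀
  · rw [Fintype.sum_eq_add_sum_subtype_ne _ w₀] at ha
    simp only [traceZeroExtend, h, dite_true]
    subst h
    rw [div_eq_iff hm]
    linarith
  · simp only [traceZeroExtend, h, dite_false]
    field_simp

theorem traceZeroExtend_logEmbedding (u : (𝓞 K)ˣ) :
    traceZeroExtend (logEmbedding K (Additive.ofMul u)) = fun w ↦ Real.log (w (u : K)) :=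
  traceZeroExtend_mult_mul (sum_mult_mul_log u)

theorem twistedNorm_nonneg (y : InfinitePlace K → ℝ) (x : K) : 0 ≤ twistedNorm y x :=
  norm_nonneg _

theorem twistedNorm_zero (y : InfinitePlace K → ℝ) : twistedNorm y 0 = 0 := by
  simp [twistedNorm]

theorem le_twistedNorm (y : InfinitePlace K → ℝ) (x : K) (w : InfinitePlace K) :
    Real.exp (y w) * w x ≤ twistedNorm y x := by
  refine (le_abs_self _).trans ?_
  exact norm_le_pi_norm (fun w : InfinitePlace K ↦ Real.exp (y w) * w x) w

theorem twistedNorm_le_iff {y : InfinitePlace K → ℝ} {x : K} {r : ℝ} (hr : 0 ≤ r) :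
    twistedNorm y x ≤ r ↔ ∀ w : InfinitePlace K, Real.exp (y w) * w x ≤ r := by
  rw [twistedNorm, pi_norm_le_iff_of_nonneg hr]
  refine forall_congr' fun w ↦ ?_
  rw [Real.norm_of_nonneg (by positivity)]

theorem twistedNorm_neg (y : InfinitePlace K → ℝ) (x : K) :
    twistedNorm y (-x) = twistedNorm y x := by
  have h (w : InfinitePlace K) : w (-x) = w x := w.1.map_neg x
  simp only [twistedNorm, h]

theorem twistedNorm_add_le (y : InfinitePlace K → ℝ) (x x' : K) :
    twistedNorm y (x + x') ≤ twistedNorm y x + twistedNorm y x' := by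
  rw [twistedNorm_le_iff (add_nonneg (twistedNorm_nonneg _ _) (twistedNorm_nonneg _ _))]
  intro w
  grw [← le_twistedNorm y x w, ← le_twistedNorm y x' w, ← mul_add]
  gcongr
  exact w.1.add_le x x'

theorem twistedNorm_mul {y a : InfinitePlace K → ℝ} {x x' : K} {c : ℝ} (hc : 0 ≤ c)
    (h : ∀ w : InfinitePlace K, w x' = c * Real.exp (a w)) :
    twistedNorm y (x' * x) = c * twistedNorm (y + a) x := by
  have : (fun w : InfinitePlace K ↦ Real.exp (y w) * w (x' * x)) =
      c • fun w : InfinitePlace K ↦ Real.exp ((y + a) w) * w x := by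
    ext w
    simp only [map_mul, h w, Pi.smul_apply, smul_eq_mul, Pi.add_apply, Real.exp_add]
    ring
  rw [twistedNorm, this, norm_smul, Real.norm_of_nonneg hc, twistedNorm]

theorem exists_eq_abs_norm_rpow_mul_exp_traceZeroExtend {x : K} (hx : x ≠ 0) :
    ∃ z : logSpace K, ∀ w : InfinitePlace K,
      w x = (|Algebra.norm ℚ x| : ℝ) ^ (finrank ℚ K : ℝ)⁻¹ * Real.exp (traceZeroExtend z w) := by
  have hN : (0 : ℝ) < (|Algebra.norm ℚ x| : ℚ) := by
    exact_mod_cast abs_pos.mpr (Algebra.norm_ne_zero_iff.mpr hx)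
  have hd : (finrank ℚ K : ℝ) ≠ 0 := by exact_mod_cast finrank_pos.ne'
  set c : ℝ := Real.log (|Algebra.norm ℚ x| : ℚ) / finrank ℚ K with hc
  have hsum : ∑ w : InfinitePlace K, mult w * (Real.log (w x) - c) = 0 := by
    have h1 : ∑ w : InfinitePlace K, (mult w : ℝ) * Real.log (w x) =
        Real.log (|Algebra.norm ℚ x| : ℚ) := by
      rw [← prod_eq_abs_norm, Real.log_prod fun w _ ↦ by
        simpa using fun h ↦ absurd h hx]
      simp
    have h2 : ∑ w : InfinitePlace K, (mult w : ℝ) = finrank ℚ K := by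
      exact_mod_cast sum_mult_eq
    simp only [mul_sub, Finset.sum_sub_distrib, ← Finset.sum_mul, h1, h2, hc]
    field_simp
    ring
  refine ⟨fun w ↦ mult w.1 * (Real.log (w.1 x) - c), fun w ↦ ?_⟩
  rw [traceZeroExtend_mult_mul hsum, Real.exp_sub, Real.exp_log (pos_iff.mpr hx),
    Real.rpow_def_of_pos (by simpa using hN), hc, div_eq_mul_inv (Real.log _)]
  push_cast
  field_simp

variable (K)

open scoped Classical in
/-- A bounded fundamental domain for the logarithmic lattice of the units. -/
noncomputable def unitDomain : Set (logSpace K) :=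
  ZSpan.fundamentalDomain ((basisUnitLattice K).ofZLatticeBasis ℝ (unitLattice K))

variable {K} in
open scoped Classical in
/-- A weight on `K` which is comparable to `‖x‖ ^ (-[K : ℚ] s)` and whose sum over the
associates of `x` depends only on the norm of `x`. -/
noncomputable def idealWeight (s : ℝ) (x : K) : ENNReal :=
  ∫⁻ y in unitDomain K, ENNReal.ofReal (twistedNorm (traceZeroExtend y) x ^ (-(finrank ℚ K * s)))

open scoped Classical in
/-- The constant relating `idealWeight` to the norm. -/
noncomputable def idealWeightConst (s : ℝ) : ENNReal :=
  (ENat.card (torsion K) : ENNReal) *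
    ∫⁻ y : logSpace K, ENNReal.ofReal (twistedNorm (traceZeroExtend y) (1 : K) ^ (-(finrank ℚ K * s)))

open scoped Classical in
theorem isAddFundamentalDomain_unitDomain :
    IsAddFundamentalDomain (unitLattice K) (unitDomain K) :=
  ZLattice.isAddFundamentalDomain (basisUnitLattice K) volume

open scoped Classical in
theorem tsum_units_idealWeight (s : ℝ) {x : K} (hx : x ≠ 0) :
    ∑' u : (𝓞 K)ˣ, idealWeight s ((u : K) * x) =
      idealWeightConst K s * ENNReal.ofReal ((|Algebra.norm ℚ x| : ℝ) ^ (-s)) := by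
  set m : ℝ := finrank ℚ K * s with hm
  have hd : (finrank ℚ K : ℝ) ≠ 0 := by exact_mod_cast finrank_pos.ne'
  let g : logSpace K → ENNReal := fun y ↦ ENNReal.ofReal (twistedNorm (traceZeroExtend y) x ^ (-m))
  let φ : Additive (𝓞 K)ˣ →+ unitLattice K :=
    (logEmbedding K).codRestrict (unitLattice K) fun u ↦ ⟨u, trivial, rfl⟩
  have hφ : Function.Surjective φ := by
    rintro ⟨_, u, -, rfl⟩
    exact ⟨u, rfl⟩
  have hker : ENat.card φ.ker = ENat.card (torsion K) := by
    have : φ.ker = (torsion K).toAddSubgroup := by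
      rw [← logEmbedding_ker]
      ext u
      simp only [AddMonoidHom.mem_ker, φ, Subtype.ext_iff]
      rfl
    rw [this]
    rfl
  have h1 (u : (𝓞 K)ˣ) : idealWeight s ((u : K) * x) =
      ∫⁻ y in unitDomain K, g ((φ (Additive.ofMul u)) +ᵥ y) := by
    refine lintegral_congr fun y ↦ ?_
    have hu : ∀ w : InfinitePlace K,
        w (u : K) = 1 * Real.exp (traceZeroExtend (logEmbedding K (Additive.ofMul u)) w) := by
      intro w
      rw [traceZeroExtend_logEmbedding, Real.exp_log (Units.pos_at_place _ _), one_mul]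
    have hv : φ (Additive.ofMul u) +ᵥ y = y + logEmbedding K (Additive.ofMul u) := add_comm _ _
    rw [twistedNorm_mul zero_le_one hu, one_mul, hv, ← traceZeroExtend_add]
  have : MeasurableVAdd (unitLattice K) (logSpace K) :=
    (inferInstance : MeasurableVAdd (unitLattice K).toAddSubgroup (logSpace K))
  have : VAddInvariantMeasure (unitLattice K) (logSpace K) volume :=
    (inferInstance : VAddInvariantMeasure (unitLattice K).toAddSubgroup (logSpace K) volume)
  have h2 : ∑' u : (𝓞 K)ˣ, idealWeight s ((u : K) * x) =
      (ENat.card (torsion K) : ENNReal) * ∫⁻ y, g y := by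
    rw [(isAddFundamentalDomain_unitDomain K).lintegral_eq_tsum'', ← hker,
      ← AddMonoidHom.tsum_comp_eq_card_ker_mul φ hφ]
    exact tsum_congr h1
  obtain ⟨z, hz⟩ := exists_eq_abs_norm_rpow_mul_exp_traceZeroExtend hx
  have hN : 0 ≤ |(Algebra.norm ℚ x : ℝ)| := abs_nonneg _
  have h3 (y : logSpace K) : g y = ENNReal.ofReal ((|Algebra.norm ℚ x| : ℝ) ^ (-s)) *
      ENNReal.ofReal (twistedNorm (traceZeroExtend (y + z)) (1 : K) ^ (-m)) := by
    have := twistedNorm_mul (y := traceZeroExtend y) (x := 1) (by positivity) hz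
    rw [mul_one, ← traceZeroExtend_add] at this
    simp only [g]
    rw [this, Real.mul_rpow (by positivity) (twistedNorm_nonneg _ _), ← Real.rpow_mul hN,
      ENNReal.ofReal_mul (by positivity), hm]
    congr 3
    field_simp
  rw [h2, lintegral_congr h3, lintegral_const_mul' _ _ ENNReal.ofReal_ne_top,
    lintegral_add_right_eq_self
      (fun y : logSpace K ↦ ENNReal.ofReal (twistedNorm (traceZeroExtend y) (1 : K) ^ (-m))) z,
    idealWeightConst]
  ring

end weight

/-- If `v ≤ u + A` with `u, v` bounded below by `δ`, then `u ^ (-m)` exceeds `v ^ (-m)` by at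
most a constant times `v ^ (-(d + 1))`, uniformly for `m ∈ [d, 2 * d]`. -/
theorem Real.rpow_neg_le_rpow_neg_add {d δ A u v m : ℝ} (hd : 1 ≤ d) (hδ : 0 < δ) (hδ1 : δ ≤ 1)
    (hA : 0 ≤ A) (hu : δ ≤ u) (hv : δ ≤ v) (huv : v ≤ u + A) (hm : d ≤ m) (hm' : m ≤ 2 * d) :
    u ^ (-m) ≤ v ^ (-m) + (1 + A / δ) ^ (2 * d) * (2 * d) * A * δ ^ (-d) * v ^ (-(d + 1)) := by
  have hu0 : 0 < u := hδ.trans_le hu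
  have hv0 : 0 < v := hδ.trans_le hv
  have hR : 1 ≤ 1 + A / δ := le_add_of_nonneg_right (by positivity)
  have hvR : v ≤ u * (1 + A / δ) := by
    refine huv.trans ?_
    rw [mul_add, mul_one]
    rw [mul_div_assoc']
    gcongr
    rw [le_div_iff₀ hδ]
    nlinarith
  have h1 : u ^ (-m) ≤ (1 + A / δ) ^ (2 * d) * v ^ (-m) := by
    have : u ^ (-m) ≤ (1 + A / δ) ^ m * v ^ (-m) := by
      rw [Real.rpow_neg hu0.le, Real.rpow_neg hv0.le, ← div_eq_mul_inv, le_div_iff₀ (by positivity),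
        inv_mul_le_iff₀ (by positivity), ← Real.mul_rpow hu0.le (by positivity)]
      exact Real.rpow_le_rpow hv0.le hvR (by linarith)
    grw [this]
    gcongr
  have h2 : v ^ (-m) * v⁻¹ ≤ δ ^ (-d) * v ^ (-(d + 1)) := by
    rw [← Real.rpow_neg_one v, ← Real.rpow_add hv0,
      show -m + -1 = -(m - d) + -(d + 1) by ring, Real.rpow_add hv0]
    gcongr
    calc v ^ (-(m - d)) ≤ δ ^ (-(m - d)) :=
          Real.rpow_le_rpow_of_nonpos hδ hv (by linarith)
      _ ≤ δ ^ (-d) := Real.rpow_le_rpow_of_exponent_ge hδ hδ1 (by linarith)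
  have hm0 : 0 ≤ m := by linarith
  have h3 : u ^ (-m) - v ^ (-m) ≤ u ^ (-m) * (m * A * v⁻¹) := by
    have hb := one_add_mul_self_le_rpow_one_add (s := u / v - 1)
      (by have : 0 ≤ u / v := by positivity
          linarith) (p := m) (by linarith)
    rw [add_sub_cancel, Real.div_rpow hu0.le hv0.le] at hb
    have hq : -(A * v⁻¹) ≤ u / v - 1 := by
      rw [← div_eq_mul_inv, neg_le_sub_iff_le_add, ← add_div, one_le_div hv0]
      linarith
    have hb' : 1 - u ^ m / v ^ m ≤ m * A * v⁻¹ := by nlinarith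
    calc u ^ (-m) - v ^ (-m) = u ^ (-m) * (1 - u ^ m / v ^ m) := by
          rw [Real.rpow_neg hu0.le, Real.rpow_neg hv0.le]
          field_simp
      _ ≤ _ := by gcongr
  calc u ^ (-m) ≤ v ^ (-m) + u ^ (-m) * (m * A * v⁻¹) := by linarith
    _ ≤ v ^ (-m) + (1 + A / δ) ^ (2 * d) * v ^ (-m) * (2 * d * A * v⁻¹) := by
      have : 0 ≤ m * A * v⁻¹ := by positivity
      gcongr
    _ = v ^ (-m) + (1 + A / δ) ^ (2 * d) * (2 * d) * A * (v ^ (-m) * v⁻¹) := by ring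
    _ ≤ v ^ (-m) + (1 + A / δ) ^ (2 * d) * (2 * d) * A * (δ ^ (-d) * v ^ (-(d + 1))) := by gcongr
    _ = _ := by ring

section weight

open NumberField.Units NumberField.Units.dirichletUnitTheorem NumberField.InfinitePlace
open MeasureTheory Module
open scoped Classical

variable (K : Type*) [Field K] [NumberField K]

theorem isBounded_unitDomain : Bornology.IsBounded (unitDomain K) :=
  ZSpan.fundamentalDomain_isBounded _

theorem exists_forall_abs_traceZeroExtend_le :
    ∃ B : ℝ, ∀ y ∈ unitDomain K, ∀ w, |traceZeroExtend y w| ≤ B := by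
  obtain ⟨B, hB⟩ := (isBounded_unitDomain K).isCompact_closure.exists_bound_of_continuousOn
    (f := traceZeroExtend) continuous_traceZeroExtend.continuousOn
  exact ⟨B, fun y hy w ↦ (norm_le_pi_norm _ w).trans (hB y (subset_closure hy))⟩

variable {K}

theorem twistedNorm_le_exp_mul {y z : InfinitePlace K → ℝ} {B : ℝ} (h : ∀ w, y w ≤ z w + B)
    (x : K) : twistedNorm y x ≤ Real.exp B * twistedNorm z x := by
  rw [twistedNorm_le_iff (mul_nonneg (Real.exp_pos _).le (twistedNorm_nonneg _ _))]
  intro w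
  grw [← le_twistedNorm z x w, ← mul_assoc, ← Real.exp_add, h w, add_comm B]

theorem twistedNorm_zero_eq (x : K) :
    twistedNorm (0 : InfinitePlace K → ℝ) x = ‖mixedEmbedding K x‖ := by
  rw [mixedEmbedding.norm_eq_sup'_normAtPlace]
  simp only [mixedEmbedding.normAtPlace_apply]
  refine le_antisymm ?_ ?_
  · rw [twistedNorm_le_iff]
    · intro w
      rw [Pi.zero_apply, Real.exp_zero, one_mul]
      exact Finset.le_sup' (fun w : InfinitePlace K ↦ w x) (Finset.mem_univ w)
    · obtain ⟨w⟩ := (inferInstance : Nonempty (InfinitePlace K))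
      exact (apply_nonneg w x).trans
        (Finset.le_sup' (fun w : InfinitePlace K ↦ w x) (Finset.mem_univ w))
  · refine Finset.sup'_le _ _ fun w _ ↦ ?_
    simpa using le_twistedNorm 0 x w

theorem one_le_twistedNorm_zero {x : 𝓞 K} (hx : x ≠ 0) :
    1 ≤ twistedNorm (0 : InfinitePlace K → ℝ) (x : K) := by
  by_contra! h
  have h1 (w : InfinitePlace K) : w (x : K) < 1 := by
    have := le_twistedNorm 0 (x : K) w
    simp only [Pi.zero_apply, Real.exp_zero, one_mul] at this
    linarith
  have h2 : (1 : ℝ) ≤ (|Algebra.norm ℚ (x : K)| : ℚ) := by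
    rw [← Algebra.coe_norm_int, ← Int.cast_abs]
    exact_mod_cast Int.one_le_abs (Algebra.norm_ne_zero_iff.mpr hx)
  rw [← prod_eq_abs_norm] at h2
  refine absurd h2 (not_le.mpr ?_)
  calc ∏ w : InfinitePlace K, w (x : K) ^ mult w < ∏ _w : InfinitePlace K, (1 : ℝ) :=
        Finset.prod_lt_prod_of_nonempty
          (fun w _ ↦ pow_pos (pos_iff.mpr (by exact_mod_cast hx)) _)
          (fun w _ ↦ pow_lt_one₀ (apply_nonneg _ _) (h1 w) mult_ne_zero) Finset.univ_nonempty
    _ = 1 := Finset.prod_const_one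

theorem summable_twistedNorm_zero_rpow {r : ℝ} (hr : (finrank ℚ K : ℝ) < r) :
    Summable fun x : 𝓞 K ↦ twistedNorm (0 : InfinitePlace K → ℝ) (x : K) ^ (-r) := by
  have h := ZLattice.summable_norm_rpow (mixedEmbedding.integerLattice K) (-r) (by
    rw [ZLattice.rank ℝ, mixedEmbedding.finrank]
    linarith)
  let f : 𝓞 K → mixedEmbedding.integerLattice K := fun x ↦ ⟨mixedEmbedding K (x : K), x, rfl⟩
  have hf : Function.Injective f := fun x y hxy ↦
    RingOfIntegers.coe_injective (mixedEmbedding_injective K (congrArg Subtype.val hxy))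
  refine (h.comp_injective hf).congr fun x ↦ ?_
  simp [twistedNorm_zero_eq, f]

end weight

section weight

open NumberField.Units NumberField.Units.dirichletUnitTheorem NumberField.InfinitePlace
open MeasureTheory Module
open scoped Classical

variable (K : Type*) [Field K] [NumberField K]

theorem volume_unitDomain_ne_top : volume (unitDomain K) ≠ ⊤ :=
  (isBounded_unitDomain K).measure_lt_top.ne

theorem volume_unitDomain_ne_zero : volume (unitDomain K) ≠ 0 :=
  ZSpan.measure_fundamentalDomain_ne_zero _

theorem measurableSet_unitDomain : MeasurableSet (unitDomain K) :=
  ZSpan.fundamentalDomain_measurableSet _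

theorem exists_mul_twistedNorm_le :
    ∃ δ : ℝ, 0 < δ ∧ δ ≤ 1 ∧ ∀ y ∈ unitDomain K, ∀ x : K,
      δ * twistedNorm 0 x ≤ twistedNorm (traceZeroExtend y) x ∧
      δ * twistedNorm (traceZeroExtend y) x ≤ twistedNorm 0 x := by
  obtain ⟨B, hB⟩ := exists_forall_abs_traceZeroExtend_le K
  refine ⟨Real.exp (-|B|), Real.exp_pos _, by simp, fun y hy x ↦ ⟨?_, ?_⟩⟩ <;>
  · rw [Real.exp_neg, inv_mul_le_iff₀ (Real.exp_pos _)]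
    refine twistedNorm_le_exp_mul (fun w ↦ ?_) x
    have := abs_le.mp ((hB y hy w).trans (le_abs_self B))
    simp only [Pi.zero_apply]
    linarith

variable {K}

theorem idealWeight_zero {s : ℝ} (hs : 0 < s) : idealWeight s (0 : K) = 0 := by
  have : -((finrank ℚ K : ℝ) * s) ≠ 0 :=
    neg_ne_zero.mpr (mul_ne_zero (by exact_mod_cast finrank_pos.ne') hs.ne')
  simp [idealWeight, twistedNorm_zero, Real.zero_rpow this]

theorem tsum_idealWeight_ne_top {s : ℝ} (hs : 1 < s) :
    ∑' x : 𝓞 K, idealWeight s (x : K) ≠ ⊤ := by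
  obtain ⟨δ, hδ, -, h⟩ := exists_mul_twistedNorm_le K
  have hd : (0 : ℝ) < finrank ℚ K := by exact_mod_cast finrank_pos
  set m : ℝ := finrank ℚ K * s with hm
  have hle (x : 𝓞 K) : idealWeight s (x : K) ≤
      ENNReal.ofReal (δ ^ (-m) * twistedNorm 0 (x : K) ^ (-m)) * volume (unitDomain K) := by
    rcases eq_or_ne x 0 with rfl | hx
    · simp [idealWeight_zero (zero_lt_one.trans hs)]
    rw [← setLIntegral_const]
    refine setLIntegral_mono' (measurableSet_unitDomain K) fun y hy ↦ ?_
    rw [← Real.mul_rpow hδ.le (twistedNorm_nonneg _ _)]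
    have := one_le_twistedNorm_zero hx
    refine ENNReal.ofReal_le_ofReal
      (Real.rpow_le_rpow_of_nonpos (by positivity) (h y hy x).1 ?_)
    nlinarith
  refine ((ENNReal.tsum_le_tsum hle).trans_lt ?_).ne
  rw [ENNReal.tsum_mul_right]
  refine ENNReal.mul_lt_top ?_ (volume_unitDomain_ne_top K).lt_top
  refine lt_top_iff_ne_top.mpr (Summable.tsum_ofReal_ne_top (Summable.mul_left _ ?_))
  exact summable_twistedNorm_zero_rpow (by nlinarith)

/-- Translating by an integer changes `idealWeight` by a summable amount, uniformly in `s`. -/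
theorem exists_idealWeight_add_le (a : 𝓞 K) :
    ∃ g : 𝓞 K → ENNReal, ∑' x, g x ≠ ⊤ ∧ ∀ s : ℝ, 1 < s → s ≤ 2 → ∀ x : 𝓞 K,
      idealWeight s ((x + a : 𝓞 K) : K) ≤ idealWeight s (x : K) + g x := by
  obtain ⟨δ, hδ, hδ1, h⟩ := exists_mul_twistedNorm_le K
  have hd : (1 : ℝ) ≤ finrank ℚ K := by exact_mod_cast finrank_pos
  set d : ℝ := (finrank ℚ K : ℝ) with hd'
  set A : ℝ := δ⁻¹ * twistedNorm 0 (a : K) with hA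
  have hA0 : 0 ≤ A := mul_nonneg (by positivity) (twistedNorm_nonneg _ _)
  set c : ℝ := (1 + A / δ) ^ (2 * d) * (2 * d) * A * δ ^ (-d) with hc
  have hc0 : 0 ≤ c := by positivity
  let κ : 𝓞 K → ℝ := fun x ↦ (if x = 0 then δ ^ (-(2 * d)) else 0) +
    c * δ ^ (-(d + 1)) * twistedNorm 0 (x : K) ^ (-(d + 1))
  have hκ : Summable κ := by
    refine Summable.add (summable_of_hasFiniteSupport ?_) (Summable.mul_left _ ?_)
    · refine (Set.finite_singleton (0 : 𝓞 K)).subset fun x hx ↦ ?_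
      by_contra h0
      simp_all
    · exact summable_twistedNorm_zero_rpow (by linarith)
  have hκ0 (x : 𝓞 K) : 0 ≤ κ x := by
    have := twistedNorm_nonneg 0 (x : K)
    simp only [κ]
    split_ifs <;> positivity
  refine ⟨fun x ↦ ENNReal.ofReal (κ x) * volume (unitDomain K), ?_, fun s hs hs2 x ↦ ?_⟩
  · rw [ENNReal.tsum_mul_right]
    exact ENNReal.mul_ne_top hκ.tsum_ofReal_ne_top (volume_unitDomain_ne_top K)
  beta_reduce
  rw [idealWeight, idealWeight, ← setLIntegral_const, ← lintegral_add_right _ measurable_const]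
  refine setLIntegral_mono' (measurableSet_unitDomain K) fun y hy ↦ ?_
  rw [← ENNReal.ofReal_add (Real.rpow_nonneg (twistedNorm_nonneg _ _) _) (hκ0 x)]
  refine ENNReal.ofReal_le_ofReal ?_
  set m : ℝ := d * s with hm
  have hm0 : -m ≠ 0 := by nlinarith
  have hδle {z : 𝓞 K} (hz : z ≠ 0) : δ ≤ twistedNorm (traceZeroExtend y) (z : K) := by
    have := (h y hy z).1
    have := one_le_twistedNorm_zero hz
    nlinarith
  rcases eq_or_ne (x + a) 0 with h0 | h0
  · rw [h0]
    simp only [map_zero, twistedNorm_zero, Real.zero_rpow hm0]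
    exact add_nonneg (Real.rpow_nonneg (twistedNorm_nonneg _ _) _) (hκ0 x)
  rcases eq_or_ne x 0 with rfl | hx
  · have hd1 : -(d + 1) ≠ 0 := by linarith
    simp only [κ, map_zero, twistedNorm_zero, Real.zero_rpow hm0, if_true, zero_add,
      Real.zero_rpow hd1, mul_zero, add_zero] at h0 ⊢
    calc twistedNorm (traceZeroExtend y) (a : K) ^ (-m) ≤ δ ^ (-m) :=
          Real.rpow_le_rpow_of_nonpos hδ (hδle h0) (by nlinarith)
      _ ≤ δ ^ (-(2 * d)) := Real.rpow_le_rpow_of_exponent_ge hδ hδ1 (by nlinarith)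
  · have huv : twistedNorm (traceZeroExtend y) (x : K) ≤
        twistedNorm (traceZeroExtend y) ((x + a : 𝓞 K) : K) + A := by
      have h1 := twistedNorm_add_le (traceZeroExtend y) ((x + a : 𝓞 K) : K) (-(a : K))
      have hxa : ((x + a : 𝓞 K) : K) = x + a := map_add (algebraMap (𝓞 K) K) x a
      rw [twistedNorm_neg, hxa, add_neg_cancel_right, ← hxa] at h1
      refine h1.trans ?_
      gcongr
      rw [hA, ← div_eq_inv_mul, le_div_iff₀' hδ]
      exact (h y hy a).2
    refine (Real.rpow_neg_le_rpow_neg_add hd hδ hδ1 hA0 (hδle h0) (hδle hx) huv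
      (by nlinarith) (by nlinarith)).trans ?_
    simp only [κ, hx, if_false, zero_add]
    rw [mul_assoc c, ← Real.mul_rpow hδ.le (twistedNorm_nonneg _ _)]
    have := one_le_twistedNorm_zero hx
    have hp : 0 < δ * twistedNorm 0 (x : K) := by positivity
    exact add_le_add le_rfl (mul_le_mul_of_nonneg_left
      (Real.rpow_le_rpow_of_nonpos hp (h y hy x).1 (by linarith)) hc0)

variable (K)

theorem idealWeightConst_ne_top {s : ℝ} (hs : 1 < s) : idealWeightConst K s ≠ ⊤ := by
  have h := tsum_units_idealWeight K s (one_ne_zero (α := K))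
  simp only [map_one, Rat.cast_one, abs_one, Real.one_rpow, ENNReal.ofReal_one, mul_one] at h
  rw [← h]
  exact ((ENNReal.tsum_comp_le_tsum_of_injective Units.val_injective
    fun x : 𝓞 K ↦ idealWeight s (x : K)).trans_lt (tsum_idealWeight_ne_top hs).lt_top).ne

theorem exists_le_idealWeightConst :
    ∃ c : ENNReal, c ≠ 0 ∧ ∀ s : ℝ, 1 < s → s ≤ 2 → c ≤ idealWeightConst K s := by
  obtain ⟨δ, hδ, hδ1, h⟩ := exists_mul_twistedNorm_le K
  have hd : (0 : ℝ) < finrank ℚ K := by exact_mod_cast finrank_pos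
  refine ⟨ENNReal.ofReal (δ ^ (2 * finrank ℚ K : ℝ)) * volume (unitDomain K),
    mul_ne_zero (by simp; positivity) (volume_unitDomain_ne_zero K), fun s hs hs2 ↦ ?_⟩
  have hcard : (1 : ENNReal) ≤ (ENat.card (torsion K) : ENNReal) := by
    have : 1 ≤ ENat.card (torsion K) := (ENat.one_le_card_iff_nonempty _).mpr inferInstance
    exact_mod_cast this
  rw [idealWeightConst, ← setLIntegral_const]
  grw [← hcard, one_mul, ← setLIntegral_le_lintegral (unitDomain K)]
  refine setLIntegral_mono' (measurableSet_unitDomain K) fun y hy ↦ ENNReal.ofReal_le_ofReal ?_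
  have h1 : twistedNorm 0 (1 : K) ≤ 1 := by
    rw [twistedNorm_le_iff zero_le_one]
    simp
  have h2 : twistedNorm (traceZeroExtend y) (1 : K) ≤ δ⁻¹ := by
    have := (h y hy 1).2
    rw [← one_div, le_div_iff₀' hδ]
    linarith
  have h3 : 0 < twistedNorm (traceZeroExtend y) (1 : K) := by
    have h4 := (h y hy 1).1
    have h5 := one_le_twistedNorm_zero (one_ne_zero (α := 𝓞 K))
    simp only [map_one] at h5
    exact (by positivity : 0 < δ * twistedNorm 0 (1 : K)).trans_le h4
  calc δ ^ (2 * finrank ℚ K : ℝ) ≤ δ ^ (finrank ℚ K * s) :=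
        Real.rpow_le_rpow_of_exponent_ge hδ hδ1 (by nlinarith)
    _ = δ⁻¹ ^ (-(finrank ℚ K * s)) := by
        rw [Real.inv_rpow hδ.le, ← Real.rpow_neg hδ.le, neg_neg]
    _ ≤ _ := Real.rpow_le_rpow_of_nonpos h3 h2 (by nlinarith)

end weight

namespace AddSubgroup

variable {A : Type*} [AddCommGroup A] (J : AddSubgroup A)

theorem tsum_eq_tsum_quotient_out (f : A → ENNReal) :
    ∑' x, f x = ∑' (q : A ⧸ J) (j : J), f (j + q.out) := by
  have hbij : Function.Bijective fun p : (A ⧸ J) × J ↦ (p.2 + p.1.out : A) := by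
    refine ⟨fun p p' h ↦ ?_, fun x ↦ ?_⟩
    · have h1 : p.1 = p'.1 := by
        have := congrArg (QuotientAddGroup.mk (s := J)) h
        simpa [QuotientAddGroup.mk_add, (QuotientAddGroup.eq_zero_iff _).mpr p.2.2,
          (QuotientAddGroup.eq_zero_iff _).mpr p'.2.2] using this
      refine Prod.ext h1 (Subtype.ext ?_)
      simpa [h1] using h
    · refine ⟨(x, ⟨x - (x : A ⧸ J).out, ?_⟩), by simp⟩
      rw [← QuotientAddGroup.eq_zero_iff]
      simp
  rw [← (Equiv.ofBijective _ hbij).tsum_eq, ENNReal.tsum_prod']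
  rfl

/-- If the translates of the weights `w s` differ from `w s` by summable errors which are uniform
in `s`, then the sums of `w s` over the cosets of `J` agree up to a uniformly bounded error. -/
theorem exists_index_mul_tsum_le [J.FiniteIndex] {σ : Type*} (S : Set σ) (w : σ → A → ENNReal)
    (h : ∀ a, ∃ g : A → ENNReal, ∑' x, g x ≠ ⊤ ∧ ∀ s ∈ S, ∀ x, w s (x + a) ≤ w s x + g x) :
    ∃ G : ENNReal, G ≠ ⊤ ∧ ∀ s ∈ S, ∑' x, w s x ≤ J.index * ∑' x : J, w s x + G ∧
      J.index * ∑' x : J, w s x ≤ ∑' x, w s x + G := by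
  choose g hg hw using h
  have := Fintype.ofFinite (A ⧸ J)
  have hcard (a : ENNReal) : ∑' _ : A ⧸ J, a = J.index * a := by
    rw [tsum_fintype, Finset.sum_const, Finset.card_univ, index_eq_card, Nat.card_eq_fintype_card,
      nsmul_eq_mul]
  refine ⟨∑ q : A ⧸ J, (∑' x, g q.out x + ∑' x, g (-q.out) x), ?_, fun s hs ↦ ⟨?_, ?_⟩⟩
  · exact (ENNReal.sum_lt_top.mpr fun q _ ↦ ENNReal.add_lt_top.mpr
      ⟨(hg _).lt_top, (hg _).lt_top⟩).ne
  · rw [J.tsum_eq_tsum_quotient_out, ← hcard, ← tsum_fintype (L := .unconditional _),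
      ← ENNReal.tsum_add]
    refine ENNReal.tsum_le_tsum fun q ↦ ?_
    calc ∑' j : J, w s (j + q.out) ≤ ∑' j : J, (w s j + g q.out j) :=
          ENNReal.tsum_le_tsum fun j ↦ hw _ _ hs _
      _ = ∑' j : J, w s j + ∑' j : J, g q.out j := ENNReal.tsum_add
      _ ≤ _ := by
        gcongr
        exact (ENNReal.tsum_comp_le_tsum_of_injective Subtype.val_injective _).trans le_self_add
  · rw [J.tsum_eq_tsum_quotient_out, ← hcard, ← tsum_fintype (L := .unconditional _),
      ← ENNReal.tsum_add]
    refine ENNReal.tsum_le_tsum fun q ↦ ?_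
    calc ∑' j : J, w s j ≤ ∑' j : J, (w s (j + q.out) + g (-q.out) (j + q.out)) := by
          refine ENNReal.tsum_le_tsum fun j ↦ ?_
          simpa using hw (-q.out) s hs (j + q.out)
      _ = ∑' j : J, w s (j + q.out) + ∑' j : J, g (-q.out) (j + q.out) := ENNReal.tsum_add
      _ ≤ _ := by
        gcongr
        exact (ENNReal.tsum_comp_le_tsum_of_injective (f := fun j : J ↦ (j + q.out : A))
          (fun j j' hj ↦ Subtype.ext (add_right_cancel hj)) _).trans le_add_self

end AddSubgroup

section classes

open Module nonZeroDivisors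

variable {K : Type*} [Field K] [NumberField K]

/-- The partial zeta function of an ideal class, as an extended nonnegative real. -/
noncomputable def eclassZeta (C : ClassGroup (𝓞 K)) (s : ℝ) : ENNReal :=
  ∑' I : {I : (Ideal (𝓞 K))⁰ // ClassGroup.mk0 I = C},
    ENNReal.ofReal ((Ideal.absNorm (I.1 : Ideal (𝓞 K)) : ℝ) ^ (-s))

theorem tsum_mem_idealWeight {s : ℝ} (hs : 0 < s) (J : (Ideal (𝓞 K))⁰) :
    ∑' x : (J : Ideal (𝓞 K)), idealWeight s ((x : 𝓞 K) : K) =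
      idealWeightConst K s * (ENNReal.ofReal ((Ideal.absNorm (J : Ideal (𝓞 K)) : ℝ) ^ (-s)) *
        eclassZeta (ClassGroup.mk0 J)⁻¹ s) := by
  have hgen (I : {I : (Ideal (𝓞 K))⁰ // ClassGroup.mk0 I = (ClassGroup.mk0 J)⁻¹}) :
      ∃ x : 𝓞 K, (I.1 * J : Ideal (𝓞 K)) = Ideal.span {x} := by
    have h1 : ClassGroup.mk0 (I.1 * J) = 1 := by rw [map_mul, I.2, inv_mul_cancel]
    exact ((ClassGroup.mk0_eq_one_iff (I.1 * J).2).mp h1).principal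
  choose gen hgen using hgen
  have hJ0 : (J : Ideal (𝓞 K)) ≠ 0 := nonZeroDivisors.ne_zero J.2
  have hgen0 I : gen I ≠ 0 := by
    intro h
    have h1 := hgen I
    rw [h, Ideal.span_singleton_zero] at h1
    exact mul_ne_zero (nonZeroDivisors.ne_zero I.1.2) hJ0 h1
  have hmem (I) (u : (𝓞 K)ˣ) : (u : 𝓞 K) * gen I ∈ (J : Ideal (𝓞 K)) := by
    have h1 : gen I ∈ (I.1 * J : Ideal (𝓞 K)) := by
      rw [hgen I]
      exact Ideal.mem_span_singleton_self _
    exact Ideal.mul_mem_left _ _ (Ideal.mul_le_right h1)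
  let e : (Σ _ : {I : (Ideal (𝓞 K))⁰ // ClassGroup.mk0 I = (ClassGroup.mk0 J)⁻¹}, (𝓞 K)ˣ) →
      (J : Ideal (𝓞 K)) := fun p ↦ ⟨p.2 * gen p.1, hmem p.1 p.2⟩
  have he : Function.Injective e := by
    rintro ⟨I, u⟩ ⟨I', u'⟩ h
    have h1 : (u : 𝓞 K) * gen I = u' * gen I' := congrArg Subtype.val h
    have h2 : I = I' := by
      refine Subtype.ext (Subtype.ext (mul_right_cancel₀ hJ0 ?_))
      rw [hgen, hgen, ← Ideal.span_singleton_mul_left_unit u.isUnit (gen I), h1,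
        Ideal.span_singleton_mul_left_unit u'.isUnit]
    subst h2
    rw [Units.ext (mul_right_cancel₀ (hgen0 I) h1)]
  have hsupp : Function.support (fun x : (J : Ideal (𝓞 K)) ↦ idealWeight s ((x : 𝓞 K) : K)) ⊆
      Set.range e := by
    intro x hx
    have hx0 : (x : 𝓞 K) ≠ 0 := by
      intro h
      simp [h, idealWeight_zero hs] at hx
    obtain ⟨I, hI⟩ := Ideal.dvd_span_singleton.mpr x.2
    have hI0 : I ∈ (Ideal (𝓞 K))⁰ := by
      refine mem_nonZeroDivisors_of_ne_zero fun h ↦ hx0 ?_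
      rw [h, mul_zero] at hI
      simpa using hI
    have hIc : ClassGroup.mk0 ⟨I, hI0⟩ = (ClassGroup.mk0 J)⁻¹ := by
      rw [eq_inv_iff_mul_eq_one, ← map_mul]
      refine (ClassGroup.mk0_eq_one_iff _).mpr ⟨x, ?_⟩
      rw [mul_comm]
      exact hI.symm
    have h1 : Ideal.span {gen ⟨⟨I, hI0⟩, hIc⟩} = Ideal.span {(x : 𝓞 K)} := by
      rw [← hgen, hI, mul_comm]
    obtain ⟨u, hu⟩ := Ideal.span_singleton_eq_span_singleton.mp h1
    refine ⟨⟨⟨⟨I, hI0⟩, hIc⟩, u⟩, Subtype.ext ?_⟩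
    rw [← hu, mul_comm]
  rw [← he.tsum_eq hsupp, ENNReal.tsum_sigma', eclassZeta, ← ENNReal.tsum_mul_left,
    ← ENNReal.tsum_mul_left]
  refine tsum_congr fun I ↦ ?_
  have h1 : (|Algebra.norm ℚ (gen I : K)| : ℝ) =
      Ideal.absNorm (J : Ideal (𝓞 K)) * Ideal.absNorm (I.1 : Ideal (𝓞 K)) := by
    rw [← Nat.cast_mul, ← map_mul, mul_comm, hgen, Ideal.absNorm_span_singleton,
      ← Algebra.coe_norm_int, Nat.cast_natAbs]
    push_cast
    rfl
  rw [← ENNReal.ofReal_mul (by positivity), ← Real.mul_rpow (by positivity) (by positivity), ← h1,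
    ← tsum_units_idealWeight K s (by exact_mod_cast hgen0 I)]
  refine tsum_congr fun u ↦ ?_
  simp [e]

end classes

section classes

open Module nonZeroDivisors

variable {K : Type*} [Field K] [NumberField K]

/-- The partial zeta function of an ideal class. -/
noncomputable def classZeta (C : ClassGroup (𝓞 K)) (s : ℝ) : ℝ :=
  ∑' I : {I : (Ideal (𝓞 K))⁰ // ClassGroup.mk0 I = C},
    (Ideal.absNorm (I.1 : Ideal (𝓞 K)) : ℝ) ^ (-s)

theorem summable_classZeta (C : ClassGroup (𝓞 K)) {s : ℝ} (hs : 1 < s) :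
    Summable fun I : {I : (Ideal (𝓞 K))⁰ // ClassGroup.mk0 I = C} ↦
      (Ideal.absNorm (I.1 : Ideal (𝓞 K)) : ℝ) ^ (-s) :=
  (summable_absNorm_rpow K hs).comp_injective
    (Subtype.val_injective.comp Subtype.val_injective)

theorem eclassZeta_eq_ofReal (C : ClassGroup (𝓞 K)) {s : ℝ} (hs : 1 < s) :
    eclassZeta C s = ENNReal.ofReal (classZeta C s) :=
  (ENNReal.ofReal_tsum_of_nonneg (fun _ ↦ by positivity) (summable_classZeta C hs)).symm

theorem classZeta_nonneg (C : ClassGroup (𝓞 K)) (s : ℝ) : 0 ≤ classZeta C s :=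
  tsum_nonneg fun _ ↦ by positivity

theorem classZeta_le (C : ClassGroup (𝓞 K)) {s : ℝ} (hs : 1 < s) :
    classZeta C s ≤ ∑' I : Ideal (𝓞 K), (Ideal.absNorm I : ℝ) ^ (-s) :=
  (summable_classZeta C hs).tsum_le_tsum_of_inj _
    (Subtype.val_injective.comp Subtype.val_injective) (fun _ _ ↦ by positivity)
    (fun _ ↦ le_rfl) (summable_absNorm_rpow K hs)

theorem tsum_idealWeight {s : ℝ} (hs : 0 < s) :
    ∑' x : 𝓞 K, idealWeight s (x : K) = idealWeightConst K s * eclassZeta (1 : ClassGroup (𝓞 K)) s := by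
  have h := tsum_mem_idealWeight hs (1 : (Ideal (𝓞 K))⁰)
  simp only [map_one, inv_one, OneMemClass.coe_one, Nat.cast_one, Real.one_rpow,
    ENNReal.ofReal_one, one_mul] at h
  rw [← h, Ideal.one_eq_top]
  exact ((Submodule.topEquiv (R := 𝓞 K) (M := 𝓞 K)).toEquiv.tsum_eq
    fun x : 𝓞 K ↦ idealWeight s (x : K)).symm

variable (K)

theorem exists_eventually_absNorm_rpow_mul_classZeta_le (J : (Ideal (𝓞 K))⁰) :
    ∃ M : ℝ, ∀ᶠ s in 𝓝[>] (1 : ℝ),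
      |classZeta (1 : ClassGroup (𝓞 K)) s - (Ideal.absNorm (J : Ideal (𝓞 K)) : ℝ) ^ (1 - s) *
        classZeta (ClassGroup.mk0 J)⁻¹ s| ≤ M := by
  set N : ℝ := (Ideal.absNorm (J : Ideal (𝓞 K)) : ℝ) with hN
  have hidx : (J : Ideal (𝓞 K)).toAddSubgroup.index = Ideal.absNorm (J : Ideal (𝓞 K)) := rfl
  have hN0 : Ideal.absNorm (J : Ideal (𝓞 K)) ≠ 0 := Ideal.absNorm_ne_zero_of_nonZeroDivisors J
  have hNpos : 0 < N := by rw [hN]; exact_mod_cast Nat.pos_of_ne_zero hN0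
  have : (J : Ideal (𝓞 K)).toAddSubgroup.FiniteIndex := ⟨by rwa [hidx]⟩
  obtain ⟨G, hG, h⟩ := (J : Ideal (𝓞 K)).toAddSubgroup.exists_index_mul_tsum_le
    (Set.Ioc (1 : ℝ) 2) (fun s x ↦ idealWeight s (x : K)) fun a ↦ by
      obtain ⟨g, hg, hw⟩ := exists_idealWeight_add_le a
      exact ⟨g, hg, fun s hs ↦ hw s hs.1 hs.2⟩
  obtain ⟨c₀, hc₀, hc⟩ := exists_le_idealWeightConst K
  refine ⟨G.toReal / c₀.toReal, ?_⟩
  filter_upwards [Ioc_mem_nhdsGT one_lt_two] with s hs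
  have hs1 : 1 < s := hs.1
  have hct := idealWeightConst_ne_top K hs1
  have hc₀t : c₀ ≠ ⊤ := ne_top_of_le_ne_top hct (hc s hs.1 hs.2)
  have hc₀pos : 0 < c₀.toReal := ENNReal.toReal_pos hc₀ hc₀t
  have hk : c₀.toReal ≤ (idealWeightConst K s).toReal := ENNReal.toReal_mono hct (hc s hs.1 hs.2)
  obtain ⟨h1, h2⟩ := h s hs
  have hJ := tsum_mem_idealWeight (zero_lt_one.trans hs1) J
  have hpow : N * N ^ (-s) = N ^ (1 - s) := by
    rw [sub_eq_add_neg, Real.rpow_add hNpos, Real.rpow_one]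
  change _ ≤ _ * (∑' x : (J : Ideal (𝓞 K)), idealWeight s ((x : 𝓞 K) : K)) + _ at h1
  change _ * (∑' x : (J : Ideal (𝓞 K)), idealWeight s ((x : 𝓞 K) : K)) ≤ _ at h2
  have hcast : ((J : Ideal (𝓞 K)).toAddSubgroup.index : ENNReal) = ENNReal.ofReal N := by
    rw [hidx, hN, ENNReal.ofReal_natCast]
  set k := (idealWeightConst K s).toReal with hkdef
  have hkpos : 0 < k := hc₀pos.trans_le hk
  set ZC := classZeta (ClassGroup.mk0 J)⁻¹ s
  set Z1 := classZeta (1 : ClassGroup (𝓞 K)) s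
  have hZC : 0 ≤ ZC := classZeta_nonneg _ _
  have hZ1 : 0 ≤ Z1 := classZeta_nonneg _ _
  have hp : 0 ≤ N ^ (-s) := by positivity
  rw [hJ, tsum_idealWeight (zero_lt_one.trans hs1), eclassZeta_eq_ofReal _ hs1,
    eclassZeta_eq_ofReal _ hs1, ← ENNReal.ofReal_toReal hct, ← ENNReal.ofReal_toReal hG, hcast,
    ← ENNReal.ofReal_mul hkpos.le, ← ENNReal.ofReal_mul hp, ← ENNReal.ofReal_mul hkpos.le,
    ← ENNReal.ofReal_mul hNpos.le, ← ENNReal.ofReal_add (by positivity) (by positivity),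
    ENNReal.ofReal_le_ofReal_iff (by positivity)] at h1 h2
  rw [show N * (k * (N ^ (-s) * ZC)) = k * (N ^ (1 - s) * ZC) by rw [← hpow]; ring] at h1 h2
  have h3 : k * |Z1 - N ^ (1 - s) * ZC| ≤ G.toReal := by
    rw [← abs_of_pos hkpos, ← abs_mul, abs_le]
    constructor <;> linarith
  rw [le_div_iff₀' hc₀pos]
  exact (mul_le_mul_of_nonneg_right hk (abs_nonneg _)).trans h3

/-- The partial zeta functions of any two ideal classes have the same singular part at `1`. -/
theorem exists_eventually_abs_classZeta_sub_le :
    ∃ M : ℝ, ∀ᶠ s in 𝓝[>] (1 : ℝ), ∀ C : ClassGroup (𝓞 K),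
      |classZeta C s - classZeta (1 : ClassGroup (𝓞 K)) s| ≤ M := by
  have key (C : ClassGroup (𝓞 K)) :
      ∃ M : ℝ, ∀ᶠ s in 𝓝[>] (1 : ℝ), |classZeta C s - classZeta (1 : ClassGroup (𝓞 K)) s| ≤ M := by
    obtain ⟨J, hJ⟩ := ClassGroup.mk0_surjective C⁻¹
    obtain ⟨M, hM⟩ := exists_eventually_absNorm_rpow_mul_classZeta_le K J
    rw [hJ, inv_inv] at hM
    set N : ℝ := (Ideal.absNorm (J : Ideal (𝓞 K)) : ℝ) with hN
    have hN1 : 1 ≤ N := by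
      rw [hN]
      exact_mod_cast Nat.one_le_iff_ne_zero.mpr (Ideal.absNorm_ne_zero_of_nonZeroDivisors J)
    refine ⟨M + Real.log N * (dedekindZeta_residue K + 1), ?_⟩
    filter_upwards [hM, self_mem_nhdsWithin, (tendsto_sub_one_mul_tsum_absNorm_rpow K).eventually
      (eventually_le_nhds (lt_add_one _))] with s h1 (hs : 1 < s) h2
    have h3 : 1 - N ^ (1 - s) ≤ (s - 1) * Real.log N := by
      have := Real.add_one_le_exp (Real.log N * (1 - s))
      rw [Real.rpow_def_of_pos (by linarith)]
      linarith
    have h4 : N ^ (1 - s) ≤ 1 := Real.rpow_le_one_of_one_le_of_nonpos hN1 (by linarith)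
    have h5 : |classZeta C s - N ^ (1 - s) * classZeta C s| ≤
        Real.log N * (dedekindZeta_residue K + 1) := by
      have hC := classZeta_nonneg C s
      have hlog := Real.log_nonneg hN1
      rw [show classZeta C s - N ^ (1 - s) * classZeta C s =
        (1 - N ^ (1 - s)) * classZeta C s by ring, abs_of_nonneg (by nlinarith)]
      calc (1 - N ^ (1 - s)) * classZeta C s ≤ (s - 1) * Real.log N *
            ∑' I : Ideal (𝓞 K), (Ideal.absNorm I : ℝ) ^ (-s) :=
          mul_le_mul h3 (classZeta_le C hs) hC (mul_nonneg (by linarith) hlog)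
        _ = Real.log N * ((s - 1) * ∑' I : Ideal (𝓞 K), (Ideal.absNorm I : ℝ) ^ (-s)) := by ring
        _ ≤ _ := by gcongr
    rw [abs_le] at h1 h5 ⊢
    constructor <;> linarith [h1.1, h1.2, h5.1, h5.2]
  choose M hM using key
  refine ⟨∑ C, |M C|, ?_⟩
  filter_upwards [eventually_all.mpr hM] with s hs C
  exact (hs C).trans ((le_abs_self _).trans
    (Finset.single_le_sum (f := fun C ↦ |M C|) (fun _ _ ↦ abs_nonneg _) (Finset.mem_univ C)))

end classes

section upper

open nonZeroDivisors IsDedekindDomain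

/-- The ideal class of a nonzero prime. -/
noncomputable def primeClass {R : Type*} [CommRing R] [IsDedekindDomain R]
    (p : HeightOneSpectrum R) : ClassGroup R :=
  ClassGroup.mk0 ⟨p.asIdeal, mem_nonZeroDivisors_iff_ne_zero.2 p.ne_bot⟩

section idealZeta

variable (K : Type*) [Field K] [NumberField K]

/-- The Dedekind zeta function at a real argument, as a sum over ideals. -/
noncomputable def idealZeta (s : ℝ) : ℝ := ∑' I : Ideal (𝓞 K), (Ideal.absNorm I : ℝ) ^ (-s)

/-- The multiplicative map `I ↦ N(I)⁻ˢ`. -/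
noncomputable def absNormRpow {s : ℝ} (hs : 0 < s) : Ideal (𝓞 K) →*₀ ℝ where
  toFun I := (Ideal.absNorm I : ℝ) ^ (-s)
  map_zero' := by simp [hs.ne']
  map_one' := by simp
  map_mul' I J := by rw [map_mul, Nat.cast_mul, Real.mul_rpow (by positivity) (by positivity)]

@[simp]
theorem absNormRpow_apply {s : ℝ} (hs : 0 < s) (I : Ideal (𝓞 K)) :
    absNormRpow K hs I = (Ideal.absNorm I : ℝ) ^ (-s) := rfl

variable {K}

theorem one_lt_absNorm_prime (p : HeightOneSpectrum (𝓞 K)) : 1 < Ideal.absNorm p.asIdeal := by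
  have h0 : Ideal.absNorm p.asIdeal ≠ 0 := by
    rw [Ne, Ideal.absNorm_eq_zero_iff]; exact p.ne_bot
  have h1 : Ideal.absNorm p.asIdeal ≠ 1 := by
    rw [Ne, Ideal.absNorm_eq_one_iff]; exact p.isPrime.ne_top
  omega

theorem absNorm_prime_rpow_pos (p : HeightOneSpectrum (𝓞 K)) (s : ℝ) :
    0 < (Ideal.absNorm p.asIdeal : ℝ) ^ (-s) :=
  Real.rpow_pos_of_pos (by exact_mod_cast zero_lt_one.trans (one_lt_absNorm_prime p)) _

theorem absNorm_prime_rpow_lt_one (p : HeightOneSpectrum (𝓞 K)) {s : ℝ} (hs : 0 < s) :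
    (Ideal.absNorm p.asIdeal : ℝ) ^ (-s) < 1 :=
  Real.rpow_lt_one_of_one_lt_of_neg (by exact_mod_cast one_lt_absNorm_prime p) (by linarith)

theorem idealZeta_antitone {s t : ℝ} (hs : 1 < s) (hst : s ≤ t) : idealZeta K t ≤ idealZeta K s := by
  refine (summable_absNorm_rpow K (hs.trans_le hst)).tsum_le_tsum (fun I ↦ ?_)
    (summable_absNorm_rpow K hs)
  rcases (Ideal.absNorm I).eq_zero_or_pos with h | h
  · rw [h, Nat.cast_zero, Real.zero_rpow (by linarith), Real.zero_rpow (by linarith)]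
  · exact Real.rpow_le_rpow_of_exponent_le (by exact_mod_cast h) (by linarith)

theorem one_le_idealZeta {s : ℝ} (hs : 1 < s) : 1 ≤ idealZeta K s := by
  have := one_le_prod_one_sub_mul_tsum (absNormRpow K (zero_lt_one.trans hs))
    (summable_absNorm_rpow K hs) (fun I ↦ by simp only [absNormRpow_apply]; positivity) ∅
  simpa [idealZeta] using this

/-- A lower bound, uniform in `s`, for partial products of the inverse Euler product at `2 * s`. -/
theorem one_le_prod_one_sub_sq_mul_idealZeta {s : ℝ} (hs : 1 < s)
    (T : Finset (HeightOneSpectrum (𝓞 K))) :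
    1 ≤ (∏ p ∈ T, (1 - ((Ideal.absNorm p.asIdeal : ℝ) ^ (-s)) ^ 2)) * idealZeta K 2 := by
  have h := one_le_prod_one_sub_mul_tsum (absNormRpow K (s := s * 2) (by linarith))
    (summable_absNorm_rpow K (by linarith)) (fun I ↦ by simp only [absNormRpow_apply]; positivity) T
  simp only [absNormRpow_apply] at h
  refine h.trans ?_
  have h2 : ∀ p : HeightOneSpectrum (𝓞 K), (Ideal.absNorm p.asIdeal : ℝ) ^ (-(s * 2)) =
      ((Ideal.absNorm p.asIdeal : ℝ) ^ (-s)) ^ 2 := fun p ↦ by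
    rw [← Real.rpow_mul_natCast (by positivity)]; congr 1; push_cast; ring
  simp_rw [h2]
  refine mul_le_mul_of_nonneg_left (idealZeta_antitone one_lt_two (by linarith)) ?_
  refine Finset.prod_nonneg fun p _ ↦ ?_
  have := absNorm_prime_rpow_lt_one p (zero_lt_one.trans hs)
  have := absNorm_prime_rpow_pos p s
  nlinarith

end idealZeta

theorem mul_pow_le_two_mul_pow {Z E Q z b : ℝ} {n : ℕ} (hZ : 0 ≤ Z) (hE : 0 ≤ E) (hQ : 0 ≤ Q)
    (hz : 0 ≤ z) (hQz : 1 ≤ Q * z) (hb : E * Q ≤ b) (h : Z * b ^ n ≤ 2) :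
    Z * E ^ n ≤ 2 * z ^ n :=
  calc Z * E ^ n ≤ Z * E ^ n * (Q * z) ^ n := le_mul_of_one_le_right (by positivity) (one_le_pow₀ hQz)
    _ = Z * (E * Q) ^ n * z ^ n := by ring
    _ ≤ Z * b ^ n * z ^ n := by gcongr
    _ ≤ 2 * z ^ n := by gcongr

open scoped Classical in
theorem eventually_idealZeta_mul_prod_pow_le (F L : Type*) [Field F] [NumberField F] [Field L]
    [NumberField L] [Algebra F L] {H : Subgroup (ClassGroup (𝓞 F))}
    (hH : (ClassGroup.relNorm (𝓞 F) (𝓞 L)).range ≤ H) {s : ℝ} (hs : 1 < s) :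
    ∀ᶠ T : Finset (HeightOneSpectrum (𝓞 F)) in atTop,
      idealZeta L s * (∏ p ∈ T with primeClass p ∈ H,
        (1 - (Ideal.absNorm p.asIdeal : ℝ) ^ (-s))) ^ Module.finrank F L ≤
      2 * idealZeta F 2 ^ Module.finrank F L := by
  set n := Module.finrank F L with hn
  have hs0 : 0 < s := zero_lt_one.trans hs
  obtain ⟨T', hT'⟩ := ((tendsto_prod_one_sub_mul_tsum (absNormRpow L hs0)
    (summable_absNorm_rpow L hs).norm).eventually (eventually_le_nhds one_lt_two)).exists
  simp only [absNormRpow_apply] at hT'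
  change _ * idealZeta L s ≤ 2 at hT'
  filter_upwards [eventually_ge_atTop (T'.image fun P ↦ P.under (𝓞 F))] with T hT
  set t : HeightOneSpectrum (𝓞 F) → ℝ := fun p ↦ (Ideal.absNorm p.asIdeal : ℝ) ^ (-s) with ht
  have ht0 : ∀ p, 0 < t p := fun p ↦ absNorm_prime_rpow_pos p s
  have ht1 : ∀ p, t p < 1 := fun p ↦ absNorm_prime_rpow_lt_one p hs0
  have ht2 : ∀ p, 0 ≤ 1 - t p ^ 2 ∧ 1 - t p ^ 2 ≤ 1 := fun p ↦ by
    constructor <;> nlinarith [ht0 p, ht1 p]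
  let b : HeightOneSpectrum (𝓞 F) → ℝ := fun p ↦ if primeClass p ∈ H then 1 - t p else 1 - t p ^ 2
  have hb0 : ∀ p, 0 ≤ b p := fun p ↦ by
    simp only [b]; split_ifs
    exacts [by linarith [ht1 p], (ht2 p).1]
  have hb1 : ∀ p, b p ≤ 1 := fun p ↦ by
    simp only [b]; split_ifs
    exacts [by linarith [ht0 p], (ht2 p).2]
  have hPb : ∀ P : HeightOneSpectrum (𝓞 L),
      b (P.under (𝓞 F)) ≤ 1 - (Ideal.absNorm P.asIdeal : ℝ) ^ (-s) := fun P ↦ by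
    set p := P.under (𝓞 F) with hp
    have := P.isMaximal
    have := p.isMaximal
    have : P.asIdeal.LiesOver p.asIdeal := ⟨rfl⟩
    have hf := Ideal.inertiaDeg_pos P.asIdeal (𝓞 F)
    have hN : (Ideal.absNorm P.asIdeal : ℝ) ^ (-s) = t p ^ P.asIdeal.inertiaDeg (𝓞 F) := by
      rw [← Ideal.absNorm_relNorm (𝓞 F) (𝓞 L) P.asIdeal,
        Ideal.relNorm_eq_pow_of_isMaximal P.asIdeal p.asIdeal, map_pow, Nat.cast_pow,
        ← Real.rpow_natCast, ← Real.rpow_mul (by positivity), mul_comm,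
        Real.rpow_mul (by positivity), Real.rpow_natCast]
    rw [hN]
    simp only [b]
    split_ifs with h
    · have := pow_le_pow_of_le_one (ht0 p).le (ht1 p).le hf
      linarith
    · suffices 2 ≤ P.asIdeal.inertiaDeg (𝓞 F) by
        have := pow_le_pow_of_le_one (ht0 p).le (ht1 p).le this
        linarith
      by_contra hlt
      have h1 : P.asIdeal.inertiaDeg (𝓞 F) = 1 := by omega
      refine h (hH ⟨primeClass P, ?_⟩)
      have := ClassGroup.relNorm_mk0_prime (𝓞 F) P
      rwa [h1, pow_one] at this
  have key : (∏ p ∈ T, b p) ^ n ≤ ∏ P ∈ T', (1 - (Ideal.absNorm P.asIdeal : ℝ) ^ (-s)) := by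
    have hmap : ∀ P ∈ T', P.under (𝓞 F) ∈ T := fun P hP ↦ hT (Finset.mem_image_of_mem _ hP)
    rw [← Finset.prod_fiberwise_of_maps_to hmap, ← Finset.prod_pow]
    refine Finset.prod_le_prod (fun p _ ↦ pow_nonneg (hb0 p) _) fun p _ ↦ ?_
    calc b p ^ n ≤ b p ^ (T'.filter fun P ↦ P.under (𝓞 F) = p).card :=
          pow_le_pow_of_le_one (hb0 p) (hb1 p) (by
            rw [hn, ← finrank_ringOfIntegers]; exact card_filter_under_le _ _ _)
      _ = ∏ P ∈ T' with P.under (𝓞 F) = p, b p := by rw [Finset.prod_const]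
      _ ≤ _ := Finset.prod_le_prod (fun _ _ ↦ hb0 p) fun P hP ↦ by
          rw [← (Finset.mem_filter.1 hP).2]; exact hPb P
  set E := ∏ p ∈ T with primeClass p ∈ H, (1 - t p) with hE
  have hE0 : 0 ≤ E := Finset.prod_nonneg fun p _ ↦ by linarith [ht1 p]
  have hbE : E * ∏ p ∈ T, (1 - t p ^ 2) ≤ ∏ p ∈ T, b p := by
    rw [hE, Finset.prod_filter, ← Finset.prod_mul_distrib]
    refine Finset.prod_le_prod (fun p _ ↦ mul_nonneg ?_ (ht2 p).1) fun p _ ↦ ?_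
    · split_ifs
      exacts [by linarith [ht1 p], zero_le_one]
    · simp only [b]
      split_ifs
      · exact mul_le_of_le_one_right (by linarith [ht1 p]) (ht2 p).2
      · rw [one_mul]
  have hQ := one_le_prod_one_sub_sq_mul_idealZeta hs T
  refine mul_pow_le_two_mul_pow (zero_le_one.trans (one_le_idealZeta hs)) hE0
    (Finset.prod_nonneg fun p _ ↦ (ht2 p).1) (zero_le_one.trans (one_le_idealZeta one_lt_two))
    hQ hbE ?_
  rw [mul_comm]
  exact (mul_le_mul_of_nonneg_right key (zero_le_one.trans (one_le_idealZeta hs))).trans hT'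

end upper

section lower

open nonZeroDivisors IsDedekindDomain

theorem AddChar.prod_norm_one_sub_mul_sq_le {A : Type*} [AddCommGroup A] [Finite A]
    [DecidableEq A] (a : A) {t : ℝ} (ht1 : t ≤ 1) :
    (∏ ψ : AddChar A ℂ, ‖1 - ψ a * t‖) ^ 2 ≤
      (if a = 0 then (1 - t) ^ Nat.card A else 1) ^ 2 * Real.exp (Nat.card A * t ^ 2) := by
  have := Fintype.ofFinite A
  rw [Nat.card_eq_fintype_card]
  split_ifs with ha
  · subst ha
    have : ‖(1 : ℂ) - t‖ = 1 - t := by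
      rw [← Complex.ofReal_one, ← Complex.ofReal_sub, Complex.norm_real, Real.norm_of_nonneg]
      linarith
    simp only [AddChar.map_zero_eq_one, one_mul, this, Finset.prod_const, Finset.card_univ,
      AddChar.card_eq]
    exact le_mul_of_one_le_right (by positivity) (Real.one_le_exp (by positivity))
  · have hsum : ∑ ψ : AddChar A ℂ, (ψ a).re = 0 := by
      have := AddChar.sum_apply_eq_ite a
      rw [if_neg ha] at this
      rw [← Complex.re_sum, this, Complex.zero_re]
    have hle : ∀ ψ : AddChar A ℂ, ‖1 - ψ a * t‖ ^ 2 ≤ Real.exp (-2 * t * (ψ a).re + t ^ 2) :=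
      fun ψ ↦ by
      have h1 : ‖1 - ψ a * t‖ ^ 2 = 1 - 2 * t * (ψ a).re + t ^ 2 := by
        have h2 : (ψ a).re ^ 2 + (ψ a).im ^ 2 = 1 := by
          have := Complex.normSq_apply (ψ a)
          rw [Complex.normSq_eq_norm_sq, AddChar.norm_apply] at this
          linarith
        rw [← Complex.normSq_eq_norm_sq, Complex.normSq_apply]
        simp only [Complex.sub_re, Complex.one_re, Complex.mul_re, Complex.ofReal_re,
          Complex.ofReal_im, Complex.sub_im, Complex.one_im, Complex.mul_im]
        linear_combination t ^ 2 * h2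
      rw [h1]
      have := Real.add_one_le_exp (-2 * t * (ψ a).re + t ^ 2)
      linarith
    rw [one_pow, one_mul, ← Finset.prod_pow]
    refine (Finset.prod_le_prod (fun _ _ ↦ by positivity) fun ψ _ ↦ hle ψ).trans_eq ?_
    rw [← Real.exp_sum, Finset.sum_add_distrib, ← Finset.mul_sum, hsum, Finset.sum_const,
      Finset.card_univ, AddChar.card_eq]
    simp

variable {K : Type*} [Field K] [NumberField K]

open scoped Classical in
/-- The twist of `I ↦ N(I)⁻ˢ` by a character of the class group. -/
noncomputable def classTwist (φ : ClassGroup (𝓞 K) →* ℂ) {s : ℝ} (hs : 0 < s) :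
    Ideal (𝓞 K) →*₀ ℂ where
  toFun I := if h : I ∈ (Ideal (𝓞 K))⁰ then
    φ (ClassGroup.mk0 ⟨I, h⟩) * absNormRpow K hs I else 0
  map_zero' := dif_neg zero_notMem_nonZeroDivisors
  map_one' := by
    rw [dif_pos (one_mem _), map_one, Complex.ofReal_one, mul_one]
    exact (congrArg φ (map_one ClassGroup.mk0)).trans (map_one φ)
  map_mul' I J := by
    by_cases hI : I ∈ (Ideal (𝓞 K))⁰
    · by_cases hJ : J ∈ (Ideal (𝓞 K))⁰
      · rw [dif_pos (mul_mem hI hJ), dif_pos hI, dif_pos hJ, map_mul, Complex.ofReal_mul,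
          mul_mul_mul_comm, ← map_mul, ← map_mul]
        rfl
      · rw [dif_neg hJ, mul_zero, dif_neg fun h ↦ hJ (mul_mem_nonZeroDivisors.1 h).2]
    · rw [dif_neg hI, zero_mul, dif_neg fun h ↦ hI (mul_mem_nonZeroDivisors.1 h).1]

theorem classTwist_apply (φ : ClassGroup (𝓞 K) →* ℂ) {s : ℝ} (hs : 0 < s) (I : (Ideal (𝓞 K))⁰) :
    classTwist φ hs I = φ (ClassGroup.mk0 I) * ((Ideal.absNorm (I : Ideal (𝓞 K)) : ℝ) ^ (-s) : ℝ) :=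
  dif_pos I.2

theorem norm_classTwist_le (φ : ClassGroup (𝓞 K) →* ℂ) (hφ : ∀ C, ‖φ C‖ = 1) {s : ℝ} (hs : 0 < s)
    (I : Ideal (𝓞 K)) : ‖classTwist φ hs I‖ ≤ (Ideal.absNorm I : ℝ) ^ (-s) := by
  by_cases hI : I ∈ (Ideal (𝓞 K))⁰
  · rw [classTwist_apply φ hs ⟨I, hI⟩, norm_mul, hφ, one_mul, Complex.norm_real,
      Real.norm_of_nonneg (by positivity)]
  · rw [show classTwist φ hs I = 0 from dif_neg hI, norm_zero]
    positivity

theorem summable_norm_classTwist (φ : ClassGroup (𝓞 K) →* ℂ) (hφ : ∀ C, ‖φ C‖ = 1) {s : ℝ}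
    (hs : 1 < s) : Summable fun I ↦ ‖classTwist φ (zero_lt_one.trans hs) I‖ :=
  (summable_absNorm_rpow K hs).of_nonneg_of_le (fun _ ↦ norm_nonneg _)
    (norm_classTwist_le φ hφ _)

theorem tsum_classTwist (φ : ClassGroup (𝓞 K) →* ℂ) (hφ : ∀ C, ‖φ C‖ = 1) {s : ℝ} (hs : 1 < s) :
    ∑' I, classTwist φ (zero_lt_one.trans hs) I = ∑ C, φ C * classZeta C s := by
  have hs0 := zero_lt_one.trans hs
  have hsum : Summable (classTwist φ hs0) := (summable_norm_classTwist φ hφ hs).of_norm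
  let e := Equiv.sigmaFiberEquiv (fun I : (Ideal (𝓞 K))⁰ ↦ ClassGroup.mk0 I)
  have hsum' : Summable fun x ↦ classTwist φ hs0 (e x : (Ideal (𝓞 K))⁰) :=
    hsum.comp_injective (Subtype.val_injective.comp e.injective)
  have hsupp : Function.support (classTwist φ hs0) ⊆
      Set.range (Subtype.val : (Ideal (𝓞 K))⁰ → Ideal (𝓞 K)) := fun I hI ↦ by
    by_contra h
    exact hI (dif_neg fun hI' ↦ h ⟨⟨I, hI'⟩, rfl⟩)
  rw [← Subtype.val_injective.tsum_eq hsupp, ← e.tsum_eq, hsum'.tsum_sigma, tsum_fintype]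
  refine Finset.sum_congr rfl fun C _ ↦ ?_
  rw [classZeta, Complex.ofReal_tsum, ← tsum_mul_left]
  refine tsum_congr fun I ↦ ?_
  rw [show e ⟨C, I⟩ = I.1 from rfl, classTwist_apply, I.2]

theorem norm_tsum_classTwist_le (φ : ClassGroup (𝓞 K) →* ℂ) (hφ : ∀ C, ‖φ C‖ = 1) {s : ℝ}
    (hs : 1 < s) : ‖∑' I, classTwist φ (zero_lt_one.trans hs) I‖ ≤ idealZeta K s :=
  tsum_of_norm_bounded (summable_absNorm_rpow K hs).hasSum (norm_classTwist_le φ hφ _)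

theorem norm_tsum_classTwist_le_card_mul (φ : ClassGroup (𝓞 K) →* ℂ) (hφ : ∀ C, ‖φ C‖ = 1)
    (hφ0 : ∑ C, φ C = 0) {s : ℝ} (hs : 1 < s) {M : ℝ}
    (hM : ∀ C : ClassGroup (𝓞 K), |classZeta C s - classZeta (1 : ClassGroup (𝓞 K)) s| ≤ M) :
    ‖∑' I, classTwist φ (zero_lt_one.trans hs) I‖ ≤ Fintype.card (ClassGroup (𝓞 K)) * M := by
  have : ∑ C, φ C * classZeta C s =
      ∑ C, φ C * (classZeta C s - classZeta (1 : ClassGroup (𝓞 K)) s : ℝ) := by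
    simp_rw [Complex.ofReal_sub, mul_sub]
    rw [Finset.sum_sub_distrib, ← Finset.sum_mul, hφ0, zero_mul, sub_zero]
  rw [tsum_classTwist φ hφ hs, this, ← nsmul_eq_mul, ← Finset.card_univ, ← Finset.sum_const]
  refine norm_sum_le_of_le _ fun C _ ↦ ?_
  rw [norm_mul, hφ, one_mul, Complex.norm_real]
  exact hM C

end lower

section index

open nonZeroDivisors IsDedekindDomain

/-- The character of `G` attached to an additive character of the quotient `G ⧸ H`. -/
def quotientCharacter {G : Type*} [CommGroup G] (H : Subgroup G) (ψ : AddChar (Additive (G ⧸ H)) ℂ) :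
    G →* ℂ where
  toFun g := ψ (Additive.ofMul (g : G ⧸ H))
  map_one' := ψ.map_zero_eq_one
  map_mul' g h := ψ.map_add_eq_mul (Additive.ofMul (g : G ⧸ H)) (Additive.ofMul (h : G ⧸ H))

theorem sum_quotientCharacter {G : Type*} [CommGroup G] [Fintype G] (H : Subgroup G)
    (ψ : AddChar (Additive (G ⧸ H)) ℂ) (hψ : ψ ≠ 0) : ∑ g, quotientCharacter H ψ g = 0 := by
  let χ := ψ.compAddMonoidHom (QuotientGroup.mk' H).toAdditive
  have hχ : χ ≠ 0 := fun h ↦ hψ <| by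
    ext a
    obtain ⟨g, hg⟩ := QuotientGroup.mk_surjective a.toMul
    have := DFunLike.congr_fun h (Additive.ofMul g)
    rw [← ofMul_toMul a, ← hg]
    exact this
  have : Fintype (Additive G) := ‹Fintype G›
  exact (Additive.ofMul.sum_comp χ).trans (AddChar.sum_eq_zero_iff_ne_zero.2 hχ)

variable {K : Type*} [Field K] [NumberField K]

theorem sum_absNorm_prime_rpow_sq_le {s : ℝ} (hs : 1 < s) (T : Finset (HeightOneSpectrum (𝓞 K))) :
    ∑ p ∈ T, ((Ideal.absNorm p.asIdeal : ℝ) ^ (-s)) ^ 2 ≤ idealZeta K 2 := by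
  have hinj : Function.Injective (HeightOneSpectrum.asIdeal (R := 𝓞 K)) :=
    fun _ _ ↦ HeightOneSpectrum.ext
  have hsum := summable_absNorm_rpow K one_lt_two
  calc ∑ p ∈ T, ((Ideal.absNorm p.asIdeal : ℝ) ^ (-s)) ^ 2
      ≤ ∑ p ∈ T, (Ideal.absNorm p.asIdeal : ℝ) ^ (-2 : ℝ) := by
        refine Finset.sum_le_sum fun p _ ↦ ?_
        rw [← Real.rpow_mul_natCast (by positivity)]
        refine Real.rpow_le_rpow_of_exponent_le
          (by exact_mod_cast (one_lt_absNorm_prime p).le) ?_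
        push_cast
        linarith
    _ ≤ ∑' p : HeightOneSpectrum (𝓞 K), (Ideal.absNorm p.asIdeal : ℝ) ^ (-2 : ℝ) :=
        (hsum.comp_injective hinj).sum_le_tsum T fun _ _ ↦ by positivity
    _ ≤ idealZeta K 2 :=
        (hsum.comp_injective hinj).tsum_le_tsum_of_inj _ hinj (fun _ _ ↦ by positivity)
          (fun _ ↦ le_rfl) hsum

open scoped Classical in
theorem prod_norm_prod_one_sub_classTwist_le (H : Subgroup (ClassGroup (𝓞 K))) {s : ℝ} (hs : 1 < s)
    (T : Finset (HeightOneSpectrum (𝓞 K))) :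
    ∏ ψ : AddChar (Additive (ClassGroup (𝓞 K) ⧸ H)) ℂ, ‖∏ p ∈ T,
        (1 - classTwist (quotientCharacter H ψ) (zero_lt_one.trans hs) p.asIdeal)‖ ≤
      (∏ p ∈ T with primeClass p ∈ H, (1 - (Ideal.absNorm p.asIdeal : ℝ) ^ (-s))) ^ H.index *
        Real.exp (H.index * idealZeta K 2) := by
  have hs0 := zero_lt_one.trans hs
  set t : HeightOneSpectrum (𝓞 K) → ℝ := fun p ↦ (Ideal.absNorm p.asIdeal : ℝ) ^ (-s) with ht
  have ht1 : ∀ p, 0 < 1 - t p := fun p ↦ sub_pos.2 (absNorm_prime_rpow_lt_one p hs0)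
  set E := ∏ p ∈ T with primeClass p ∈ H, (1 - t p) with hE
  have hE0 : 0 ≤ E := Finset.prod_nonneg fun p _ ↦ (ht1 p).le
  let a : HeightOneSpectrum (𝓞 K) → Additive (ClassGroup (𝓞 K) ⧸ H) :=
    fun p ↦ Additive.ofMul (primeClass p : ClassGroup (𝓞 K) ⧸ H)
  have ha : ∀ p, a p = 0 ↔ primeClass p ∈ H := fun p ↦ QuotientGroup.eq_one_iff _
  have hcard : Nat.card (Additive (ClassGroup (𝓞 K) ⧸ H)) = H.index := rfl
  refine le_of_sq_le_sq ?_ (by positivity)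
  calc (∏ ψ : AddChar (Additive (ClassGroup (𝓞 K) ⧸ H)) ℂ, ‖∏ p ∈ T,
        (1 - classTwist (quotientCharacter H ψ) hs0 p.asIdeal)‖) ^ 2
      = ∏ p ∈ T, (∏ ψ : AddChar (Additive (ClassGroup (𝓞 K) ⧸ H)) ℂ, ‖1 - ψ (a p) * t p‖) ^ 2 := by
        simp_rw [norm_prod]
        rw [Finset.prod_comm, ← Finset.prod_pow]
        refine Finset.prod_congr rfl fun p _ ↦ congrArg (· ^ 2) <|
          Finset.prod_congr rfl fun ψ _ ↦ ?_
        rw [classTwist_apply _ hs0 ⟨p.asIdeal, mem_nonZeroDivisors_iff_ne_zero.2 p.ne_bot⟩]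
        rfl
    _ ≤ ∏ p ∈ T, ((if primeClass p ∈ H then (1 - t p) ^ H.index else 1) ^ 2 *
          Real.exp (H.index * t p ^ 2)) := by
        refine Finset.prod_le_prod (fun _ _ ↦ by positivity) fun p _ ↦ ?_
        have := AddChar.prod_norm_one_sub_mul_sq_le (a p) (sub_pos.1 (ht1 p)).le
        simpa only [ha, hcard] using this
    _ = (E ^ H.index) ^ 2 * Real.exp (H.index * ∑ p ∈ T, t p ^ 2) := by
        rw [Finset.prod_mul_distrib, Finset.prod_pow, ← Finset.prod_filter, Finset.prod_pow,
          ← Real.exp_sum, Finset.mul_sum]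
    _ ≤ (E ^ H.index) ^ 2 * Real.exp (H.index * idealZeta K 2) ^ 2 := by
        refine mul_le_mul_of_nonneg_left ?_ (by positivity)
        refine (Real.exp_le_exp.2 (mul_le_mul_of_nonneg_left (sum_absNorm_prime_rpow_sq_le hs T)
          (by positivity))).trans ?_
        refine le_self_pow₀ (Real.one_le_exp ?_) two_ne_zero
        exact mul_nonneg (by positivity) (zero_le_one.trans (one_le_idealZeta one_lt_two))
    _ = (E ^ H.index * Real.exp (H.index * idealZeta K 2)) ^ 2 := (mul_pow _ _ _).symm

open scoped Classical in
theorem exists_eventually_one_le_mul_prod_pow (H : Subgroup (ClassGroup (𝓞 K))) :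
    ∃ C : ℝ, ∀ᶠ s in 𝓝[>] (1 : ℝ), ∀ᶠ T : Finset (HeightOneSpectrum (𝓞 K)) in atTop,
      1 ≤ C * idealZeta K s * (∏ p ∈ T with primeClass p ∈ H,
        (1 - (Ideal.absNorm p.asIdeal : ℝ) ^ (-s))) ^ H.index := by
  obtain ⟨M, hM⟩ := exists_eventually_abs_classZeta_sub_le K
  let X := AddChar (Additive (ClassGroup (𝓞 K) ⧸ H)) ℂ
  set B : ℝ := ∏ ψ ∈ (Finset.univ : Finset X).erase 0, (Fintype.card (ClassGroup (𝓞 K)) * M) with hB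
  refine ⟨2 * Real.exp (H.index * idealZeta K 2) * B, ?_⟩
  filter_upwards [hM, self_mem_nhdsWithin] with s hM hs
  replace hs : 1 < s := hs
  have hs0 := zero_lt_one.trans hs
  have hnorm : ∀ (ψ : X) C, ‖quotientCharacter H ψ C‖ = 1 := fun ψ C ↦ ψ.norm_apply _
  let Lf : X → ℂ := fun ψ ↦ ∑' I, classTwist (quotientCharacter H ψ) hs0 I
  have hL : ∏ ψ, ‖Lf ψ‖ ≤ idealZeta K s * B := by
    rw [← Finset.mul_prod_erase _ _ (Finset.mem_univ 0)]
    refine mul_le_mul (norm_tsum_classTwist_le _ (hnorm 0) hs) ?_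
      (Finset.prod_nonneg fun _ _ ↦ norm_nonneg _) (zero_le_one.trans (one_le_idealZeta hs))
    refine Finset.prod_le_prod (fun _ _ ↦ norm_nonneg _) fun ψ hψ ↦ ?_
    exact norm_tsum_classTwist_le_card_mul _ (hnorm ψ)
      (sum_quotientCharacter H ψ (Finset.ne_of_mem_erase hψ)) hs hM
  have hlim : Tendsto (fun T : Finset (HeightOneSpectrum (𝓞 K)) ↦ ∏ ψ : X,
      ‖(∏ p ∈ T, (1 - classTwist (quotientCharacter H ψ) hs0 p.asIdeal)) * Lf ψ‖)
      atTop (𝓝 (∏ _ψ : X, ‖(1 : ℂ)‖)) :=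
    tendsto_finsetProd _ fun ψ _ ↦ (tendsto_prod_one_sub_mul_tsum _
      (summable_norm_classTwist _ (hnorm ψ) hs)).norm
  rw [norm_one, Finset.prod_const_one] at hlim
  filter_upwards [hlim.eventually (eventually_ge_nhds one_half_lt_one)] with T hT
  simp_rw [norm_mul] at hT
  rw [Finset.prod_mul_distrib] at hT
  have hP := prod_norm_prod_one_sub_classTwist_le H hs T
  set E := (∏ p ∈ T with primeClass p ∈ H, (1 - (Ideal.absNorm p.asIdeal : ℝ) ^ (-s))) ^ H.index
  have h := hT.trans (mul_le_mul hP hL (Finset.prod_nonneg fun _ _ ↦ norm_nonneg _)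
    ((Finset.prod_nonneg fun _ _ ↦ norm_nonneg _).trans hP))
  linarith

theorem le_of_one_le_mul_pow {Z z C D E : ℝ} {h n : ℕ} (hZ : 0 ≤ Z) (hE : 0 ≤ E)
    (h1 : 1 ≤ C * z * E ^ h) (h2 : Z * E ^ n ≤ D) : Z ^ h ≤ D ^ h * C ^ n * z ^ n := by
  have hCz : 0 ≤ C * z := by
    by_contra hneg
    have : C * z * E ^ h ≤ 0 := mul_nonpos_of_nonpos_of_nonneg (not_le.1 hneg).le (by positivity)
    linarith
  calc Z ^ h ≤ Z ^ h * (C * z * E ^ h) ^ n :=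
        le_mul_of_one_le_right (by positivity) (one_le_pow₀ h1)
    _ = (Z * E ^ n) ^ h * (C * z) ^ n := by ring
    _ ≤ D ^ h * (C * z) ^ n := by gcongr
    _ = D ^ h * C ^ n * z ^ n := by ring

theorem exists_eventually_idealZeta_pow_le (F L : Type*) [Field F] [NumberField F] [Field L]
    [NumberField L] [Algebra F L] {H : Subgroup (ClassGroup (𝓞 F))}
    (hH : (ClassGroup.relNorm (𝓞 F) (𝓞 L)).range ≤ H) :
    ∃ D : ℝ, ∀ᶠ s in 𝓝[>] (1 : ℝ),
      idealZeta L s ^ H.index ≤ D * idealZeta F s ^ Module.finrank F L := by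
  classical
  obtain ⟨C, hC⟩ := exists_eventually_one_le_mul_prod_pow H
  refine ⟨(2 * idealZeta F 2 ^ Module.finrank F L) ^ H.index * C ^ Module.finrank F L, ?_⟩
  filter_upwards [hC, self_mem_nhdsWithin] with s hC hs
  replace hs : 1 < s := hs
  obtain ⟨T, hT1, hT2⟩ := (hC.and (eventually_idealZeta_mul_prod_pow_le F L hH hs)).exists
  refine le_of_one_le_mul_pow (zero_le_one.trans (one_le_idealZeta hs))
    (Finset.prod_nonneg fun p _ ↦ ?_) hT1 hT2
  exact sub_nonneg.2 (absNorm_prime_rpow_lt_one p (zero_lt_one.trans hs)).le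

/-- The index of the image of the norm map on class groups is at most the degree. -/
theorem index_range_relNorm_le_finrank (F L : Type*) [Field F] [NumberField F] [Field L]
    [NumberField L] [Algebra F L] :
    (ClassGroup.relNorm (𝓞 F) (𝓞 L)).range.index ≤ Module.finrank F L := by
  obtain ⟨D, hbound⟩ := exists_eventually_idealZeta_pow_le F L le_rfl
  generalize (ClassGroup.relNorm (𝓞 F) (𝓞 L)).range.index = h at hbound ⊢
  generalize Module.finrank F L = n at hbound ⊢
  by_contra! hlt
  have hlim1 := (tendsto_sub_one_mul_tsum_absNorm_rpow L).pow h
  have hsub : Tendsto (fun s : ℝ ↦ (s - 1) ^ (h - n)) (𝓝[>] 1) (𝓝 0) := by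
    have : Tendsto (fun s : ℝ ↦ (s - 1) ^ (h - n)) (𝓝 1) (𝓝 ((1 - 1) ^ (h - n))) :=
      ((continuous_id.sub continuous_const).pow _).tendsto 1
    rw [sub_self, zero_pow (Nat.sub_pos_of_lt hlt).ne'] at this
    exact this.mono_left nhdsWithin_le_nhds
  have hlim2 := (((tendsto_sub_one_mul_tsum_absNorm_rpow F).pow n).const_mul D).mul hsub
  rw [mul_zero] at hlim2
  refine (pow_pos (dedekindZeta_residue_pos L) h).not_ge
    (le_of_tendsto_of_tendsto hlim1 hlim2 ?_)
  filter_upwards [hbound, self_mem_nhdsWithin] with s hs hs1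
  have hs1' : 0 ≤ s - 1 := sub_nonneg.2 (le_of_lt hs1)
  change ((s - 1) * idealZeta L s) ^ h ≤
    D * ((s - 1) * idealZeta F s) ^ n * (s - 1) ^ (h - n)
  calc ((s - 1) * idealZeta L s) ^ h = (s - 1) ^ h * idealZeta L s ^ h :=
        mul_pow _ _ _
    _ ≤ (s - 1) ^ h * (D * idealZeta F s ^ n) := by gcongr
    _ = (s - 1) ^ (n + (h - n)) * (D * idealZeta F s ^ n) := by
        rw [Nat.add_sub_cancel' hlt.le]
    _ = _ := by rw [pow_add, mul_pow (s - 1) (idealZeta F s) n]; ring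

end index

/-- For an extension `L/F` of number fields and any integer `ℓ > 1`,
`|Cl_L[ℓ]| · h_F ≤ [L : F] · |Cl_F[ℓ]| · h_L`. -/
theorem ltorsion_relative_bound (ℓ : ℕ) (hℓ : 1 < ℓ)
    (F L : Type) [Field F] [NumberField F] [Field L] [NumberField L] [Algebra F L] :
    ellTorsion L ℓ * classNumber F ≤
      Module.finrank F L * ellTorsion F ℓ * classNumber L := by
  have h := card_torsion_mul_card_le_of_index_range_le (ClassGroup.relNorm (𝓞 F) (𝓞 L))
    (index_range_relNorm_le_finrank F L) ℓ
  rwa [Nat.card_eq_fintype_card (α := ClassGroup (𝓞 F)),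
    Nat.card_eq_fintype_card (α := ClassGroup (𝓞 L))] at h
end
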